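/- Let f : G → G be a graph map with zero topological entropy. Then f is Li–Yorke chaotic if and only if there exists an NS-pair for f. -/

import Mathlib

open Set Filter Topology

/-- An arc in `X` with endpoints `a` and `b`: the image of a continuous injection
of `[0,1]` sending `0` to `a` and `1` to `b`. -/
def IsArcWithEnds {X : Type*} [TopologicalSpace X] (A : Set X) (a b : X) : Prop :=
  ∃ φ : Set.Icc (0:ℝ) 1 → X, Continuous φ ∧ Function.Injective φ ∧
    Set.range φ = A ∧ φ ⟨0, by norm_num⟩ = a ∧ φ ⟨1, by norm_num⟩ = b

/-- A topological graph: a compact connected (metrizable) space which is a union of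
finitely many arcs, any two of which are either disjoint or intersect in exactly one
common endpoint. -/
def IsTopGraph (X : Type*) [TopologicalSpace X] : Prop :=
  CompactSpace X ∧ ConnectedSpace X ∧
  ∃ (n : ℕ) (A : Fin n → Set X) (a b : Fin n → X),
    (∀ i, IsArcWithEnds (A i) (a i) (b i)) ∧
    (⋃ i, A i) = Set.univ ∧
    ∀ i j, i ≠ j →
      A i ∩ A j = ∅ ∨
      ∃ p, A i ∩ A j = {p} ∧ p ∈ ({a i, b i} : Set X) ∧ p ∈ ({a j, b j} : Set X)

/-- A subgraph of `G`: a closed connected subset which is itself a topological graph. -/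
def IsSubgraph {G : Type*} [TopologicalSpace G] (K : Set G) : Prop :=
  IsClosed K ∧ IsConnected K ∧ IsTopGraph ↥K

/-- A periodic subgraph with period `k`: `K, f(K), …, f^{k−1}(K)` are pairwise disjoint
and `f^k(K) = K`. -/
def IsPeriodicSubgraph {G : Type*} [TopologicalSpace G] (f : G → G) (K : Set G) (k : ℕ) :
    Prop :=
  IsSubgraph K ∧ 0 < k ∧ f^[k] '' K = K ∧
    ∀ i j, i < k → j < k → i ≠ j → Disjoint (f^[i] '' K) (f^[j] '' K)

/-- A cycle of graphs with period `k`: the orbit `⋃_{i<k} f^i(K)` of a periodic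
subgraph `K` with period `k`. -/
def IsCycleOfGraphs {G : Type*} [TopologicalSpace G] (f : G → G) (X : Set G) (k : ℕ) :
    Prop :=
  ∃ K, IsPeriodicSubgraph f K k ∧ X = ⋃ i ∈ Finset.range k, f^[i] '' K

/-- The ω-limit set of `x` under `f`. -/
def omegaSet {G : Type*} [TopologicalSpace G] (f : G → G) (x : G) : Set G :=
  ⋂ n : ℕ, closure ((fun m => f^[m] x) '' Set.Ici n)

/-- `ω(f) = ⋃_{x} ω_f(x)`. -/
def omegaUnion {G : Type*} [TopologicalSpace G] (f : G → G) : Set G :=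
  ⋃ x, omegaSet f x

/-- A set `W` is a solenoid for `f` if it is infinite and is contained in cycles of
graphs of arbitrarily large periods. -/
def IsSolenoid {G : Type*} [TopologicalSpace G] (f : G → G) (W : Set G) : Prop :=
  W.Infinite ∧ ∀ n : ℕ, ∃ X k, n ≤ k ∧ IsCycleOfGraphs f X k ∧ W ⊆ X

/-- Two points are separable if they belong to two disjoint periodic subgraphs. -/
def SeparablePoints {G : Type*} [TopologicalSpace G] (f : G → G) (x y : G) : Prop :=
  ∃ I J kI kJ, IsPeriodicSubgraph f I kI ∧ IsPeriodicSubgraph f J kJ ∧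
    Disjoint I J ∧ x ∈ I ∧ y ∈ J

/-- An NS-pair: a pair of distinct points of `ω(f)` contained in a nested sequence of
periodic subgraphs whose periods tend to infinity. -/
def IsNSPair {G : Type*} [TopologicalSpace G] (f : G → G) (x y : G) : Prop :=
  x ≠ y ∧ x ∈ omegaUnion f ∧ y ∈ omegaUnion f ∧
  ∃ (J : ℕ → Set G) (m : ℕ → ℕ),
    (∀ n, IsPeriodicSubgraph f (J n) (m n)) ∧
    (∀ n, J (n + 1) ⊆ J n) ∧
    Filter.Tendsto m Filter.atTop Filter.atTop ∧
    ∀ n, x ∈ J n ∧ y ∈ J n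

/-- The pair `⟨x,y⟩` is proximal. -/
def Proximal {G : Type*} [PseudoMetricSpace G] (f : G → G) (x y : G) : Prop :=
  ∀ ε > (0 : ℝ), ∀ N : ℕ, ∃ n ≥ N, dist (f^[n] x) (f^[n] y) < ε

/-- The pair `⟨x,y⟩` is asymptotic. -/
def Asymptotic {G : Type*} [PseudoMetricSpace G] (f : G → G) (x y : G) : Prop :=
  Filter.Tendsto (fun n => dist (f^[n] x) (f^[n] y)) Filter.atTop (nhds 0)

/-- A scrambled pair is proximal but not asymptotic. -/
def ScrambledPair {G : Type*} [PseudoMetricSpace G] (f : G → G) (x y : G) : Prop :=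
  Proximal f x y ∧ ¬ Asymptotic f x y

/-- Li–Yorke chaos: existence of an uncountable scrambled set. -/
def LiYorkeChaotic {G : Type*} [PseudoMetricSpace G] (f : G → G) : Prop :=
  ∃ S : Set G, ¬ S.Countable ∧ ∀ x ∈ S, ∀ y ∈ S, x ≠ y → ScrambledPair f x y

/-- `I ⊆ ℕ` is an independence set for the pair of sets `{A, B}`. -/
def IsIndepSet {G : Type*} (f : G → G) (A B : Set G) (I : Set ℕ) : Prop :=
  ∀ J : Finset ℕ, ↑J ⊆ I → J.Nonempty → ∀ S : ℕ → Bool,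
    (⋂ i ∈ J, f^[i] ⁻¹' (if S i then A else B)).Nonempty

/-- An IN-pair: every pair of neighborhoods has arbitrarily large finite
independence sets. -/
def IsINPair {G : Type*} [TopologicalSpace G] (f : G → G) (x y : G) : Prop :=
  ∀ U V : Set G, U ∈ nhds x → V ∈ nhds y →
    ∀ n : ℕ, ∃ I : Finset ℕ, n ≤ I.card ∧ IsIndepSet f U V ↑I

/-- An IT-pair: every pair of neighborhoods has an infinite independence set. -/
def IsITPair {G : Type*} [TopologicalSpace G] (f : G → G) (x y : G) : Prop :=
  ∀ U V : Set G, U ∈ nhds x → V ∈ nhds y →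
    ∃ I : Set ℕ, I.Infinite ∧ IsIndepSet f U V I

/-- The set of periodic points of `f`. -/
def PerPts {G : Type*} (f : G → G) : Set G :=
  {p | ∃ n ≥ 1, f^[n] p = p}

/-- A parametrisation of an edge: a continuous map from the line, injective on `[0,1]`, whose
restriction to `(0,1)` has open image. -/
structure IsChart {X : Type*} [TopologicalSpace X] (φ : ℝ → X) : Prop where
  cont : Continuous φ
  inj : InjOn φ (Icc 0 1)
  isOpen : IsOpen (φ '' Ioo 0 1)

theorem IsChart.mem_image_Ioo {X : Type*} [TopologicalSpace X] {φ : ℝ → X}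
    (hφ : IsChart φ) {a b t : ℝ} (ha : 0 ≤ a) (hb : b ≤ 1)
    (ht : t ∈ Icc (0:ℝ) 1) : φ t ∈ φ '' Ioo a b ↔ t ∈ Ioo a b := by
  constructor
  · rintro ⟨s, hs, h⟩
    rwa [← hφ.inj ⟨by linarith [hs.1], by linarith [hs.2]⟩ ht h]
  · exact fun h => ⟨t, h, rfl⟩

theorem IsChart.flip {X : Type*} [TopologicalSpace X] {φ : ℝ → X}
    (hφ : IsChart φ) : IsChart fun t => φ (1 - t) where
  cont := hφ.cont.comp (by fun_prop)
  inj := by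
    intro s hs t ht h
    have := hφ.inj (x₁ := 1 - s) (x₂ := 1 - t) (by constructor <;> linarith [hs.1, hs.2])
      (by constructor <;> linarith [ht.1, ht.2]) h
    linarith
  isOpen := by
    have : (fun t => φ (1 - t)) '' Ioo 0 1 = φ '' Ioo 0 1 := by
      have := image_comp φ (fun t : ℝ => 1 - t) (Ioo 0 1)
      simp only [Set.image_const_sub_Ioo, sub_self, sub_zero] at this
      exact this
    rw [this]
    exact hφ.isOpen

section Charts

variable {X : Type*} [TopologicalSpace X] [T2Space X]

theorem IsTopGraph.exists_charts (h : IsTopGraph X) :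
    ∃ (n : ℕ) (φ : Fin n → ℝ → X), (∀ i, IsChart (φ i)) ∧ (⋃ i, φ i '' Icc 0 1) = univ ∧
      (∀ i j, i ≠ j → ∀ s ∈ Icc (0:ℝ) 1, ∀ t ∈ Icc (0:ℝ) 1, φ i s = φ j t →
        (s = 0 ∨ s = 1) ∧ (t = 0 ∨ t = 1)) ∧
      ∀ i j, i ≠ j → (φ i '' Icc 0 1 ∩ φ j '' Icc 0 1).Subsingleton := by
  obtain ⟨-, -, n, A, a, b, hA, hU, hI⟩ := h
  choose ψ hc hinj hr h0 h1 using hA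
  have im : ∀ i, (fun t : ℝ => ψ i (projIcc 0 1 zero_le_one t)) '' Icc 0 1 = A i := by
    intro i
    rw [← hr i]
    ext z
    constructor
    · rintro ⟨t, -, rfl⟩; exact ⟨_, rfl⟩
    · rintro ⟨t, rfl⟩
      exact ⟨t, t.2, by simp⟩
  have inj : ∀ i, InjOn (fun t : ℝ => ψ i (projIcc 0 1 zero_le_one t)) (Icc 0 1) := by
    intro i s hs t ht hst
    have := hinj i hst
    rw [projIcc_of_mem _ hs, projIcc_of_mem _ ht] at this
    simpa using this
  have cont : ∀ i, Continuous (fun t : ℝ => ψ i (projIcc 0 1 zero_le_one t)) :=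
    fun i => (hc i).comp continuous_projIcc
  have e0 : ∀ i, ψ i (projIcc 0 1 zero_le_one (0:ℝ)) = a i := by
    intro i; rw [← h0 i, projIcc_of_mem _ (by norm_num)]
  have e1 : ∀ i, ψ i (projIcc 0 1 zero_le_one (1:ℝ)) = b i := by
    intro i; rw [← h1 i, projIcc_of_mem _ (by norm_num)]
  have ends : ∀ i, ∀ s ∈ Icc (0:ℝ) 1, ψ i (projIcc 0 1 zero_le_one s) ∈ ({a i, b i} : Set X) →
      s = 0 ∨ s = 1 := by
    intro i s hs h
    rcases h with h | h
    · exact Or.inl (inj i hs (by norm_num) (h.trans (e0 i).symm))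
    · exact Or.inr (inj i hs (by norm_num) (Eq.trans h (e1 i).symm))
  have cross : ∀ i j, i ≠ j → ∀ s ∈ Icc (0:ℝ) 1, ∀ t ∈ Icc (0:ℝ) 1,
      ψ i (projIcc 0 1 zero_le_one s) = ψ j (projIcc 0 1 zero_le_one t) →
        (s = 0 ∨ s = 1) ∧ (t = 0 ∨ t = 1) := by
    intro i j hij s hs t ht hst
    have hm : ψ i (projIcc 0 1 zero_le_one s) ∈ A i ∩ A j := by
      refine ⟨im i ▸ ⟨s, hs, rfl⟩, im j ▸ ⟨t, ht, hst.symm⟩⟩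
    rcases hI i j hij with h | ⟨p, hp, hpi, hpj⟩
    · rw [h] at hm; exact hm.elim
    · rw [hp] at hm
      have hm' : _ = p := hm
      exact ⟨ends i s hs (hm' ▸ hpi), ends j t ht (hst ▸ hm' ▸ hpj)⟩
  refine ⟨n, fun i t => ψ i (projIcc 0 1 zero_le_one t), fun i => ⟨cont i, inj i, ?_⟩, ?_, cross,
    ?_⟩
  · have : (fun t : ℝ => ψ i (projIcc 0 1 zero_le_one t)) '' Ioo 0 1 =
        ((⋃ j ∈ {j | j ≠ i}, A j) ∪ {a i, b i})ᶜ := by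
      ext z
      constructor
      · rintro ⟨t, ht, rfl⟩ hz
        have ht' := Ioo_subset_Icc_self ht
        rcases hz with hz | hz
        · simp only [mem_iUnion] at hz
          obtain ⟨j, hj, hz⟩ := hz
          rw [← im j] at hz
          obtain ⟨s, hs, hst⟩ := hz
          have := (cross j i hj s hs t ht' hst).2
          rcases this with h | h
          · exact ht.1.ne' h
          · exact ht.2.ne h
        · rcases ends i t ht' hz with h | h
          · exact ht.1.ne' h
          · exact ht.2.ne h
      · intro hz
        rw [mem_compl_iff, mem_union, not_or] at hz
        have hzu : z ∈ ⋃ i, A i := hU ▸ mem_univ z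
        obtain ⟨j, hj⟩ := mem_iUnion.1 hzu
        have hji : j = i := by
          by_contra hne
          exact hz.1 (mem_biUnion (show j ∈ {j | j ≠ i} from hne) hj)
        subst hji
        rw [← im j] at hj
        obtain ⟨t, ht, rfl⟩ := hj
        refine ⟨t, ⟨lt_of_le_of_ne ht.1 ?_, lt_of_le_of_ne ht.2 ?_⟩, rfl⟩
        · rintro rfl; exact hz.2 (Or.inl (e0 j))
        · rintro rfl; exact hz.2 (Or.inr (e1 j))
    rw [this, isOpen_compl_iff]
    refine IsClosed.union ?_ (by simp)
    refine Set.Finite.isClosed_biUnion (Set.toFinite _) fun j _ => ?_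
    rw [← im j]
    exact (isCompact_Icc.image (cont j)).isClosed
  · simp only [im, hU]
  · intro i j hij
    simp only [im]
    rcases hI i j hij with h | ⟨p, hp, -⟩
    · rw [h]; exact subsingleton_empty
    · rw [hp]; exact subsingleton_singleton

variable {φ : ℝ → X}

theorem IsChart.isClosed_image_Icc (hφ : IsChart φ) (a b : ℝ) : IsClosed (φ '' Icc a b) :=
  (isCompact_Icc.image hφ.cont).isClosed

theorem IsChart.isOpen_image_Ioo (hφ : IsChart φ) {a b : ℝ} (ha : 0 ≤ a) (hb : b ≤ 1) :
    IsOpen (φ '' Ioo a b) := by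
  have : φ '' Ioo a b = φ '' Ioo 0 1 \ (φ '' Icc 0 a ∪ φ '' Icc b 1) := by
    ext z
    constructor
    · rintro ⟨t, ht, rfl⟩
      refine ⟨⟨t, ⟨ha.trans_lt ht.1, ht.2.trans_le hb⟩, rfl⟩, ?_⟩
      have ht01 : t ∈ Icc (0:ℝ) 1 := ⟨(ha.trans_lt ht.1).le, (ht.2.trans_le hb).le⟩
      rintro (⟨s, hs, h⟩ | ⟨s, hs, h⟩)
      · have := hφ.inj ⟨hs.1, by linarith [hs.2, ht.1, ht01.2]⟩ ht01 h
        linarith [hs.2, ht.1]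
      · have := hφ.inj ⟨by linarith [hs.1, ht.2, ht01.1], hs.2⟩ ht01 h
        linarith [hs.1, ht.2]
    · rintro ⟨⟨t, ht, rfl⟩, h⟩
      refine ⟨t, ⟨?_, ?_⟩, rfl⟩
      · by_contra! hh
        exact h (Or.inl ⟨t, ⟨ht.1.le, hh⟩, rfl⟩)
      · by_contra! hh
        exact h (Or.inr ⟨t, ⟨hh, ht.2.le⟩, rfl⟩)
  rw [this]
  exact hφ.isOpen.sdiff ((hφ.isClosed_image_Icc _ _).union (hφ.isClosed_image_Icc _ _))

/-- A preconnected set meeting an open piece of an edge but missing both ends of the piece is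
contained in the piece. -/
theorem IsChart.subset_of_notMem (hφ : IsChart φ) {K : Set X} (hK : IsPreconnected K)
    {a b c : ℝ} (ha : 0 ≤ a) (hab : a < b) (hbc : b < c) (hc : c ≤ 1)
    (hb : φ b ∈ K) (haK : φ a ∉ K) (hcK : φ c ∉ K) : K ⊆ φ '' Ioo a c := by
  refine hK.subset_left_of_subset_union (hφ.isOpen_image_Ioo ha hc)
    (hφ.isClosed_image_Icc a c).isOpen_compl ?_ ?_ ⟨φ b, hb, b, ⟨hab, hbc⟩, rfl⟩
  · exact disjoint_compl_right.mono_left (image_mono Ioo_subset_Icc_self)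
  · intro z hz
    by_cases h : z ∈ φ '' Icc a c
    · obtain ⟨t, ht, rfl⟩ := h
      left
      refine ⟨t, ⟨lt_of_le_of_ne ht.1 ?_, lt_of_le_of_ne ht.2 ?_⟩, rfl⟩
      · rintro rfl; exact haK hz
      · rintro rfl; exact hcK hz
    · exact Or.inr h

theorem IsChart.image_Icc_subset_or (hφ : IsChart φ) {K : Set X} (hK : IsPreconnected K)
    {a b c : ℝ} (ha : 0 ≤ a) (hab : a ≤ b) (hbc : b ≤ c) (hc : c ≤ 1)
    (hb : φ b ∈ K) (h : ¬ K ⊆ φ '' Ioo a c) : φ '' Icc a b ⊆ K ∨ φ '' Icc b c ⊆ K := by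
  by_contra! hcon
  obtain ⟨h1, h2⟩ := hcon
  obtain ⟨_, ⟨d, hd, rfl⟩, hdK⟩ := not_subset.1 h1
  obtain ⟨_, ⟨e, he, rfl⟩, heK⟩ := not_subset.1 h2
  have hdb : d < b := lt_of_le_of_ne hd.2 (by rintro rfl; exact hdK hb)
  have hbe : b < e := lt_of_le_of_ne he.1 (by rintro rfl; exact heK hb)
  refine h ((hφ.subset_of_notMem hK (ha.trans hd.1) hdb hbe (he.2.trans hc) hb hdK heK).trans ?_)
  exact image_mono (Ioo_subset_Ioo hd.1 he.2)

theorem IsTopGraph.exists_finite_chart_seq (h : IsTopGraph X) :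
    ∃ C : Set (ℝ → X), C.Finite ∧ (∀ φ ∈ C, IsChart φ) ∧ ∀ A : Set X, A.Infinite →
      ∃ φ ∈ C, ∃ r : ℕ → ℝ, StrictMono r ∧ (∀ k, r k ∈ Ioo (0:ℝ) 1) ∧ ∀ k, φ (r k) ∈ A := by
  obtain ⟨n, φ, hφ, hU, -⟩ := h.exists_charts
  refine ⟨range φ ∪ range fun i s => φ i (1 - s), (finite_range _).union (finite_range _), ?_,
    fun A hA => ?_⟩
  · rintro _ (⟨i, rfl⟩ | ⟨i, rfl⟩)
    exacts [hφ i, (hφ i).flip]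
  have : ∃ i, (Icc (0:ℝ) 1 ∩ φ i ⁻¹' A).Infinite := by
    by_contra! hcon
    refine hA ((Set.finite_iUnion fun i => (hcon i).image (φ i)).subset ?_)
    intro a ha
    obtain ⟨i, t, ht, rfl⟩ := mem_iUnion.1 (hU ▸ mem_univ a : a ∈ ⋃ i, φ i '' Icc 0 1)
    exact mem_iUnion.2 ⟨i, t, ⟨ht, ha⟩, rfl⟩
  obtain ⟨i, hi⟩ := this
  have hi' : (Ioo (0:ℝ) 1 ∩ φ i ⁻¹' A).Infinite := by
    refine (hi.sdiff (Set.toFinite {0, 1})).mono ?_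
    rintro t ⟨⟨ht, hA⟩, h01⟩
    simp only [mem_insert_iff, mem_singleton_iff, not_or] at h01
    exact ⟨⟨lt_of_le_of_ne ht.1 (Ne.symm h01.1), lt_of_le_of_ne ht.2 h01.2⟩, hA⟩
  set r := hi'.natEmbedding
  obtain ⟨g, hg⟩ := exists_increasing_or_nonincreasing_subseq (· < ·) fun k => (r k : ℝ)
  rcases hg with hg | hg
  · exact ⟨φ i, Or.inl ⟨i, rfl⟩, fun k => r (g k), fun a b hab => hg a b hab,
      fun k => (r (g k)).2.1, fun k => (r (g k)).2.2⟩
  · refine ⟨_, Or.inr ⟨i, rfl⟩, fun k => 1 - r (g k), fun a b hab => ?_, fun k => ?_, fun k => ?_⟩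
    · have h1 := hg a b hab
      have h2 : (r (g a) : ℝ) ≠ r (g b) := by
        intro h
        exact hab.ne (g.injective (r.injective (Subtype.ext h)))
      have : (r (g b) : ℝ) < r (g a) := lt_of_le_of_ne (not_lt.1 h1) h2.symm
      simp only
      linarith
    · have := (r (g k)).2.1
      constructor <;> simp only <;> linarith [this.1, this.2]
    · have := (r (g k)).2.2
      simpa using this

theorem IsTopGraph.exists_chart_seq (h : IsTopGraph X) {A : Set X} (hA : A.Infinite) :
    ∃ (φ : ℝ → X) (r : ℕ → ℝ), IsChart φ ∧ StrictMono r ∧ (∀ k, r k ∈ Ioo (0:ℝ) 1) ∧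
      ∀ k, φ (r k) ∈ A :=
  let ⟨_, _, hC, h⟩ := h.exists_finite_chart_seq
  let ⟨φ, hφ, r, hr⟩ := h A hA
  ⟨φ, r, hC φ hφ, hr⟩

end Charts

/-- A connected set of a graph avoiding a suitable finite set is small. -/
theorem IsTopGraph.exists_finite_dist_lt {X : Type*} [MetricSpace X] (h : IsTopGraph X)
    {ε : ℝ} (hε : 0 < ε) : ∃ F : Set X, F.Finite ∧ ∀ K : Set X, IsPreconnected K →
      Disjoint K F → ∀ p ∈ K, ∀ q ∈ K, dist p q < ε := by
  obtain ⟨n, φ, hφ, hU, -⟩ := h.exists_charts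
  have hδ : ∀ i, ∃ N : ℕ, 0 < N ∧ ∀ s ∈ Icc (0:ℝ) 1, ∀ t ∈ Icc (0:ℝ) 1, dist s t < 1 / N →
      dist (φ i s) (φ i t) < ε := by
    intro i
    have := isCompact_Icc.uniformContinuousOn_of_continuous
      ((hφ i).cont.continuousOn (s := Icc (0:ℝ) 1))
    obtain ⟨δ, hδ, h⟩ := Metric.uniformContinuousOn_iff.1 this ε hε
    obtain ⟨N, hN⟩ := exists_nat_one_div_lt hδ
    exact ⟨N + 1, Nat.succ_pos _, fun s hs t ht hst => h s hs t ht
      (hst.trans (by push_cast; exact hN))⟩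
  choose N hN hδ using hδ
  refine ⟨⋃ i, (fun k : ℕ => φ i (k / N i)) '' Iic (N i), Set.finite_iUnion fun i =>
    (Set.finite_Iic _).image _, fun K hK hKF p hp q hq => ?_⟩
  obtain ⟨i, t, ht, rfl⟩ := mem_iUnion.1 (hU ▸ mem_univ p : p ∈ ⋃ i, φ i '' Icc 0 1)
  have hNi : (0:ℝ) < N i := by exact_mod_cast hN i
  have notin : ∀ k : ℕ, k ≤ N i → φ i (k / N i) ∉ K := fun k hk hkK =>
    disjoint_left.1 hKF hkK (mem_iUnion.2 ⟨i, k, hk, rfl⟩)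
  set k := ⌊t * N i⌋₊
  have hk1 : (k:ℝ) ≤ t * N i := Nat.floor_le (mul_nonneg ht.1 hNi.le)
  have hk2 : t * N i < k + 1 := Nat.lt_floor_add_one _
  have hkt : (k:ℝ) / N i ≤ t := by rwa [div_le_iff₀ hNi]
  have htk : t < ((k + 1 : ℕ) : ℝ) / N i := by rw [lt_div_iff₀ hNi]; push_cast; exact hk2
  have hkN : k ≤ N i := by
    have : (k:ℝ) ≤ N i := hk1.trans (by nlinarith [ht.2])
    exact_mod_cast this
  have hlt : (k:ℝ) / N i < t := lt_of_le_of_ne hkt (by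
    intro h; rw [← h] at hp; exact notin k hkN hp)
  have hkN' : k + 1 ≤ N i := by
    have h1 : (k:ℝ) / N i < 1 := hlt.trans_le ht.2
    rw [div_lt_one hNi] at h1
    exact_mod_cast h1
  have hle1 : ((k + 1 : ℕ) : ℝ) / N i ≤ 1 := by
    rw [div_le_one hNi]; exact_mod_cast hkN'
  have hsub := (hφ i).subset_of_notMem hK (by positivity) hlt htk hle1 hp (notin k hkN)
    (notin _ hkN')
  obtain ⟨s, hs, rfl⟩ := hsub hq
  refine hδ i t ht s ⟨le_trans (by positivity) hs.1.le, hs.2.le.trans hle1⟩ ?_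
  have e : ((k + 1 : ℕ) : ℝ) / N i = k / N i + 1 / N i := by push_cast; ring
  rw [e] at hs htk
  rw [Real.dist_eq, abs_lt]
  constructor <;> linarith [hs.1, hs.2]

theorem IsTopGraph.locallyConnectedSpace {X : Type*} [TopologicalSpace X] [T2Space X]
    (h : IsTopGraph X) : LocallyConnectedSpace X := by
  obtain ⟨n, φ, hφ, hU, -⟩ := h.exists_charts
  rw [locallyConnectedSpace_iff_connected_subsets]
  intro x U hxU
  have key : ∀ i, ∃ C D : Set ℝ, IsCompact C ∧ IsPreconnected ({x} ∪ φ i '' D) ∧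
      Icc (0:ℝ) 1 ⊆ C ∪ D ∧ x ∉ φ i '' C ∧ φ i '' D ⊆ U := by
    intro i
    by_cases hx : x ∈ φ i '' Icc 0 1
    · obtain ⟨s, hs, rfl⟩ := hx
      have := (hφ i).cont.continuousAt.preimage_mem_nhds hxU
      obtain ⟨ε, hε, hsub⟩ := Metric.mem_nhds_iff.1 this
      refine ⟨Icc 0 1 \ Metric.ball s ε, Icc 0 1 ∩ Metric.ball s ε,
        isCompact_Icc.diff Metric.isOpen_ball, ?_, ?_, ?_, ?_⟩
      · have hsm : φ i s ∈ φ i '' (Icc 0 1 ∩ Metric.ball s ε) :=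
          ⟨s, ⟨hs, Metric.mem_ball_self hε⟩, rfl⟩
        rw [union_eq_self_of_subset_left (singleton_subset_iff.2 hsm)]
        refine IsPreconnected.image ?_ _ (hφ i).cont.continuousOn
        rw [Real.ball_eq_Ioo]
        exact (ordConnected_Icc.inter ordConnected_Ioo).isPreconnected
      · rw [sdiff_union_inter]
      · rintro ⟨t, ⟨ht, htb⟩, hts⟩
        rw [(hφ i).inj ht hs hts] at htb
        exact htb (Metric.mem_ball_self hε)
      · rintro _ ⟨t, ht, rfl⟩
        exact hsub ht.2
    · exact ⟨Icc 0 1, ∅, isCompact_Icc, by simpa using isPreconnected_singleton,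
        subset_union_left, hx, by simp⟩
  choose C D hC hD hCD hxC hDU using key
  refine ⟨⋃ i, ({x} ∪ φ i '' D i), ?_, ?_, ?_⟩
  · have hcl : IsClosed (⋃ i, φ i '' C i) :=
      isClosed_iUnion_of_finite fun i => ((hC i).image (hφ i).cont).isClosed
    refine mem_of_superset (hcl.isOpen_compl.mem_nhds (by simpa using hxC)) ?_
    intro z hz
    obtain ⟨i, t, ht, rfl⟩ := mem_iUnion.1 (hU ▸ mem_univ z : z ∈ ⋃ i, φ i '' Icc 0 1)
    rcases hCD i ht with h | h
    · exact (hz (mem_iUnion.2 ⟨i, t, h, rfl⟩)).elim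
    · exact mem_iUnion.2 ⟨i, Or.inr ⟨t, h, rfl⟩⟩
  · exact isPreconnected_iUnion ⟨x, mem_iInter.2 fun i => Or.inl rfl⟩ hD
  · exact iUnion_subset fun i => union_subset
      (singleton_subset_iff.2 (mem_of_mem_nhds hxU)) (hDU i)

/-- The set `T` is, up to finitely many points, a finite disjoint union of nondegenerate compact
intervals. -/
def HasIntervalDecomposition (T : Set ℝ) : Prop :=
  ∃ Λ : Finset (ℝ × ℝ), (∀ q ∈ Λ, q.1 < q.2 ∧ Icc q.1 q.2 ⊆ T) ∧
    (∀ q ∈ Λ, ∀ q' ∈ Λ, q ≠ q' → Disjoint (Icc q.1 q.2) (Icc q'.1 q'.2)) ∧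
    (T \ ⋃ q ∈ Λ, Icc q.1 q.2).Finite

theorem HasIntervalDecomposition.of_ordConnected {T : Set ℝ} (hT : IsCompact T)
    (h : T.OrdConnected) : HasIntervalDecomposition T := by
  rcases T.eq_empty_or_nonempty with rfl | hne
  · exact ⟨∅, by simp, by simp, by simp⟩
  have e : T = Icc (sInf T) (sSup T) :=
    Subset.antisymm (fun t ht => ⟨csInf_le hT.bddBelow ht, le_csSup hT.bddAbove ht⟩)
      (h.out (hT.sInf_mem hne) (hT.sSup_mem hne))
  rcases (csInf_le hT.bddBelow (hT.sSup_mem hne)).lt_or_eq with hlt | heq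
  · refine ⟨{(sInf T, sSup T)}, ?_, ?_, ?_⟩
    · simp only [Finset.mem_singleton, forall_eq]
      exact ⟨hlt, e.symm.subset⟩
    · simp
    · simp [← e]
  · refine ⟨∅, by simp, by simp, ?_⟩
    rw [← heq, Icc_self] at e
    rw [e]
    simp

theorem HasIntervalDecomposition.union {A B : Set ℝ} (hA : HasIntervalDecomposition A)
    (hB : HasIntervalDecomposition B) (hAB : Disjoint A B) : HasIntervalDecomposition (A ∪ B) := by
  classical
  obtain ⟨Λ, h1, h2, h3⟩ := hA
  obtain ⟨M, k1, k2, k3⟩ := hB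
  refine ⟨Λ ∪ M, ?_, ?_, ?_⟩
  · intro q hq
    rcases Finset.mem_union.1 hq with h | h
    · exact ⟨(h1 q h).1, (h1 q h).2.trans subset_union_left⟩
    · exact ⟨(k1 q h).1, (k1 q h).2.trans subset_union_right⟩
  · intro q hq q' hq' hne
    rcases Finset.mem_union.1 hq with h | h <;> rcases Finset.mem_union.1 hq' with h' | h'
    · exact h2 q h q' h' hne
    · exact hAB.mono (h1 q h).2 (k1 q' h').2
    · exact (hAB.mono (h1 q' h').2 (k1 q h).2).symm
    · exact k2 q h q' h' hne
  · refine (h3.union k3).subset ?_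
    rintro t ⟨ht, hn⟩
    simp only [Finset.mem_union, mem_iUnion, not_exists] at hn
    rcases ht with ht | ht
    · left
      refine ⟨ht, ?_⟩
      simp only [mem_iUnion, not_exists]
      exact fun q hq => hn q (Or.inl hq)
    · right
      refine ⟨ht, ?_⟩
      simp only [mem_iUnion, not_exists]
      exact fun q hq => hn q (Or.inr hq)

theorem HasIntervalDecomposition.of_forall_or {T : Set ℝ} (hT : IsClosed T) (hT1 : T ⊆ Icc 0 1)
    (h : ∀ t ∈ T, Icc 0 t ⊆ T ∨ Icc t 1 ⊆ T) : HasIntervalDecomposition T := by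
  have comp : ∀ S : Set ℝ, IsClosed S → S ⊆ T → IsCompact S := fun S hS hST =>
    isCompact_Icc.of_isClosed_subset hS (hST.trans hT1)
  set A := {t | t ∈ T ∧ Icc 0 t ⊆ T} with hA
  set B := {t | t ∈ T ∧ Icc t 1 ⊆ T} with hB
  have hAc : IsClosed A := by
    refine isClosed_of_closure_subset fun t ht => ?_
    have htT : t ∈ T := hT.closure_eq ▸ closure_mono (fun s hs => hs.1) ht
    refine ⟨htT, fun s hs => ?_⟩
    rcases hs.2.lt_or_eq with hlt | rfl
    · obtain ⟨r, hr, hrA⟩ := mem_closure_iff.1 ht (Ioi s) isOpen_Ioi hlt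
      exact hrA.2 ⟨hs.1, le_of_lt hr⟩
    · exact htT
  have hBc : IsClosed B := by
    refine isClosed_of_closure_subset fun t ht => ?_
    have htT : t ∈ T := hT.closure_eq ▸ closure_mono (fun s hs => hs.1) ht
    refine ⟨htT, fun s hs => ?_⟩
    rcases hs.1.lt_or_eq with hlt | rfl
    · obtain ⟨r, hr, hrA⟩ := mem_closure_iff.1 ht (Iio s) isOpen_Iio hlt
      exact hrA.2 ⟨le_of_lt hr, hs.2⟩
    · exact htT
  have hAT : A ⊆ T := fun s hs => hs.1
  have hBT : B ⊆ T := fun s hs => hs.1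
  have hAo : A.OrdConnected := ordConnected_of_Ioo fun a ha b hb _ t ht =>
    ⟨hb.2 ⟨(hT1 ha.1).1.trans ht.1.le, ht.2.le⟩, fun s hs => hb.2 ⟨hs.1, hs.2.trans ht.2.le⟩⟩
  have hBo : B.OrdConnected := ordConnected_of_Ioo fun a ha b hb _ t ht =>
    ⟨ha.2 ⟨ht.1.le, ht.2.le.trans (hT1 hb.1).2⟩, fun s hs => ha.2 ⟨ht.1.le.trans hs.1, hs.2⟩⟩
  have hU : T = A ∪ B := by
    refine Subset.antisymm (fun t ht => ?_) (union_subset hAT hBT)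
    rcases h t ht with h | h
    · exact Or.inl ⟨ht, h⟩
    · exact Or.inr ⟨ht, h⟩
  by_cases hd : Disjoint A B
  · rw [hU]
    exact (of_ordConnected (comp A hAc hAT) hAo).union (of_ordConnected (comp B hBc hBT) hBo) hd
  · obtain ⟨t, htA, htB⟩ := not_disjoint_iff.1 hd
    have : T = Icc 0 1 := by
      refine hT1.antisymm fun s hs => ?_
      rcases le_total s t with hst | hst
      · exact htA.2 ⟨hs.1, hst⟩
      · exact htB.2 ⟨hst, hs.2⟩
    rw [this]
    exact of_ordConnected isCompact_Icc ordConnected_Icc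

theorem IsTopGraph.isTopGraph_coe {X : Type*} [TopologicalSpace X] [T2Space X]
    (h : IsTopGraph X) {K : Set X} (hK : IsClosed K) (hKc : IsConnected K) (hKn : K.Nontrivial) :
    IsTopGraph ↥K := by
  classical
  have := h.1
  obtain ⟨n, φ, hφ, hU, hend, hsub⟩ := h.exists_charts
  set T : Fin n → Set ℝ := fun i => Icc 0 1 ∩ φ i ⁻¹' K with hTdef
  have hTc : ∀ i, IsClosed (T i) := fun i => isClosed_Icc.inter (hK.preimage (hφ i).cont)
  have hdec : ∀ i, HasIntervalDecomposition (T i) := by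
    intro i
    by_cases hi : K ⊆ φ i '' Ioo 0 1
    · refine .of_ordConnected (isCompact_Icc.inter_right (hK.preimage (hφ i).cont)) ?_
      refine ⟨fun a ha b hb t ht => ?_⟩
      have ht01 : t ∈ Icc (0:ℝ) 1 := ⟨ha.1.1.trans ht.1, ht.2.trans hb.1.2⟩
      refine ⟨ht01, ?_⟩
      by_contra htK
      have hta : a < t := lt_of_le_of_ne ht.1 (by rintro rfl; exact htK ha.2)
      have htb : t < b := lt_of_le_of_ne ht.2 (by rintro rfl; exact htK hb.2)
      have h0 : φ i 0 ∉ K := fun h0 => by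
        have := ((hφ i).mem_image_Ioo le_rfl le_rfl (by norm_num)).1 (hi h0)
        exact lt_irrefl _ this.1
      have ha0 : 0 < a := lt_of_le_of_ne ha.1.1 (by rintro rfl; exact h0 ha.2)
      have := (hφ i).subset_of_notMem hKc.isPreconnected le_rfl ha0 hta ht01.2 ha.2 h0 htK hb.2
      have := ((hφ i).mem_image_Ioo le_rfl ht01.2 hb.1).1 this
      exact absurd this.2 htb.le.not_gt
    · refine .of_forall_or (hTc i) inter_subset_left fun t ht => ?_
      rcases (hφ i).image_Icc_subset_or hKc.isPreconnected le_rfl ht.1.1 ht.1.2 le_rfl ht.2 hi with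
        h | h
      · exact Or.inl fun s hs => ⟨⟨hs.1, hs.2.trans ht.1.2⟩, h ⟨s, hs, rfl⟩⟩
      · exact Or.inr fun s hs => ⟨⟨ht.1.1.trans hs.1, hs.2⟩, h ⟨s, hs, rfl⟩⟩
  choose Λ hΛ1 hΛ2 hΛ3 using hdec
  set Ω : Finset (Σ _ : Fin n, ℝ × ℝ) := Finset.univ.sigma Λ
  have hΩ : ∀ q : Ω, q.1.2 ∈ Λ q.1.1 := fun q => (Finset.mem_sigma.1 q.2).2
  have h01 : ∀ q : Ω, Icc q.1.2.1 q.1.2.2 ⊆ Icc 0 1 := fun q =>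
    (hΛ1 _ _ (hΩ q)).2.trans inter_subset_left
  have hlt : ∀ q : Ω, q.1.2.1 < q.1.2.2 := fun q => (hΛ1 _ _ (hΩ q)).1
  have hqK : ∀ q : Ω, ∀ t ∈ Icc q.1.2.1 q.1.2.2, φ q.1.1 t ∈ K := fun q t ht =>
    ((hΛ1 _ _ (hΩ q)).2 ht).2
  set E : Ω → Set X := fun q => φ q.1.1 '' Icc q.1.2.1 q.1.2.2
  have hEcl : IsClosed (⋃ q, E q) :=
    isClosed_iUnion_of_finite fun q => (hφ q.1.1).isClosed_image_Icc _ _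
  have hrest : (K \ ⋃ q, E q).Finite := by
    refine (Set.finite_iUnion fun i => (hΛ3 i).image (φ i)).subset ?_
    rintro z ⟨hz, hzn⟩
    obtain ⟨i, t, ht, rfl⟩ := mem_iUnion.1 (hU ▸ mem_univ z : z ∈ ⋃ i, φ i '' Icc 0 1)
    refine mem_iUnion.2 ⟨i, t, ⟨⟨ht, hz⟩, fun hh => hzn ?_⟩, rfl⟩
    simp only [mem_iUnion] at hh
    obtain ⟨q, hq, htq⟩ := hh
    exact mem_iUnion.2 ⟨⟨⟨i, q⟩, Finset.mem_sigma.2 ⟨Finset.mem_univ _, hq⟩⟩, t, htq, rfl⟩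
  have hcover : K ⊆ ⋃ q, E q := by
    by_contra hcon
    obtain ⟨p, hpK, hp⟩ := not_subset.1 hcon
    obtain ⟨r, hrK, hrp⟩ := hKn.exists_ne p
    have hcl : IsClosed ((⋃ q, E q) ∪ ((K \ ⋃ q, E q) \ {p})) :=
      hEcl.union (hrest.subset sdiff_subset).isClosed
    have hmem : ∀ z ∈ K, z ≠ p → z ∈ (⋃ q, E q) ∪ ((K \ ⋃ q, E q) \ {p}) := by
      intro z hz hzp
      by_cases hzE : z ∈ ⋃ q, E q
      · exact Or.inl hzE
      · exact Or.inr ⟨⟨hz, hzE⟩, hzp⟩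
    obtain ⟨z, -, hz1, hz2⟩ := isPreconnected_closed_iff.1 hKc.isPreconnected {p} _
      isClosed_singleton hcl (fun z hz => by
        by_cases hzp : z = p
        · exact Or.inl hzp
        · exact Or.inr (hmem z hz hzp)) ⟨p, hpK, rfl⟩ ⟨r, hrK, hmem r hrK hrp⟩
    rw [mem_singleton_iff.1 hz1] at hz2
    rcases hz2 with h | h
    · exact hp h
    · exact h.2 rfl
  have hEdis : ∀ q q' : Ω, q ≠ q' → E q ∩ E q' = ∅ ∨ ∃ p, E q ∩ E q' = {p} ∧
      p ∈ ({φ q.1.1 q.1.2.1, φ q.1.1 q.1.2.2} : Set X) ∧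
      p ∈ ({φ q'.1.1 q'.1.2.1, φ q'.1.1 q'.1.2.2} : Set X) := by
    rintro ⟨⟨i, u⟩, hi⟩ ⟨⟨j, v⟩, hj⟩ hne
    rcases (E ⟨⟨i, u⟩, hi⟩ ∩ E ⟨⟨j, v⟩, hj⟩).eq_empty_or_nonempty with he | ⟨p, hp⟩
    · exact Or.inl he
    by_cases hij : i = j
    · subst hij
      obtain ⟨⟨s, hs, rfl⟩, ⟨t, ht, hst⟩⟩ := hp
      have hts : t = s := (hφ i).inj (h01 ⟨⟨i, v⟩, hj⟩ ht) (h01 ⟨⟨i, u⟩, hi⟩ hs) hst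
      subst hts
      have huv : u ≠ v := by rintro rfl; exact hne rfl
      exact (disjoint_left.1 (hΛ2 i u (hΩ ⟨⟨i, u⟩, hi⟩) v (hΩ ⟨⟨i, v⟩, hj⟩) huv) hs ht).elim
    · right
      refine ⟨p, ?_, ?_⟩
      · refine Subset.antisymm (fun z hz => ?_) (singleton_subset_iff.2 hp)
        exact hsub i j hij ⟨image_mono (h01 ⟨⟨i, u⟩, hi⟩) hz.1, image_mono (h01 ⟨⟨j, v⟩, hj⟩) hz.2⟩
          ⟨image_mono (h01 ⟨⟨i, u⟩, hi⟩) hp.1, image_mono (h01 ⟨⟨j, v⟩, hj⟩) hp.2⟩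
      · obtain ⟨⟨s, hs, rfl⟩, ⟨t, ht, hst⟩⟩ := hp
        have hs' := h01 ⟨⟨i, u⟩, hi⟩ hs
        have ht' := h01 ⟨⟨j, v⟩, hj⟩ ht
        have hu := h01 ⟨⟨i, u⟩, hi⟩ ⟨le_rfl, (hlt ⟨⟨i, u⟩, hi⟩).le⟩
        have hu' := h01 ⟨⟨i, u⟩, hi⟩ ⟨(hlt ⟨⟨i, u⟩, hi⟩).le, le_rfl⟩
        have hv := h01 ⟨⟨j, v⟩, hj⟩ ⟨le_rfl, (hlt ⟨⟨j, v⟩, hj⟩).le⟩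
        have hv' := h01 ⟨⟨j, v⟩, hj⟩ ⟨(hlt ⟨⟨j, v⟩, hj⟩).le, le_rfl⟩
        obtain ⟨h1, h2⟩ := hend i j hij s hs' t ht' hst.symm
        have aux : ∀ a b w : ℝ, w ∈ Icc a b → a ∈ Icc (0:ℝ) 1 → b ∈ Icc (0:ℝ) 1 →
            (w = 0 ∨ w = 1) → w = a ∨ w = b := by
          rintro a b w hw ha hb (rfl | rfl)
          · exact Or.inl (le_antisymm ha.1 hw.1)
          · exact Or.inr (le_antisymm hw.2 hb.2)
        refine ⟨?_, ?_⟩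
        · rcases aux _ _ s hs hu hu' h1 with h | h
          · exact Or.inl (by rw [h])
          · exact Or.inr (by rw [h]; rfl)
        · rw [← hst]
          rcases aux _ _ t ht hv hv' h2 with h | h
          · exact Or.inl (by rw [h])
          · exact Or.inr (by rw [h]; rfl)
  set e := Ω.equivFin.symm
  have hEK : ∀ q, E q ⊆ K := by
    rintro q _ ⟨t, ht, rfl⟩
    exact hqK q t ht
  refine ⟨isCompact_iff_compactSpace.1 hK.isCompact, isConnected_iff_connectedSpace.1 hKc, Ω.card,
    fun k => Subtype.val ⁻¹' E (e k), fun k => ⟨φ (e k).1.1 (e k).1.2.1,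
      hqK _ _ ⟨le_rfl, (hlt _).le⟩⟩, fun k => ⟨φ (e k).1.1 (e k).1.2.2,
      hqK _ _ ⟨(hlt _).le, le_rfl⟩⟩, fun k => ?_, ?_, fun k l hkl => ?_⟩
  · set q := e k
    have hm : ∀ t : Icc (0:ℝ) 1, q.1.2.1 + t * (q.1.2.2 - q.1.2.1) ∈ Icc q.1.2.1 q.1.2.2 := by
      intro t
      have := hlt q
      constructor <;> nlinarith [t.2.1, t.2.2]
    refine ⟨fun t => ⟨φ q.1.1 (q.1.2.1 + t * (q.1.2.2 - q.1.2.1)), hqK q _ (hm t)⟩, ?_, ?_, ?_,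
      ?_, ?_⟩
    · refine Continuous.subtype_mk ((hφ q.1.1).cont.comp ?_) _
      fun_prop
    · intro s t hst
      have h1 := (hφ q.1.1).inj (h01 q (hm s)) (h01 q (hm t)) (Subtype.ext_iff.1 hst)
      have h2 : (s:ℝ) * (q.1.2.2 - q.1.2.1) = t * (q.1.2.2 - q.1.2.1) := by linarith
      exact Subtype.ext (mul_right_cancel₀ (sub_pos.2 (hlt q)).ne' h2)
    · ext ⟨z, hz⟩
      constructor
      · rintro ⟨t, ht⟩
        rw [Subtype.ext_iff] at ht
        exact ⟨_, hm t, ht⟩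
      · rintro ⟨t, ht, htz⟩
        have hd : 0 < q.1.2.2 - q.1.2.1 := sub_pos.2 (hlt q)
        refine ⟨⟨(t - q.1.2.1) / (q.1.2.2 - q.1.2.1), div_nonneg (sub_nonneg.2 ht.1) hd.le, ?_⟩, ?_⟩
        · rw [div_le_one hd]; linarith [ht.2]
        · apply Subtype.ext
          simp only
          rw [div_mul_cancel₀ _ hd.ne', add_sub_cancel]
          exact htz
    · simp [q]
    · simp [q]
  · refine eq_univ_of_forall fun z => ?_
    obtain ⟨q, hq⟩ := mem_iUnion.1 (hcover z.2)
    exact mem_iUnion.2 ⟨e.symm q, by simpa using hq⟩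
  · have hne : e k ≠ e l := fun h => hkl (e.injective h)
    rcases hEdis _ _ hne with h | ⟨p, hp, hp1, hp2⟩
    · left
      rw [← preimage_inter, h, preimage_empty]
    · right
      have hpK : p ∈ K := hEK (e k) (hp.symm.subset rfl).1
      refine ⟨⟨p, hpK⟩, ?_, ?_, ?_⟩
      · rw [← preimage_inter, hp]
        ext z
        simp [Subtype.ext_iff]
      · simpa [Subtype.ext_iff] using hp1
      · simpa [Subtype.ext_iff] using hp2

theorem IsTopGraph.isSubgraph {X : Type*} [TopologicalSpace X] [T2Space X] (h : IsTopGraph X)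
    {K : Set X} (hK : IsClosed K) (hKc : IsPreconnected K) (hKn : K.Nontrivial) : IsSubgraph K :=
  ⟨hK, ⟨hKn.nonempty, hKc⟩, h.isTopGraph_coe hK ⟨hKn.nonempty, hKc⟩ hKn⟩

/-- No two sets at positive distance both cover their union under iterates of `f`. -/
def NoHorseshoe {X : Type*} [MetricSpace X] (f : X → X) : Prop :=
  ∀ A B : Set X, A.Nonempty → ∀ δ > 0, (∀ p ∈ A, ∀ q ∈ B, δ ≤ dist p q) → ∀ a ≥ 1, ∀ b ≥ 1,
    A ∪ B ⊆ f^[a] '' A → A ∪ B ⊆ f^[b] '' B → False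

theorem subset_iterate_image {X : Type*} {f : X → X} {A C : Set X} {a : ℕ} (hAC : A ⊆ C)
    (h : C ⊆ f^[a] '' A) {b : ℕ} (hb : 1 ≤ b) : C ⊆ f^[a * b] '' A := by
  induction b, hb using Nat.le_induction with
  | base => simpa using h
  | succ b hb ih =>
    refine h.trans ?_
    rw [Nat.mul_succ, Nat.add_comm, Function.iterate_add, image_comp]
    exact image_mono (hAC.trans ih)

theorem exists_itinerary {X : Type*} {f : X → X} {S : Bool → Set X} {C : Set X} {n : ℕ}
    (hC : C.Nonempty) (hS : ∀ i, S i ⊆ C) (h : ∀ i, C ⊆ f^[n] '' S i) (k : ℕ) :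
    ∀ w : ℕ → Bool, ∃ z ∈ C, ∀ j < k, f^[n * j] z ∈ S (w j) := by
  induction k with
  | zero => exact fun w => ⟨hC.some, hC.some_mem, by simp⟩
  | succ k ih =>
    intro w
    obtain ⟨z, hz, hzj⟩ := ih fun j => w (j + 1)
    obtain ⟨y, hy, rfl⟩ := h (w 0) hz
    refine ⟨y, hS _ hy, fun j hj => ?_⟩
    rcases j with _ | j
    · simpa using hy
    · have := hzj j (by omega)
      rwa [← Function.iterate_add_apply, ← Nat.mul_succ] at this

theorem NoHorseshoe.of_coverEntropy {X : Type*} [MetricSpace X] {f : X → X}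
    (hent : Dynamics.coverEntropy f univ = 0) : NoHorseshoe f := by
  classical
  intro A B hA δ hδ hAB a ha b hb hfA hfB
  set n := a * b with hn
  have hn1 : 1 ≤ n := Nat.mul_pos ha hb
  set S : Bool → Set X := fun i => if i then A else B
  have hit := fun k => exists_itinerary (f := f) (S := S) (C := A ∪ B) (n := n) (hA.mono
    subset_union_left) (by
      rintro (_ | _)
      · exact subset_union_right
      · exact subset_union_left) (by
      rintro (_ | _)
      · rw [hn, mul_comm]
        exact subset_iterate_image subset_union_right hfB ha
      · exact subset_iterate_image subset_union_left hfA hb) k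
  have hU : {p : X × X | dist p.1 p.2 < δ / 2} ∈ uniformity X := Metric.dist_mem_uniformity
    (by positivity)
  have hcard : ∀ k : ℕ, ((2 ^ k : ℕ) : ℕ∞) ≤
      Dynamics.netMaxcard f univ {p : X × X | dist p.1 p.2 < δ / 2} (n * k) := by
    intro k
    choose z hzC hz using fun w : Fin k → Bool =>
      hit k fun j => if h : j < k then w ⟨j, h⟩ else true
    have far : ∀ w w' : Fin k → Bool, w ≠ w' →
        ∃ j < n * k, δ ≤ dist (f^[j] (z w)) (f^[j] (z w')) := by
      intro w w' hne
      obtain ⟨i, hi⟩ := Function.ne_iff.1 hne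
      refine ⟨n * i, Nat.mul_lt_mul_of_pos_left i.2 hn1, ?_⟩
      have h1 := hz w i i.2
      have h2 := hz w' i i.2
      simp only [i.2, dite_true, Fin.eta] at h1 h2
      cases hw : w i <;> cases hw' : w' i <;> rw [hw] at h1 <;> rw [hw'] at h2
      · rw [hw, hw'] at hi; exact (hi rfl).elim
      · rw [dist_comm]; exact hAB _ h2 _ h1
      · exact hAB _ h1 _ h2
      · rw [hw, hw'] at hi; exact (hi rfl).elim
    have zinj : Function.Injective z := by
      intro w w' h
      by_contra hne
      obtain ⟨j, -, hj⟩ := far w w' hne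
      rw [h, dist_self] at hj
      linarith
    have hnet : Dynamics.IsDynNetIn f univ {p : X × X | dist p.1 p.2 < δ / 2} (n * k)
        ((Finset.univ.image z : Finset X) : Set X) := by
      refine ⟨subset_univ _, ?_⟩
      intro p hp q hq hpq
      simp only [Finset.coe_image, Finset.coe_univ, image_univ, mem_range] at hp hq
      obtain ⟨w, rfl⟩ := hp
      obtain ⟨w', rfl⟩ := hq
      obtain ⟨j, hj, hd⟩ := far w w' (fun h => hpq (by rw [h]))
      refine disjoint_left.2 fun y hy hy' => ?_
      rw [Dynamics.mem_ball_dynEntourage] at hy hy'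
      have h1 : dist (f^[j] (z w)) (f^[j] y) < δ / 2 := hy j hj
      have h2 : dist (f^[j] (z w')) (f^[j] y) < δ / 2 := hy' j hj
      have := dist_triangle_right (f^[j] (z w)) (f^[j] (z w')) (f^[j] y)
      linarith
    have := hnet.card_le_netMaxcard
    rw [Finset.card_image_of_injective _ zinj] at this
    simpa using this
  have hle := Dynamics.netEntropyEntourage_le_coverEntropy (T := f) univ hU
  rw [hent] at hle
  set c : ℝ := Real.log 2 / n with hc
  have hcpos : 0 < c := div_pos (Real.log_pos one_lt_two) (by exact_mod_cast hn1)
  have hge : (c : EReal) ≤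
      Dynamics.netEntropyEntourage f univ {p : X × X | dist p.1 p.2 < δ / 2} := by
    refine Frequently.le_expGrowthSup ?_
    refine frequently_atTop.2 fun m => ⟨n * m, Nat.le_mul_of_pos_left m hn1, ?_⟩
    have e : (c : EReal) * ((n * m : ℕ) : EReal) = ((Real.log 2 * m : ℝ) : EReal) := by
      have : ((n * m : ℕ) : EReal) = (((n * m : ℕ) : ℝ) : EReal) := by norm_cast
      rw [this, ← EReal.coe_mul, hc]
      congr 1
      have : (n:ℝ) ≠ 0 := by positivity
      push_cast
      field_simp
    rw [e, EReal.exp_coe, mul_comm, Real.exp_nat_mul, Real.exp_log two_pos]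
    have h2 := ENat.toENNReal_mono (hcard m)
    refine le_trans ?_ h2
    rw [ENNReal.ofReal_pow two_pos.le]
    simp
  have : (c : EReal) ≤ 0 := hge.trans hle
  exact absurd (by exact_mod_cast this) hcpos.not_ge

theorem NoHorseshoe.iterate {X : Type*} [MetricSpace X] {f : X → X} (h : NoHorseshoe f) {d : ℕ}
    (hd : 1 ≤ d) : NoHorseshoe f^[d] := by
  intro A B hA δ hδ hAB a ha b hb hfA hfB
  rw [← Function.iterate_mul] at hfA hfB
  exact h A B hA δ hδ hAB _ (Nat.mul_pos hd ha) _ (Nat.mul_pos hd hb) hfA hfB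

section Omega

variable {X : Type*} [MetricSpace X] {f : X → X}

theorem mem_omegaSet_iff {x a : X} :
    a ∈ omegaSet f x ↔ ∀ U, IsOpen U → a ∈ U → ∀ N, ∃ m ≥ N, f^[m] x ∈ U := by
  simp only [omegaSet, mem_iInter, mem_closure_iff]
  constructor
  · intro h U hU ha N
    obtain ⟨_, hz, m, hm, rfl⟩ := h N U hU ha
    exact ⟨m, hm, hz⟩
  · intro h N U hU ha
    obtain ⟨m, hm, hz⟩ := h U hU ha N
    exact ⟨_, hz, m, hm, rfl⟩

theorem isClosed_omegaSet (f : X → X) (x : X) : IsClosed (omegaSet f x) :=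
  isClosed_iInter fun _ => isClosed_closure

theorem apply_mem_omegaSet (hf : Continuous f) {x a : X} (ha : a ∈ omegaSet f x) :
    f a ∈ omegaSet f x := by
  rw [mem_omegaSet_iff] at ha ⊢
  intro U hU haU N
  obtain ⟨m, hm, h⟩ := ha _ (hU.preimage hf) haU N
  exact ⟨m + 1, by omega, by rwa [Function.iterate_succ_apply']⟩

theorem iterate_mem_omegaSet (hf : Continuous f) {x a : X} (ha : a ∈ omegaSet f x) (n : ℕ) :
    f^[n] a ∈ omegaSet f x := by
  induction n with
  | zero => exact ha
  | succ n ih => rw [Function.iterate_succ_apply']; exact apply_mem_omegaSet hf ih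

theorem omegaSet_iterate (f : X → X) (x : X) (i : ℕ) : omegaSet f (f^[i] x) = omegaSet f x := by
  ext a
  simp only [mem_omegaSet_iff]
  constructor
  · intro h U hU ha N
    obtain ⟨m, hm, h⟩ := h U hU ha N
    exact ⟨m + i, by omega, by rwa [Function.iterate_add_apply]⟩
  · intro h U hU ha N
    obtain ⟨m, hm, h⟩ := h U hU ha (N + i)
    refine ⟨m - i, by omega, ?_⟩
    rwa [← Function.iterate_add_apply, Nat.sub_add_cancel (by omega)]

theorem omegaSet_subset_of_eventually {x : X} {C : Set X} (hC : IsClosed C)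
    (h : ∀ᶠ m in atTop, f^[m] x ∈ C) : omegaSet f x ⊆ C := by
  intro a ha
  by_contra hn
  obtain ⟨N, hN⟩ := eventually_atTop.1 h
  obtain ⟨m, hm, h⟩ := mem_omegaSet_iff.1 ha _ hC.isOpen_compl hn N
  exact h (hN m hm)

variable [CompactSpace X]

theorem eventually_mem_of_omegaSet_subset {x : X} {U : Set X} (hU : IsOpen U)
    (h : omegaSet f x ⊆ U) : ∀ᶠ m in atTop, f^[m] x ∈ U := by
  by_contra hcon
  have hfr : ∃ᶠ m in atTop, f^[m] x ∈ Uᶜ := not_eventually.1 hcon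
  obtain ⟨a, ha, hmc⟩ := hU.isClosed_compl.isCompact.exists_mapClusterPt_of_frequently hfr
  refine ha (h (mem_omegaSet_iff.2 fun V hV haV N => ?_))
  have := (mapClusterPt_iff_frequently.1 hmc) V (hV.mem_nhds haV)
  exact frequently_atTop.1 this N

theorem omegaSet_subset_iUnion_iterate (hf : Continuous f) {d : ℕ} (hd : 1 ≤ d) (x : X) :
    omegaSet f x ⊆ ⋃ i ∈ Iio d, f^[i] '' omegaSet f^[d] x := by
  set C := ⋃ i ∈ Iio d, f^[i] '' omegaSet f^[d] x
  have hC : IsClosed C := Set.Finite.isClosed_biUnion (Set.finite_Iio d) fun i _ =>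
    ((isClosed_omegaSet _ _).isCompact.image (hf.iterate i)).isClosed
  intro a ha
  by_contra hn
  obtain ⟨U, V, hU, hV, hCU, haV, hUV⟩ := SeparatedNhds.of_isCompact_isCompact hC.isCompact
    (isCompact_singleton (x := a)) (disjoint_singleton_right.2 hn)
  have hev : ∀ i ∈ Iio d, ∀ᶠ q in atTop, (f^[d])^[q] x ∈ f^[i] ⁻¹' U := fun i hi =>
    eventually_mem_of_omegaSet_subset (hU.preimage (hf.iterate i)) fun b hb =>
      hCU (mem_biUnion hi ⟨b, hb, rfl⟩)
  obtain ⟨Q, hQ⟩ := eventually_atTop.1 ((eventually_all_finite (Set.finite_Iio d)).2 hev)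
  obtain ⟨m, hm, hmV⟩ := mem_omegaSet_iff.1 ha V hV (haV rfl) (d * Q)
  have h1 : Q ≤ m / d := by
    rw [Nat.le_div_iff_mul_le hd, mul_comm]; exact hm
  have h2 := hQ _ h1 (m % d) (Nat.mod_lt _ hd)
  rw [mem_preimage, ← Function.iterate_mul, ← Function.iterate_add_apply, Nat.mod_add_div] at h2
  exact disjoint_left.1 hUV h2 hmV

theorem omegaSet_iterate_infinite (hf : Continuous f) {d : ℕ} (hd : 1 ≤ d) {x : X}
    (h : (omegaSet f x).Infinite) : (omegaSet f^[d] x).Infinite := fun hfin =>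
  h (((Set.finite_Iio d).biUnion fun i _ => hfin.image f^[i]).subset
    (omegaSet_subset_iUnion_iterate hf hd x))

theorem omegaSet_finite_of_tendsto (hf : Continuous f) {x z : X} {i n : ℕ} (hn : 1 ≤ n)
    (h : Tendsto (fun k => f^[i + n * k] x) atTop (𝓝 z)) : (omegaSet f x).Finite := by
  by_contra hinf
  rw [← omegaSet_iterate f x i] at hinf
  refine omegaSet_iterate_infinite hf hn hinf ((Set.finite_singleton z).subset ?_)
  intro a ha
  by_contra hne
  obtain ⟨U, V, hU, hV, haU, hzV, hUV⟩ := t2_separation (show a ≠ z from hne)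
  obtain ⟨K, hK⟩ := eventually_atTop.1 (h.eventually (hV.mem_nhds hzV))
  obtain ⟨k, hk, hkU⟩ := mem_omegaSet_iff.1 ha U hU haU K
  rw [← Function.iterate_mul, ← Function.iterate_add_apply, add_comm] at hkU
  exact disjoint_left.1 hUV hkU (hK k hk)

theorem exists_forall_iterate_dist_lt (hf : Continuous f) (d : ℕ) {ε : ℝ} (hε : 0 < ε) :
    ∃ δ > 0, ∀ p q, dist p q < δ → ∀ j ≤ d, dist (f^[j] p) (f^[j] q) < ε := by
  induction d with
  | zero => exact ⟨ε, hε, fun p q h j hj => by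
      obtain rfl : j = 0 := by omega
      exact h⟩
  | succ d ih =>
    obtain ⟨δ, hδ, h⟩ := ih
    obtain ⟨δ', hδ', h'⟩ := Metric.uniformContinuous_iff.1
      (CompactSpace.uniformContinuous_of_continuous (hf.iterate (d + 1))) ε hε
    refine ⟨min δ δ', lt_min hδ hδ', fun p q hpq j hj => ?_⟩
    rcases Nat.lt_or_ge j (d + 1) with hlt | hge
    · exact h p q (hpq.trans_le (min_le_left _ _)) j (by omega)
    · obtain rfl : j = d + 1 := by omega
      exact h' (hpq.trans_le (min_le_right _ _))

theorem ScrambledPair.iterate (hf : Continuous f) {x y : X} (h : ScrambledPair f x y) {d : ℕ}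
    (hd : 1 ≤ d) : ScrambledPair f^[d] x y := by
  refine ⟨fun ε hε N => ?_, fun has => h.2 ?_⟩
  · obtain ⟨δ, hδ, hu⟩ := exists_forall_iterate_dist_lt hf d hε
    obtain ⟨n, hn, hlt⟩ := h.1 δ hδ (d * N)
    refine ⟨n / d + 1, ?_, ?_⟩
    · have : N ≤ n / d := by rw [Nat.le_div_iff_mul_le hd, mul_comm]; exact hn
      omega
    · have e : d * (n / d + 1) = (d - n % d) + n := by
        have h1 := Nat.div_add_mod n d
        have h2 := Nat.mod_lt n hd
        rw [mul_add]; omega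
      rw [← Function.iterate_mul, e, Function.iterate_add_apply, Function.iterate_add_apply]
      exact hu _ _ hlt _ (Nat.sub_le _ _)
  · refine Metric.tendsto_atTop.2 fun ε hε => ?_
    obtain ⟨δ, hδ, hu⟩ := exists_forall_iterate_dist_lt hf d hε
    obtain ⟨N, hN⟩ := Metric.tendsto_atTop.1 has δ hδ
    refine ⟨d * N, fun n hn => ?_⟩
    have h1 := hN (n / d) (by rw [ge_iff_le, Nat.le_div_iff_mul_le hd, mul_comm]; exact hn)
    rw [Real.dist_0_eq_abs, abs_of_nonneg dist_nonneg] at h1 ⊢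
    have h2 := hu _ _ h1 (n % d) (Nat.mod_lt _ hd).le
    rwa [← Function.iterate_mul, ← Function.iterate_add_apply, ← Function.iterate_add_apply,
      Nat.mod_add_div] at h2

/-- Proximal points with finite ω-limit sets are asymptotic. -/
theorem Proximal.asymptotic_of_finite (hf : Continuous f) {x y : X} (h : Proximal f x y)
    (hx : (omegaSet f x).Finite) (hy : (omegaSet f y).Finite) : Asymptotic f x y := by
  set W := omegaSet f x ∪ omegaSet f y
  have hWf : W.Finite := hx.union hy
  have hfW : ∀ a ∈ W, f a ∈ W := fun a ha => ha.imp (apply_mem_omegaSet hf) (apply_mem_omegaSet hf)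
  have hsep : ∃ ε > 0, ∀ a ∈ W, ∀ b ∈ W, dist a b < ε → a = b := by
    by_cases hne : W.Nontrivial
    · refine ⟨W.infsep, (hWf.infsep_pos_iff_nontrivial).2 hne, fun a ha b hb hab => ?_⟩
      by_contra hne'
      exact absurd (infsep_le_dist_of_mem ha hb hne') hab.not_ge
    · exact ⟨1, one_pos, fun a ha b hb _ => not_nontrivial_iff.1 hne ha hb⟩
  obtain ⟨ε, hε, hsep⟩ := hsep
  refine Metric.tendsto_atTop.2 fun η hη => ?_
  obtain ⟨δ', hδ', hu⟩ := exists_forall_iterate_dist_lt hf 1 (by positivity : (0:ℝ) < ε / 3)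
  set δ := min (min δ' (ε / 3)) (η / 2)
  have hδ : 0 < δ := by positivity
  have hδ1 : δ ≤ δ' := (min_le_left _ _).trans (min_le_left _ _)
  have hδ2 : δ ≤ ε / 3 := (min_le_left _ _).trans (min_le_right _ _)
  have hδ3 : δ ≤ η / 2 := min_le_right _ _
  have near : ∀ z : X, omegaSet f z ⊆ W → ∀ᶠ m in atTop, ∃ a ∈ W, dist (f^[m] z) a < δ := by
    intro z hz
    have := eventually_mem_of_omegaSet_subset (f := f) (x := z)
      (Metric.isOpen_thickening (δ := δ) (E := W)) (hz.trans (Metric.self_subset_thickening hδ W))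
    filter_upwards [this] with m hm
    exact Metric.mem_thickening_iff.1 hm
  obtain ⟨N, hN⟩ := eventually_atTop.1
    ((near x subset_union_left).and (near y subset_union_right))
  obtain ⟨n, hn, hnd⟩ := h (ε / 3) (by positivity) N
  have step : ∀ z a : X, ∀ m, dist (f^[m] z) a < δ → a ∈ W → (∃ a' ∈ W, dist (f^[m + 1] z) a' < δ) →
      dist (f^[m + 1] z) (f a) < δ := by
    rintro z a m h1 ha ⟨a', ha', h2⟩
    have h3 := hu _ _ (h1.trans_le hδ1) 1 le_rfl
    rw [Function.iterate_succ_apply'] at h2 ⊢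
    simp only [Function.iterate_one] at h3
    have := hsep (f a) (hfW a ha) a' ha' (by
      have := dist_triangle_left (f a) a' (f (f^[m] z))
      linarith)
    rwa [this]
  have main : ∀ k, ∃ a ∈ W, dist (f^[n + k] x) a < δ ∧ dist (f^[n + k] y) a < δ := by
    intro k
    induction k with
    | zero =>
      obtain ⟨⟨a, ha, h1⟩, b, hb, h2⟩ := hN n hn
      have : a = b := hsep a ha b hb (by
        have h3 := dist_triangle_left a b (f^[n] x)
        have h4 := dist_triangle (f^[n] x) (f^[n] y) b
        linarith)
      subst this
      exact ⟨a, ha, h1, h2⟩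
    | succ k ih =>
      obtain ⟨a, ha, h1, h2⟩ := ih
      obtain ⟨h3, h4⟩ := hN (n + k + 1) (by omega)
      exact ⟨f a, hfW a ha, step x a _ h1 ha h3, step y a _ h2 ha h4⟩
  refine ⟨n, fun m hm => ?_⟩
  obtain ⟨a, -, h1, h2⟩ := main (m - n)
  rw [Nat.add_sub_cancel' hm] at h1 h2
  rw [Real.dist_0_eq_abs, abs_of_nonneg dist_nonneg]
  have := dist_triangle_right (f^[m] x) (f^[m] y) a
  linarith

end Omega

/-- If a connected set contains infinitely many points of `ω(z)`, then the orbit of `z`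
visits it arbitrarily late. -/
theorem IsTopGraph.exists_iterate_mem {X : Type*} [MetricSpace X] {f : X → X}
    (hX : IsTopGraph X) {z : X} {K A : Set X}
    (hK : IsPreconnected K) (hA : A.Infinite) (hAK : A ⊆ K) (hAz : A ⊆ omegaSet f z) (N : ℕ) :
    ∃ p ≥ N, f^[p] z ∈ K := by
  obtain ⟨φ, r, hφ, hr, hr01, hrA⟩ := hX.exists_chart_seq hA
  have lt : ∀ i j, i < j → r i < r j := fun i j h => hr h
  have hnot : ¬ K ⊆ φ '' Ioo (r 1) (r 5) := fun hsub =>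
    absurd ((hφ.mem_image_Ioo (hr01 1).1.le (hr01 5).2.le (Ioo_subset_Icc_self (hr01 0))).1
      (hsub (hAK (hrA 0)))).1 (lt 0 1 (by omega)).not_gt
  have fin : ∀ i, φ '' Icc (r i) (r (i + 2)) ⊆ K → ∃ p ≥ N, f^[p] z ∈ K := by
    intro i hi
    obtain ⟨p, hp, hpK⟩ := mem_omegaSet_iff.1 (hAz (hrA (i + 1))) _
      (hφ.isOpen_image_Ioo (hr01 i).1.le (hr01 (i + 2)).2.le)
      ⟨_, ⟨lt _ _ (by omega), lt _ _ (by omega)⟩, rfl⟩ N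
    exact ⟨p, hp, hi (image_mono Ioo_subset_Icc_self hpK)⟩
  rcases hφ.image_Icc_subset_or hK (hr01 1).1.le (lt 1 3 (by omega)).le (lt 3 5 (by omega)).le
    (hr01 5).2.le (hAK (hrA 3)) hnot with h | h
  · exact fin 1 h
  · exact fin 3 h

theorem IsChart.mem_of_between {X : Type*} [TopologicalSpace X] [T2Space X] {φ : ℝ → X}
    (hφ : IsChart φ) {K : Set X} (hK : IsPreconnected K) (hKφ : K ⊆ φ '' Ioo 0 1) {a s b : ℝ}
    (ha : a ∈ Ioo (0:ℝ) 1) (hb : b ∈ Ioo (0:ℝ) 1) (has : a < s) (hsb : s < b) (haK : φ a ∈ K)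
    (hbK : φ b ∈ K) : φ s ∈ K := by
  by_contra hs
  have h0 : φ 0 ∉ K := fun h0 => lt_irrefl (0:ℝ)
    ((hφ.mem_image_Ioo le_rfl le_rfl (by norm_num)).1 (hKφ h0)).1
  have := hφ.subset_of_notMem hK le_rfl ha.1 has (hsb.trans hb.2).le haK h0 hs hbK
  exact ((hφ.mem_image_Ioo le_rfl (hsb.trans hb.2).le (Ioo_subset_Icc_self hb)).1 this).2.not_gt hsb

theorem IsTopGraph.exists_finite_subset_edge {X : Type*} [TopologicalSpace X] [T2Space X]
    (h : IsTopGraph X) : ∃ V : Set X, V.Finite ∧ ∀ K, IsPreconnected K → K.Nonempty →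
      Disjoint K V → ∃ φ : ℝ → X, IsChart φ ∧ K ⊆ φ '' Ioo 0 1 := by
  obtain ⟨n, φ, hφ, hU, -⟩ := h.exists_charts
  refine ⟨⋃ i, {φ i 0, φ i 1}, Set.finite_iUnion fun i => by simp, fun K hK hne hd => ?_⟩
  obtain ⟨p, hp⟩ := hne
  obtain ⟨i, t, ht, rfl⟩ := mem_iUnion.1 (hU ▸ mem_univ p : p ∈ ⋃ i, φ i '' Icc 0 1)
  have h0 : φ i 0 ∉ K := fun hm => disjoint_left.1 hd hm (mem_iUnion.2 ⟨i, Or.inl rfl⟩)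
  have h1 : φ i 1 ∉ K := fun hm => disjoint_left.1 hd hm (mem_iUnion.2 ⟨i, Or.inr rfl⟩)
  exact ⟨φ i, hφ i, (hφ i).subset_of_notMem hK le_rfl
    (lt_of_le_of_ne ht.1 (by rintro rfl; exact h0 hp))
    (lt_of_le_of_ne ht.2 (by rintro rfl; exact h1 hp)) le_rfl hp h0 h1⟩

theorem IsSubgraph.exists_preconnected_nhd {X : Type*} [TopologicalSpace X] [T2Space X]
    {K : Set X} (hK : IsSubgraph K) {x : X} (hx : x ∈ K) {U : Set X} (hU : U ∈ 𝓝 x) :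
    ∃ A O, IsPreconnected A ∧ A ⊆ U ∩ K ∧ IsOpen O ∧ x ∈ O ∧ O ∩ K ⊆ A := by
  have := hK.2.2.locallyConnectedSpace
  have hU' : (Subtype.val ⁻¹' U : Set K) ∈ 𝓝 (⟨x, hx⟩ : K) :=
    continuous_subtype_val.continuousAt.preimage_mem_nhds hU
  obtain ⟨W, hW, hWc, hWU⟩ := locallyConnectedSpace_iff_connected_subsets.1 this _ _ hU'
  obtain ⟨O, hO, hOW⟩ := mem_nhds_induced _ _ _ |>.1 hW
  obtain ⟨O', hO', hOo, hxO⟩ := mem_nhds_iff.1 hO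
  refine ⟨Subtype.val '' W, O', hWc.image _ continuous_subtype_val.continuousOn, ?_, hOo, hxO, ?_⟩
  · rintro _ ⟨z, hz, rfl⟩
    exact ⟨hWU hz, z.2⟩
  · rintro z ⟨hz, hzK⟩
    exact ⟨⟨z, hzK⟩, hOW (hO' hz), rfl⟩

theorem iterate_mem_image {X : Type*} {f : X → X} {K : Set X} {p : X} {e : ℕ} (hp : p ∈ f^[e] '' K)
    (i : ℕ) : f^[i] p ∈ f^[i + e] '' K := by
  obtain ⟨q, hq, rfl⟩ := hp
  exact ⟨q, hq, by rw [Function.iterate_add_apply]⟩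

section PeriodicSubgraph

variable {X : Type*} [MetricSpace X] {f : X → X} {K : Set X} {k : ℕ}

theorem IsPeriodicSubgraph.image_add_mul (h : IsPeriodicSubgraph f K k) (e q : ℕ) :
    f^[e + k * q] '' K = f^[e] '' K := by
  have : f^[k * q] '' K = K := by
    induction q with
    | zero => simp
    | succ q ih => rw [Nat.mul_succ, Function.iterate_add, image_comp, h.2.2.1, ih]
  rw [Function.iterate_add, image_comp, this]

theorem IsPeriodicSubgraph.image_mod (h : IsPeriodicSubgraph f K k) (e : ℕ) :
    f^[e % k] '' K = f^[e] '' K := by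
  conv_rhs => rw [← Nat.mod_add_div e k]
  rw [h.image_add_mul]

theorem IsPeriodicSubgraph.image_congr (h : IsPeriodicSubgraph f K k) {e e' : ℕ}
    (hee : e ≡ e' [MOD k]) : f^[e] '' K = f^[e'] '' K := by
  rw [← h.image_mod e, ← h.image_mod e', hee]

theorem IsPeriodicSubgraph.modEq_of_mem (h : IsPeriodicSubgraph f K k) {e e' : ℕ} {p : X}
    (he : p ∈ f^[e] '' K) (he' : p ∈ f^[e'] '' K) : e ≡ e' [MOD k] := by
  by_contra hne
  rw [← h.image_mod] at he he'
  exact disjoint_left.1 (h.2.2.2 _ _ (Nat.mod_lt _ h.2.1) (Nat.mod_lt _ h.2.1) hne) he he'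

theorem IsPeriodicSubgraph.dvd_of_subset (h : IsPeriodicSubgraph f K k) {K' : Set X} {k' : ℕ}
    (h' : IsPeriodicSubgraph f K' k') (hs : K' ⊆ K) : k ∣ k' := by
  obtain ⟨p, hp⟩ := h'.1.2.1.nonempty
  have h1 : p ∈ f^[k'] '' K := by
    rw [← h'.2.2.1] at hp
    exact image_mono hs hp
  exact (Nat.modEq_zero_iff_dvd.1 (h.modEq_of_mem h1 (e' := 0) (by simpa using hs hp)))

theorem IsPeriodicSubgraph.isPreconnected_image (h : IsPeriodicSubgraph f K k) (hf : Continuous f)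
    (e : ℕ) : IsPreconnected (f^[e] '' K) :=
  h.1.2.1.isPreconnected.image _ (hf.iterate e).continuousOn

theorem IsPeriodicSubgraph.isClosed_image [CompactSpace X] (h : IsPeriodicSubgraph f K k)
    (hf : Continuous f) (e : ℕ) : IsClosed (f^[e] '' K) :=
  (h.1.1.isCompact.image (hf.iterate e)).isClosed

/-- The orbit of `z` eventually follows a periodic subgraph containing a point of `ω(z)` with
infinite orbit. -/
theorem IsPeriodicSubgraph.exists_eventually_mem (h : IsPeriodicSubgraph f K k)
    (hX : IsTopGraph X) (hf : Continuous f) {x z : X} (hx : x ∈ K) (hxz : x ∈ omegaSet f z)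
    (hinj : Function.Injective fun n => f^[n] x) :
    ∃ p0 κ, ∀ p ≥ p0, f^[p] z ∈ f^[p + κ] '' K := by
  have hA : (range fun i => f^[k * i] x).Infinite := infinite_range_of_injective fun i j hij =>
    Nat.eq_of_mul_eq_mul_left h.2.1 (hinj hij)
  obtain ⟨p0, -, hp0⟩ := hX.exists_iterate_mem h.1.2.1.isPreconnected hA (by
    rintro _ ⟨i, rfl⟩
    have := h.image_add_mul 0 i
    rw [zero_add, Function.iterate_zero, image_id] at this
    exact this ▸ mem_image_of_mem _ hx) (by
    rintro _ ⟨i, rfl⟩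
    exact iterate_mem_omegaSet hf hxz _) 0
  refine ⟨p0, p0 * (k - 1), fun p hp => ?_⟩
  have e : p + p0 * (k - 1) = (p - p0) + k * p0 := by
    obtain ⟨k', rfl⟩ : ∃ k', k = k' + 1 := ⟨k - 1, by have := h.2.1; omega⟩
    obtain ⟨q, rfl⟩ := Nat.exists_eq_add_of_le hp
    simp only [Nat.add_sub_cancel, Nat.add_sub_cancel_left]
    ring
  rw [e, h.image_add_mul]
  refine ⟨_, hp0, ?_⟩
  rw [← Function.iterate_add_apply, Nat.sub_add_cancel hp]

theorem IsPeriodicSubgraph.exists_isOpen_iterate_mem [CompactSpace X]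
    (h : IsPeriodicSubgraph f K k)
    (hX : IsTopGraph X) (hf : Continuous f) {x z : X} (hx : x ∈ K) (hxz : x ∈ omegaSet f z)
    (hinj : Function.Injective fun n => f^[n] x) :
    ∃ O p0, IsOpen O ∧ x ∈ O ∧ ∀ p ≥ p0, f^[p] z ∈ O → f^[p] z ∈ K := by
  obtain ⟨p0, κ, hp⟩ := h.exists_eventually_mem hX hf hx hxz hinj
  refine ⟨(⋃ e ∈ Ioo 0 k, f^[e] '' K)ᶜ, p0, ?_, ?_, ?_⟩
  · rw [isOpen_compl_iff]
    exact Set.Finite.isClosed_biUnion (Set.finite_Ioo _ _) fun e _ => h.isClosed_image hf e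
  · simp only [mem_compl_iff, mem_iUnion, not_exists]
    intro e he hxe
    have := h.modEq_of_mem hxe (e' := 0) (by simpa using hx)
    rw [Nat.modEq_zero_iff_dvd] at this
    exact absurd (Nat.le_of_dvd he.1 this) he.2.not_ge
  · intro p hpp hO
    have h1 := hp p hpp
    rw [← h.image_mod] at h1
    rcases Nat.eq_zero_or_pos ((p + κ) % k) with h0 | h0
    · rw [h0] at h1; simpa using h1
    · exact (hO (mem_biUnion ⟨h0, Nat.mod_lt _ h.2.1⟩ h1)).elim

end PeriodicSubgraph

theorem exists_three_of_frequently {P : ℕ → Prop} (h : ∀ N, ∃ n ≥ N, P n) :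
    ∃ a b c, a < b ∧ b < c ∧ P a ∧ P b ∧ P c := by
  obtain ⟨a, -, ha⟩ := h 0
  obtain ⟨b, hb, hbP⟩ := h (a + 1)
  obtain ⟨c, hc, hcP⟩ := h (b + 1)
  exact ⟨a, b, c, hb, hc, ha, hbP, hcP⟩

theorem lt_of_disjoint_ordConnected {S T : Set ℝ} (hS : S.OrdConnected) (hT : T.OrdConnected)
    (hd : Disjoint S T) {s₀ t₀ s t : ℝ} (hs₀ : s₀ ∈ S) (ht₀ : t₀ ∈ T) (hlt : s₀ < t₀) (hs : s ∈ S)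
    (ht : t ∈ T) : s < t := by
  rw [disjoint_left] at hd
  by_contra! hle
  rcases le_or_gt s t₀ with h | h
  · exact hd hs (hT.out ht ht₀ ⟨hle, h⟩)
  · exact hd (hS.out hs₀ hs ⟨hlt.le, h.le⟩) ht₀

/-- Small pieces of a periodic subgraph around two points of `ω(f)` lying in arbitrarily deep
periodic subgraphs simultaneously cover one of these. -/
theorem exists_cover_of_nested {X : Type*} [MetricSpace X] (hX : IsTopGraph X) {f : X → X}
    (hf : Continuous f) {x y z w : X} (hxz : x ∈ omegaSet f z) (hyw : y ∈ omegaSet f w)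
    {J : ℕ → Set X} {m : ℕ → ℕ} (hJ : ∀ n, IsPeriodicSubgraph f (J n) (m n)) (hanti : Antitone J)
    (hm : Tendsto m atTop atTop) (hxJ : ∀ n, x ∈ J n) (hyJ : ∀ n, y ∈ J n) (n : ℕ) {U V : Set X}
    (hU : U ∈ 𝓝 x) (hV : V ∈ 𝓝 y) :
    ∃ s ≥ 1, ∃ n', J n' ⊆ f^[s] '' (U ∩ J n) ∧ J n' ⊆ f^[s] '' (V ∩ J n) := by
  have := hX.1
  have inj : ∀ u, (∀ n, u ∈ J n) → Function.Injective fun n => f^[n] u := by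
    intro u hu i j hij
    obtain ⟨n, hn⟩ := (hm.eventually_gt_atTop (max i j)).exists
    have h1 : f^[i] u ∈ f^[i] '' J n := mem_image_of_mem _ (hu n)
    have h2 : f^[i] u ∈ f^[j] '' J n := by
      simp only at hij
      rw [hij]; exact mem_image_of_mem _ (hu n)
    have := (hJ n).modEq_of_mem h1 h2
    exact this.eq_of_lt_of_lt ((le_max_left _ _).trans_lt hn) ((le_max_right _ _).trans_lt hn)
  obtain ⟨Vx, hVx, hedge⟩ := hX.exists_finite_subset_edge
  obtain ⟨n0, hn0, hmn0⟩ := ((hm.eventually_gt_atTop Vx.ncard).and (eventually_ge_atTop n)).exists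
  obtain ⟨i0, hi0⟩ : ∃ i0 < m n0, Disjoint (f^[i0] '' J n0) Vx := by
    by_contra! hcon
    have : Nonempty X := ⟨x⟩
    choose! g hg using fun i hi => not_disjoint_iff.1 (hcon i hi)
    have h1 : g '' ↑(Finset.range (m n0)) ⊆ Vx := by
      rintro _ ⟨i, hi, rfl⟩
      exact (hg i (by simpa using hi)).2
    have h2 : InjOn g ↑(Finset.range (m n0)) := by
      intro i hi j hj hij
      simp only [Finset.coe_range, mem_Iio] at hi hj
      exact ((hJ n0).modEq_of_mem (hg i hi).1 (hij ▸ (hg j hj).1)).eq_of_lt_of_lt hi hj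
    have h3 := ncard_le_ncard h1 hVx
    rw [h2.ncard_image, ncard_coe_finset, Finset.card_range] at h3
    omega
  obtain ⟨φ, hφ, hφJ⟩ := hedge _ ((hJ n0).isPreconnected_image hf i0)
    ((hJ n0).1.2.1.nonempty.image _) hi0.2
  -- pieces around a point, met three times by an approximating orbit
  have piece : ∀ u v : X, (∀ n, u ∈ J n) → u ∈ omegaSet f v → ∀ W ∈ 𝓝 u, ∃ A, IsPreconnected A ∧
      A ⊆ W ∩ J n0 ∧ u ∈ A ∧
      ∃ a b c, a < b ∧ b < c ∧ f^[a] v ∈ A ∧ f^[b] v ∈ A ∧ f^[c] v ∈ A := by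
    intro u v hu huv W hW
    obtain ⟨A, O, hA, hAW, hO, huO, hOA⟩ := (hJ n0).1.exists_preconnected_nhd (hu n0) hW
    obtain ⟨O', p0, hO', huO', hp0⟩ :=
      (hJ n0).exists_isOpen_iterate_mem hX hf (hu n0) huv (inj u hu)
    refine ⟨A, hA, hAW, hOA ⟨huO, hu n0⟩, ?_⟩
    refine exists_three_of_frequently fun N => ?_
    obtain ⟨p, hp, hpO⟩ := mem_omegaSet_iff.1 huv _ (hO.inter hO') ⟨huO, huO'⟩ (max N p0)
    exact ⟨p, (le_max_left _ _).trans hp, hOA ⟨hpO.1, hp0 p ((le_max_right _ _).trans hp) hpO.2⟩⟩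
  obtain ⟨A, hA, hAU, hxA, a, b, c, hab, hbc, haA, hbA, hcA⟩ := piece x z hxJ hxz U hU
  obtain ⟨B, hB, hBV, hyB, a', b', c', hab', hbc', haB, hbB, hcB⟩ := piece y w hyJ hyw V hV
  obtain ⟨n', hn', hnn⟩ := ((hm.eventually_gt_atTop (max c c')).and (eventually_ge_atTop n0)).exists
  set M := m n' with hM
  have hdvd : m n0 ∣ M := (hJ n0).dvd_of_subset (hJ n') (hanti hnn)
  have hM0 : 0 < M := (hJ n').2.1
  have hsubK : ∀ e, f^[e] '' J n' ⊆ f^[e] '' J n0 := fun e => image_mono (hanti hnn)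
  set E := (Finset.range M).filter fun e => e ≡ i0 [MOD m n0] with hE
  have hEedge : ∀ e ∈ E, f^[e] '' J n' ⊆ φ '' Ioo 0 1 := by
    intro e he
    refine (hsubK e).trans ?_
    rw [(hJ n0).image_congr (Finset.mem_filter.1 he).2]
    exact hφJ
  have hpar : ∀ e ∈ E, ∃ t ∈ Ioo (0:ℝ) 1, φ t = f^[e] x := fun e he =>
    hEedge e he (mem_image_of_mem _ (hxJ n'))
  choose! τ hτ01 hτ using hpar
  set T : ℕ → Set ℝ := fun e => {t | t ∈ Ioo (0:ℝ) 1 ∧ φ t ∈ f^[e] '' J n'}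
  have hTo : ∀ e ∈ E, (T e).OrdConnected := by
    intro e he
    refine ordConnected_of_Ioo fun p hp q hq _ t ht => ⟨⟨hp.1.1.trans ht.1, ht.2.trans hq.1.2⟩, ?_⟩
    exact hφ.mem_of_between ((hJ n').isPreconnected_image hf e) (hEedge e he) hp.1 hq.1 ht.1 ht.2
      hp.2 hq.2
  have hTd : ∀ e ∈ E, ∀ e' ∈ E, e ≠ e' → Disjoint (T e) (T e') := by
    intro e he e' he' hne
    refine disjoint_left.2 fun t ht ht' => hne ?_
    exact ((hJ n').modEq_of_mem ht.2 ht'.2).eq_of_lt_of_lt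
      (Finset.mem_range.1 (Finset.mem_filter.1 he).1)
      (Finset.mem_range.1 (Finset.mem_filter.1 he').1)
  have hτT : ∀ e ∈ E, τ e ∈ T e := fun e he =>
    ⟨hτ01 e he, by rw [hτ e he]; exact mem_image_of_mem _ (hxJ n')⟩
  have hτinj : ∀ e ∈ E, ∀ e' ∈ E, τ e = τ e' → e = e' := by
    intro e he e' he' h
    by_contra hne
    exact disjoint_left.1 (hTd e he e' he' hne) (hτT e he) (h ▸ hτT e' he')
  -- the classes visited by an approximating orbit
  have classes : ∀ u v : X, (∀ n, u ∈ J n) → u ∈ omegaSet f v → ∀ A, A ⊆ J n0 →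
      ∀ a b c, a < b → b < c → c < M → f^[a] v ∈ A → f^[b] v ∈ A → f^[c] v ∈ A →
      ∃ L, ∀ l ≥ L, l ≡ i0 [MOD m n0] → ∀ e e', ∃ e'' ∈ E, e'' ≠ e ∧ e'' ≠ e' ∧
        ((f^[l] '' A) ∩ (f^[e''] '' J n')).Nonempty := by
    intro u v hu huv A hAJ a b c hab hbc hcM ha hb hc
    obtain ⟨p0, κ, hp⟩ := (hJ n').exists_eventually_mem hX hf (hu n') huv (inj u hu)
    refine ⟨p0, fun l hl hli e e' => ?_⟩
    have cls : ∀ j, f^[j] v ∈ A → (l + j + κ) % M ∈ E ∧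
        ((f^[l] '' A) ∩ (f^[(l + j + κ) % M] '' J n')).Nonempty := by
      intro j hj
      have h1 : f^[l + j] v ∈ f^[(l + j + κ) % M] '' J n' := by
        rw [(hJ n').image_mod]; exact hp _ (by omega)
      have h2 : f^[l + j] v ∈ f^[l] '' A := by
        rw [Function.iterate_add_apply]; exact mem_image_of_mem _ hj
      refine ⟨Finset.mem_filter.2 ⟨Finset.mem_range.2 (Nat.mod_lt _ hM0), ?_⟩, _, h2, h1⟩
      exact ((hJ n0).modEq_of_mem (hsubK _ h1) (image_mono hAJ h2)).trans hli
    have dist : ∀ j j', j < j' → j' < M → (l + j + κ) % M ≠ (l + j' + κ) % M := by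
      intro j j' hjj hjM h
      have h1 : l + j + κ ≡ l + j' + κ [MOD M] := h
      have h2 : j ≡ j' [MOD M] := Nat.ModEq.add_left_cancel' l (Nat.ModEq.add_right_cancel' κ h1)
      exact hjj.ne (h2.eq_of_lt_of_lt (hjj.trans hjM) hjM)
    have d1 := dist a b hab (hbc.trans hcM)
    have d2 := dist b c hbc hcM
    have d3 := dist a c (hab.trans hbc) hcM
    by_cases q1 : (l + a + κ) % M ≠ e ∧ (l + a + κ) % M ≠ e'
    · exact ⟨_, (cls a ha).1, q1.1, q1.2, (cls a ha).2⟩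
    by_cases q2 : (l + b + κ) % M ≠ e ∧ (l + b + κ) % M ≠ e'
    · exact ⟨_, (cls b hb).1, q2.1, q2.2, (cls b hb).2⟩
    refine ⟨_, (cls c hc).1, ?_, ?_, (cls c hc).2⟩
    · intro h; grind
    · intro h; grind
  obtain ⟨L, hL⟩ := classes x z hxJ hxz A (hAU.trans inter_subset_right) a b c hab hbc
    ((le_max_left _ _).trans_lt hn') haA hbA hcA
  obtain ⟨L', hL'⟩ := classes y w hyJ hyw B (hBV.trans inter_subset_right) a' b' c' hab' hbc'
    ((le_max_right _ _).trans_lt hn') haB hbB hcB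
  have hi0E : i0 ∈ E := Finset.mem_filter.2 ⟨Finset.mem_range.2
    (hi0.1.trans_le (Nat.le_of_dvd hM0 hdvd)), rfl⟩
  obtain ⟨e1, he1, hmax1⟩ := E.exists_max_image τ ⟨i0, hi0E⟩
  have he1' : e1 ≡ i0 [MOD m n0] := (Finset.mem_filter.1 he1).2
  have hne2 : (E.erase e1).Nonempty := by
    obtain ⟨e, he, hne, -⟩ := hL (i0 + m n0 * L)
      ((Nat.le_mul_of_pos_left L (hJ n0).2.1).trans (Nat.le_add_left _ _))
      (by simp [Nat.ModEq]) e1 e1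
    exact ⟨e, Finset.mem_erase.2 ⟨hne, he⟩⟩
  obtain ⟨e2, he2, hmax2⟩ := (E.erase e1).exists_max_image τ hne2
  obtain ⟨hne21, he2E⟩ := Finset.mem_erase.1 he2
  have lt21 : τ e2 < τ e1 := lt_of_le_of_ne (hmax1 e2 he2E) fun h => hne21 (hτinj _ he2E _ he1 h)
  set l := e1 + M * (max L L') with hl
  have hlL : max L L' ≤ l := (Nat.le_mul_of_pos_left _ hM0).trans (Nat.le_add_left _ _)
  have hl1 : l ≡ e1 [MOD M] := by simp [Nat.ModEq, hl]
  have hli : l ≡ i0 [MOD m n0] := (hl1.of_dvd hdvd).trans he1'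
  have cover : ∀ u A, IsPreconnected A → A ⊆ J n0 → u ∈ A → u ∈ J n' →
      (∃ e'' ∈ E, e'' ≠ e1 ∧ e'' ≠ e2 ∧ ((f^[l] '' A) ∩ (f^[e''] '' J n')).Nonempty) →
      f^[e2] '' J n' ⊆ f^[l] '' A := by
    rintro u A hA hAJ huA huJ ⟨e3, he3, h31, h32, p, hpA, hp3⟩
    have hAe : f^[l] '' A ⊆ φ '' Ioo 0 1 := by
      refine (image_mono hAJ).trans ?_
      rw [(hJ n0).image_congr hli]
      exact hφJ
    have lt32 : τ e3 < τ e2 := lt_of_le_of_ne (hmax2 e3 (Finset.mem_erase.2 ⟨h31, he3⟩))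
      fun h => h32 (hτinj _ he3 _ he2E h)
    obtain ⟨r3, hr3, rfl⟩ := hAe hpA
    obtain ⟨r1, hr1, hr1u⟩ := hAe (mem_image_of_mem _ huA)
    have hr1T : r1 ∈ T e1 := ⟨hr1, by
      rw [hr1u, ← (hJ n').image_congr hl1]; exact mem_image_of_mem _ huJ⟩
    intro q hq
    obtain ⟨r2, hr2, rfl⟩ := hEedge e2 he2E hq
    have h12 := lt_of_disjoint_ordConnected (hTo e2 he2E) (hTo e1 he1) (hTd _ he2E _ he1 hne21)
      (hτT e2 he2E) (hτT e1 he1) lt21 ⟨hr2, hq⟩ hr1T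
    have h23 := lt_of_disjoint_ordConnected (hTo e3 he3) (hTo e2 he2E) (hTd _ he3 _ he2E h32)
      (hτT e3 he3) (hτT e2 he2E) lt32 ⟨hr3, hp3⟩ ⟨hr2, hq⟩
    exact hφ.mem_of_between (hA.image _ (hf.iterate l).continuousOn) hAe hr3 hr1 h23 h12 hpA
      (hr1u ▸ mem_image_of_mem _ huA)
  have cA := cover x A hA (hAU.trans inter_subset_right) hxA (hxJ n')
    (hL l ((le_max_left _ _).trans hlL) hli e1 e2)
  have cB := cover y B hB (hBV.trans inter_subset_right) hyB (hyJ n')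
    (hL' l ((le_max_right _ _).trans hlL) hli e1 e2)
  have he2M : e2 < M := Finset.mem_range.1 (Finset.mem_filter.1 he2E).1
  have fin : ∀ C W, C ⊆ W ∩ J n0 → f^[e2] '' J n' ⊆ f^[l] '' C →
      J n' ⊆ f^[(M - e2) + l] '' (W ∩ J n) := by
    intro C W hC hcov
    have h1 : f^[M - e2] '' (f^[e2] '' J n') = J n' := by
      rw [← image_comp, ← Function.iterate_add, Nat.sub_add_cancel he2M.le, (hJ n').2.2.1]
    rw [Function.iterate_add, image_comp, ← h1]
    refine image_mono (hcov.trans (image_mono (hC.trans ?_)))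
    exact inter_subset_inter_right _ (hanti hmn0)
  exact ⟨(M - e2) + l, by omega, n', fin A U hAU cA, fin B V hBV cB⟩

theorem exists_forall_iterate_mem_of_cover {X : Type*} [TopologicalSpace X] [CompactSpace X]
    {f : X → X} (hf : Continuous f) {J W : ℕ → Set X} {s : ℕ → ℕ} (hJ : ∀ k, (J k).Nonempty)
    (hW : ∀ k, IsClosed (W k)) (hs : ∀ k, J (k + 1) ⊆ f^[s k] '' (W k ∩ J k)) :
    ∃ p, ∀ k, f^[∑ i ∈ Finset.range k, s i] p ∈ W k := by
  set t : ℕ → ℕ := fun k => ∑ i ∈ Finset.range k, s i with ht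
  have key : ∀ K, ∀ q ∈ J K, ∃ p, f^[t K] p = q ∧ ∀ k < K, f^[t k] p ∈ W k := by
    intro K
    induction K with
    | zero => exact fun q _ => ⟨q, by simp [ht], fun k hk => absurd hk (Nat.not_lt_zero k)⟩
    | succ K ih =>
      intro q hq
      obtain ⟨q', ⟨hqW, hqJ⟩, rfl⟩ := hs K hq
      obtain ⟨p, rfl, hp⟩ := ih q' hqJ
      refine ⟨p, ?_, fun k hk => ?_⟩
      · rw [← Function.iterate_add_apply]
        congr 2
        simp only [ht, Finset.sum_range_succ]
        ring
      · rcases Nat.lt_succ_iff_lt_or_eq.1 hk with h | rfl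
        · exact hp k h
        · exact hqW
  have hcl : ∀ K, IsClosed {p | ∀ k < K, f^[t k] p ∈ W k} := by
    intro K
    simp only [ofPred_forall]
    exact isClosed_iInter fun k => isClosed_iInter fun _ => (hW k).preimage (hf.iterate _)
  obtain ⟨p, hp⟩ := IsCompact.nonempty_iInter_of_sequence_nonempty_isCompact_isClosed
    (fun K => {p | ∀ k < K, f^[t k] p ∈ W k}) (fun K p hp k hk => hp k (hk.trans K.lt_succ_self))
    (fun K => by
      obtain ⟨q, hq⟩ := hJ K
      obtain ⟨p, -, hp⟩ := key K q hq
      exact ⟨p, hp⟩) (hcl 0).isCompact hcl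
  exact ⟨p, fun k => mem_iInter.1 hp (k + 1) k k.lt_succ_self⟩

theorem not_countable_range_nat_bool {X : Type*} {g : (ℕ → Bool) → X} (hg : Function.Injective g) :
    ¬ (range g).Countable := by
  intro hc
  have := hc.to_subtype
  have : Countable (ℕ → Bool) := (rangeFactorization_injective.2 hg).countable
  obtain ⟨e, he⟩ := exists_injective_nat (ℕ → Bool)
  exact Function.cantor_injective (fun s : Set ℕ => e fun n => by classical exact decide (n ∈ s))
    fun s s' h => by
      ext n
      simpa using congrFun (he h) n

theorem IsNSPair.liYorkeChaotic {X : Type*} [MetricSpace X] (hX : IsTopGraph X) {f : X → X}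
    (hf : Continuous f) {x y : X} (h : IsNSPair f x y) : LiYorkeChaotic f := by
  have := hX.1
  obtain ⟨hxy, hx, hy, J, m, hJ, hJs, hm, hmem⟩ := h
  obtain ⟨z, hz⟩ := mem_iUnion.1 hx
  obtain ⟨w, hw⟩ := mem_iUnion.1 hy
  have cov := fun k n => exists_cover_of_nested hX hf hz hw hJ (antitone_nat_of_succ_le hJs) hm
    (fun n => (hmem n).1) (fun n => (hmem n).2) n
    (Metric.closedBall_mem_nhds x (ε := 1 / ((k : ℕ) + 1 : ℝ)) (by positivity))
    (Metric.closedBall_mem_nhds y (ε := 1 / ((k : ℕ) + 1 : ℝ)) (by positivity))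
  choose s hs1 N hU hV using cov
  let n : ℕ → ℕ := fun k => Nat.rec 0 (fun k r => N k r) k
  set t : ℕ → ℕ := fun k => ∑ i ∈ Finset.range k, s i (n i) with ht
  have htk : ∀ k, k ≤ t k := by
    intro k
    calc k = ∑ i ∈ Finset.range k, 1 := by simp
      _ ≤ t k := Finset.sum_le_sum fun i _ => hs1 _ _
  have main : ∀ σ : ℕ → Bool, ∃ p, ∀ k, f^[t k] p ∈
      if σ k then Metric.closedBall x (1 / ((k : ℕ) + 1 : ℝ))
      else Metric.closedBall y (1 / ((k : ℕ) + 1 : ℝ)) := by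
    intro σ
    refine exists_forall_iterate_mem_of_cover hf (J := fun k => J (n k))
      (fun k => (hJ _).1.2.1.nonempty) (fun k => ?_) fun k => ?_
    · split_ifs <;> exact Metric.isClosed_closedBall
    · split_ifs
      · exact hU k (n k)
      · exact hV k (n k)
  choose p hp using main
  have same : ∀ σ σ' k, σ k = σ' k → dist (f^[t k] (p σ)) (f^[t k] (p σ')) ≤ 2 / ((k : ℕ) + 1) := by
    intro σ σ' k hk
    have h1 := hp σ k
    have h2 := hp σ' k
    rw [← hk] at h2
    have e : (2 : ℝ) / (k + 1) = 1 / (k + 1) + 1 / (k + 1) := by ring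
    rw [e]
    split_ifs at h1 h2
    · exact (dist_triangle_right _ _ x).trans (add_le_add h1 h2)
    · exact (dist_triangle_right _ _ y).trans (add_le_add h1 h2)
  have diff : ∀ σ σ' k, σ k ≠ σ' k →
      dist x y - 2 / ((k : ℕ) + 1) ≤ dist (f^[t k] (p σ)) (f^[t k] (p σ')) := by
    intro σ σ' k hk
    have h1 := hp σ k
    have h2 := hp σ' k
    have e : (2 : ℝ) / (k + 1) = 1 / (k + 1) + 1 / (k + 1) := by ring
    rw [e]
    have t1 := fun u v : X => dist_triangle4 x u v y
    have t2 := fun u v : X => dist_triangle4 y u v x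
    cases hσ : σ k <;> cases hσ' : σ' k <;> simp only [hσ, hσ', ne_eq, not_true_eq_false,
      Bool.false_eq_true, if_true, if_false, Metric.mem_closedBall] at hk h1 h2
    · have := t2 (f^[t k] (p σ)) (f^[t k] (p σ'))
      rw [dist_comm y x, dist_comm y] at this
      linarith
    · have := t1 (f^[t k] (p σ)) (f^[t k] (p σ'))
      rw [dist_comm x (f^[t k] (p σ))] at this
      linarith
  have small : ∀ ε > (0:ℝ), ∃ K : ℕ, ∀ k ≥ K, 2 / ((k : ℕ) + 1 : ℝ) < ε := by
    intro ε hε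
    obtain ⟨K, hK⟩ := exists_nat_gt (2 / ε)
    refine ⟨K, fun k hk => ?_⟩
    rw [div_lt_iff₀ hε] at hK
    rw [div_lt_iff₀ (by positivity)]
    have : (K : ℝ) ≤ k := by exact_mod_cast hk
    nlinarith
  let code : (ℕ → Bool) → ℕ → Bool := fun α k =>
    if k % 2 = 0 then true else α (Nat.unpair (k / 2)).1
  have hprox : ∀ σ σ', (∀ N, ∃ k ≥ N, σ k = σ' k) → Proximal f (p σ) (p σ') := by
    intro σ σ' h ε hε M
    obtain ⟨K, hK⟩ := small ε hε
    obtain ⟨k, hk, he⟩ := h (max M K)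
    exact ⟨t k, (le_max_left _ _).trans (hk.trans (htk k)),
      (same σ σ' k he).trans_lt (hK k ((le_max_right _ _).trans hk))⟩
  have hnas : ∀ σ σ', (∀ N, ∃ k ≥ N, σ k ≠ σ' k) → ¬ Asymptotic f (p σ) (p σ') := by
    intro σ σ' h has
    have hd := dist_pos.2 hxy
    obtain ⟨K, hK⟩ := small (dist x y / 2) (by positivity)
    obtain ⟨M, hM⟩ := eventually_atTop.1 (has.eventually_lt_const (half_pos hd))
    obtain ⟨k, hk, he⟩ := h (max M K)
    have h1 := hM (t k) ((le_max_left _ _).trans (hk.trans (htk k)))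
    have h2 := hK k ((le_max_right _ _).trans hk)
    have h3 := diff σ σ' k he
    linarith
  have scr : ∀ α β, α ≠ β → ScrambledPair f (p (code α)) (p (code β)) := by
    intro α β hne
    obtain ⟨j, hj⟩ := Function.ne_iff.1 hne
    refine ⟨hprox _ _ fun N => ⟨2 * N, by omega, by simp [code]⟩, hnas _ _ fun N => ?_⟩
    refine ⟨2 * Nat.pair j N + 1, ?_, ?_⟩
    · have := Nat.right_le_pair j N
      omega
    · have e : (2 * Nat.pair j N + 1) / 2 = Nat.pair j N := by omega
      simpa [code, e] using hj
  have hinj : Function.Injective fun α => p (code α) := by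
    intro α β h
    by_contra hne
    refine (scr α β hne).2 ?_
    simp only at h
    rw [h]
    simp [Asymptotic]
  refine ⟨range fun α => p (code α), not_countable_range_nat_bool hinj, ?_⟩
  rintro _ ⟨α, rfl⟩ _ ⟨β, rfl⟩ hne
  exact scr α β fun h => hne (by rw [h])

theorem IsTopGraph.exists_finite_chart_seq_tendsto {X : Type*} [MetricSpace X]
    (h : IsTopGraph X) : ∃ C : Set (ℝ → X), C.Finite ∧ (∀ φ ∈ C, IsChart φ) ∧
      ∀ (A : Set X) (c : X), c ∈ closure A → c ∉ A → ∃ φ ∈ C, ∃ (r : ℕ → ℝ) (ρ : ℝ),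
        StrictMono r ∧ (∀ k, r k ∈ Ioo (0:ℝ) 1) ∧ (∀ k, φ (r k) ∈ A) ∧ Tendsto r atTop (𝓝 ρ) ∧
        ρ ≤ 1 ∧ (∀ k, r k < ρ) ∧ φ ρ = c := by
  obtain ⟨C, hC, hCc, hCA⟩ := h.exists_finite_chart_seq
  refine ⟨C, hC, hCc, fun A c hc hcA => ?_⟩
  obtain ⟨u, huA, hu⟩ := mem_closure_iff_seq_limit.1 hc
  have hinf : (range u).Infinite := by
    intro hfin
    have : c ∈ range u := hfin.isClosed.mem_of_tendsto hu (Eventually.of_forall mem_range_self)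
    exact hcA (range_subset_iff.2 huA this)
  obtain ⟨φ, hφC, r, hr, hr01, hrA⟩ := hCA _ hinf
  have hφ := hCc φ hφC
  have hbdd : BddAbove (range r) := ⟨1, by rintro _ ⟨k, rfl⟩; exact (hr01 k).2.le⟩
  have ht := tendsto_atTop_ciSup hr.monotone hbdd
  refine ⟨φ, hφC, r, ⨆ k, r k, hr, hr01, fun k => range_subset_iff.2 huA (hrA k), ht,
    ciSup_le fun k => (hr01 k).2.le,
    fun k => (hr k.lt_succ_self).trans_le (le_ciSup hbdd (k + 1)), ?_⟩
  by_contra hne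
  obtain ⟨O₁, O₂, hO₁, hO₂, h1, h2, hd⟩ := t2_separation hne
  obtain ⟨N, hN⟩ := eventually_atTop.1 (hu (hO₂.mem_nhds h2))
  obtain ⟨M, hM⟩ := eventually_atTop.1 ((hφ.cont.tendsto _).comp ht (hO₁.mem_nhds h1))
  have hsub : range (fun k => φ (r (M + k))) ⊆ u '' Iio N := by
    rintro _ ⟨k, rfl⟩
    obtain ⟨n, hn⟩ := hrA (M + k)
    refine ⟨n, ?_, hn⟩
    by_contra hNn
    refine disjoint_left.1 hd (hM (M + k) (Nat.le_add_right _ _)) ?_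
    simp only [Function.comp_apply, ← hn]
    exact hN n (not_lt.1 hNn)
  refine (infinite_range_of_injective ?_) (((finite_Iio N).image u).subset hsub)
  intro i j hij
  have := hr.injective (hφ.inj (Ioo_subset_Icc_self (hr01 _)) (Ioo_subset_Icc_self (hr01 _)) hij)
  omega

theorem IsTopGraph.exists_chart_seq_tendsto {X : Type*} [MetricSpace X] (h : IsTopGraph X)
    {A : Set X} {c : X} (hc : c ∈ closure A) (hcA : c ∉ A) :
    ∃ (φ : ℝ → X) (r : ℕ → ℝ) (ρ : ℝ), IsChart φ ∧ StrictMono r ∧ (∀ k, r k ∈ Ioo (0:ℝ) 1) ∧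
      (∀ k, φ (r k) ∈ A) ∧ Tendsto r atTop (𝓝 ρ) ∧ ρ ≤ 1 ∧ (∀ k, r k < ρ) ∧ φ ρ = c :=
  let ⟨_, _, hC, h⟩ := h.exists_finite_chart_seq_tendsto
  let ⟨φ, hφ, r, ρ, hr⟩ := h A c hc hcA
  ⟨φ, r, ρ, hC φ hφ, hr⟩

theorem IsChart.map_mem_Ioo {X : Type*} [TopologicalSpace X] [T2Space X] {φ : ℝ → X}
    (hφ : IsChart φ) {g : X → X} (hg : Continuous g) {σ ρ : ℝ} (hσ0 : 0 < σ) (hσρ : σ < ρ)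
    (hρ : ρ ≤ 1) (hne : ∀ s ∈ Ico σ ρ, g (φ s) ≠ φ s ∧ g (φ s) ≠ φ ρ)
    (h : g (φ σ) ∈ φ '' Ioo σ ρ) : ∀ s ∈ Ico σ ρ, g (φ s) ∈ φ '' Ioo s ρ := by
  have hσ := hσ0.le
  have key := (isPreconnected_Ico (a := σ) (b := ρ)).subset_left_of_subset_union
    (u := ⋃ b ∈ Ico σ ρ, Iio b ∩ (fun s => g (φ s)) ⁻¹' (φ '' Ioo b ρ))
    (v := ⋃ b, Ioi b ∩ (fun s => g (φ s)) ⁻¹' (φ '' Icc b ρ)ᶜ)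
    (isOpen_biUnion fun b hb => isOpen_Iio.inter
      ((hφ.isOpen_image_Ioo (hσ.trans hb.1) hρ).preimage (hg.comp hφ.cont)))
    (isOpen_iUnion fun b => isOpen_Ioi.inter
      ((hφ.isClosed_image_Icc b ρ).isOpen_compl.preimage (hg.comp hφ.cont)))
  have hdis : Disjoint (⋃ b ∈ Ico σ ρ, Iio b ∩ (fun s => g (φ s)) ⁻¹' (φ '' Ioo b ρ))
      (⋃ b, Ioi b ∩ (fun s => g (φ s)) ⁻¹' (φ '' Icc b ρ)ᶜ) := by
    refine disjoint_left.2 fun s h1 h2 => ?_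
    simp only [mem_iUnion] at h1 h2
    obtain ⟨b, hb, hsb, hb'⟩ := h1
    obtain ⟨e, hes, he⟩ := h2
    exact he (image_mono (Ioo_subset_Icc_self.trans (Icc_subset_Icc_left (hes.trans hsb).le)) hb')
  have hcov : Ico σ ρ ⊆ (⋃ b ∈ Ico σ ρ, Iio b ∩ (fun s => g (φ s)) ⁻¹' (φ '' Ioo b ρ)) ∪
      ⋃ b, Ioi b ∩ (fun s => g (φ s)) ⁻¹' (φ '' Icc b ρ)ᶜ := by
    intro s hs
    by_cases hsv : g (φ s) ∈ φ '' Icc s ρ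
    · left
      obtain ⟨v, hv, hve⟩ := hsv
      have h1 : s < v := lt_of_le_of_ne hv.1 fun e => (hne s hs).1 (by rw [← hve, e])
      have h2 : v < ρ := lt_of_le_of_ne hv.2 fun e => (hne s hs).2 (by rw [← hve, e])
      obtain ⟨b, hsb, hbv⟩ := exists_between h1
      exact mem_biUnion (x := b) ⟨hs.1.trans hsb.le, hbv.trans h2⟩ ⟨hsb, v, ⟨hbv, h2⟩, hve⟩
    · right
      by_cases hex : ∃ v ∈ Ico 0 s, φ v = g (φ s)
      · obtain ⟨v, hv, hve⟩ := hex
        obtain ⟨b, hvb, hbs⟩ := exists_between hv.2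
        refine mem_iUnion.2 ⟨b, hbs, ?_⟩
        rintro ⟨w, hw, hwe⟩
        have := hφ.inj ⟨hv.1.trans (hvb.le.trans hw.1), hw.2.trans hρ⟩
          ⟨hv.1, hv.2.le.trans (hs.2.le.trans hρ)⟩ (hwe.trans hve.symm)
        exact (hvb.trans_le hw.1).ne' this
      · refine mem_iUnion.2 ⟨0, hσ0.trans_le hs.1, ?_⟩
        rintro ⟨w, hw, hwe⟩
        rcases lt_or_ge w s with h | h
        · exact hex ⟨w, ⟨hw.1, h⟩, hwe⟩
        · exact hsv ⟨w, ⟨h, hw.2⟩, hwe⟩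
  intro s hs
  have := key hdis hcov ⟨σ, ⟨le_rfl, hσρ⟩, by
    obtain ⟨v, hv, hve⟩ := h
    obtain ⟨b, hsb, hbv⟩ := exists_between hv.1
    exact mem_biUnion (x := b) ⟨hsb.le, hbv.trans hv.2⟩ ⟨hsb, v, ⟨hbv, hv.2⟩, hve⟩⟩ hs
  simp only [mem_iUnion] at this
  obtain ⟨b, hb, hsb, v, hv, hve⟩ := this
  exact ⟨v, ⟨hsb.trans hv.1, hv.2⟩, hve⟩

/-- A decreasing sequence of connected invariant sets absorbing the orbit of `x` whose
intersection contains no periodic point. -/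
structure IsTrap {X : Type*} [TopologicalSpace X] (f : X → X) (x : X) (Z : ℕ → Set X) : Prop where
  preconn : ∀ n, IsPreconnected (Z n)
  anti : Antitone Z
  maps : ∀ n, MapsTo f (Z n) (Z n)
  mem : ∀ n, ∀ᶠ l in atTop, f^[l] x ∈ Z n
  noper : ∀ c n, 1 ≤ n → f^[n] c = c → ∃ k, c ∉ Z k

section

variable {X : Type*} [MetricSpace X] {f : X → X} {x : X}

theorem exists_mem_of_mem_omegaSet {a : X} {φ : ℝ → X} (hφ : IsChart φ) {s r t : ℝ}
    (hs : 0 ≤ s) (ht : t ≤ 1) (hr : r ∈ Ioo s t) (ha : φ r = a) (hax : a ∈ omegaSet f x) (N : ℕ) :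
    ∃ m ≥ N, ∃ u ∈ Ioo s t, φ u = f^[m] x := by
  obtain ⟨m, hm, u, hu, h⟩ := mem_omegaSet_iff.1 hax _ (hφ.isOpen_image_Ioo hs ht)
    ⟨r, hr, ha⟩ N
  exact ⟨m, hm, u, hu, h⟩

/-- A set of finitely many periodic points in an infinite `ω`-limit set is accumulated by the
remaining limit points. -/
theorem exists_mem_closure_sdiff [CompactSpace X] (hf : Continuous f)
    (hinf : (omegaSet f x).Infinite) {P : Set X} (hP : P.Finite) (hfP : MapsTo f P P) {c : X}
    (hc : c ∈ omegaSet f x) (hcP : c ∈ P) : ∃ p ∈ P, p ∈ closure (omegaSet f x \ P) := by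
  by_contra! hcon
  obtain ⟨V, hV, hPV, hVc⟩ := normal_exists_closure_subset hP.isClosed
    (isClosed_closure (s := omegaSet f x \ P)).isOpen_compl hcon
  have hVω : ∀ a ∈ closure V, a ∈ omegaSet f x → a ∈ P := by
    intro a ha hax
    by_contra haP
    exact hVc ha (subset_closure ⟨hax, haP⟩)
  have hU : IsOpen (V ∩ f ⁻¹' V) := hV.inter (hV.preimage hf)
  have hPU : P ⊆ V ∩ f ⁻¹' V := fun p hp => ⟨hPV hp, hPV (hfP hp)⟩
  have hW : IsOpen (closure V \ (V ∩ f ⁻¹' V))ᶜ :=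
    (isClosed_closure.sdiff hU).isOpen_compl
  obtain ⟨N, hN⟩ := eventually_atTop.1 (eventually_mem_of_omegaSet_subset (f := f) (x := x) hW
    fun a ha h => h.2 (hPU (hVω a h.1 ha)))
  obtain ⟨m, hm, hmU⟩ := mem_omegaSet_iff.1 hc _ hU (hPU hcP) N
  have stay : ∀ k ≥ m, f^[k] x ∈ V ∩ f ⁻¹' V := by
    intro k hk
    induction k, hk using Nat.le_induction with
    | base => exact hmU
    | succ k hk ih =>
      have h1 : f^[k + 1] x ∈ V := by
        rw [Function.iterate_succ_apply']; exact ih.2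
      by_contra h2
      exact hN (k + 1) (by omega) ⟨subset_closure h1, h2⟩
  have : omegaSet f x ⊆ P := by
    intro a ha
    refine hVω a ?_ ha
    exact omegaSet_subset_of_eventually isClosed_closure
      (eventually_atTop.2 ⟨m, fun k hk => subset_closure (stay k hk).1⟩) ha
  exact hinf (hP.subset this)

theorem IsTrap.iterate_ne [CompactSpace X] (hX : IsTopGraph X) (hf : Continuous f)
    (hinf : (omegaSet f x).Infinite) {Z : ℕ → Set X} (hZ : IsTrap f x Z) {c : X}
    (hc : c ∈ omegaSet f x) {n : ℕ} (hn : 1 ≤ n) : f^[n] c ≠ c := by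
  intro hper
  have hiter : ∀ j, f^[n] (f^[j] c) = f^[j] c := fun j => by
    rw [← Function.iterate_add_apply, add_comm, Function.iterate_add_apply, hper]
  have hP : MapsTo f ((fun j => f^[j] c) '' Iio n) ((fun j => f^[j] c) '' Iio n) := by
    rintro _ ⟨j, hj, rfl⟩
    rcases Nat.lt_or_ge (j + 1) n with h | h
    · exact ⟨j + 1, h, by simp only [Function.iterate_succ_apply']⟩
    · obtain rfl : n = j + 1 := by have := mem_Iio.1 hj; omega
      refine ⟨0, hn, ?_⟩
      simp only [← Function.iterate_succ_apply' f]
      exact hper.symm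
  obtain ⟨_, ⟨j, hj, rfl⟩, hcl⟩ := exists_mem_closure_sdiff hf hinf ((finite_Iio n).image _) hP hc
    ⟨0, hn, rfl⟩
  obtain ⟨φ, r, ρ, hφ, hr, hr01, hrA, hrρt, hρ1, hrρ, hφρ⟩ :=
    hX.exists_chart_seq_tendsto hcl fun h => h.2 ⟨j, hj, rfl⟩
  simp only at hφρ
  obtain ⟨k₁, hk₁⟩ := hZ.noper _ n hn (hiter j)
  rw [← hφρ] at hk₁
  have lt : ∀ i j, i < j → r i < r j := fun i j h => hr h
  have hZsub : ∀ m, ∀ s ∈ Ico (r 2) ρ, φ s ∈ Z m := by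
    have main : ∀ m ≥ k₁, ∀ s ∈ Ico (r 2) ρ, φ s ∈ Z m := by
      intro m hm s hs
      by_contra hsZ
      obtain ⟨N, hN⟩ := eventually_atTop.1 (hZ.mem m)
      obtain ⟨k, hk⟩ : ∃ k, s < r k := (hrρt.eventually_const_lt hs.2).exists
      obtain ⟨l, hl, p, hp, hpe⟩ := exists_mem_of_mem_omegaSet hφ (hr01 0).1.le (hr01 2).2.le
        ⟨lt 0 1 (by omega), lt 1 2 (by omega)⟩ rfl (hrA 1).1 N
      obtain ⟨l', hl', q, hq, hqe⟩ := exists_mem_of_mem_omegaSet hφ (hr01 k).1.le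
        (hr01 (k + 2)).2.le ⟨lt k (k + 1) (by omega), lt (k + 1) (k + 2) (by omega)⟩ rfl
        (hrA (k + 1)).1 N
      have hs0 : 0 ≤ s := (hr01 2).1.le.trans hs.1
      have := hφ.subset_of_notMem (hZ.preconn m) hs0 (hk.trans hq.1)
        (hq.2.trans (hrρ (k + 2))) hρ1 (hqe ▸ hN l' hl') hsZ fun h => hk₁ (hZ.anti hm h)
      have h2 := (hφ.mem_image_Ioo hs0 hρ1
        ⟨(hr01 0).1.le.trans hp.1.le, hp.2.le.trans (hr01 2).2.le⟩).1 (this (hpe ▸ hN l hl))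
      exact (h2.1.trans (hp.2.trans_le hs.1)).false
    intro m s hs
    rcases le_total k₁ m with h | h
    · exact main m h s hs
    · exact hZ.anti h (main k₁ le_rfl s hs)
  obtain ⟨i, -, σ, hσ, hσe⟩ := exists_mem_of_mem_omegaSet hφ (hr01 2).1.le (hr01 4).2.le
    ⟨lt 2 3 (by omega), lt 3 4 (by omega)⟩ rfl (hrA 3).1 0
  obtain ⟨i', hi', σ', hσ', hσe'⟩ := exists_mem_of_mem_omegaSet hφ (hr01 4).1.le (hr01 6).2.le
    ⟨lt 4 5 (by omega), lt 5 6 (by omega)⟩ rfl (hrA 5).1 (i + 1)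
  obtain ⟨q, rfl⟩ := Nat.exists_eq_add_of_lt (Nat.lt_of_succ_le hi')
  have hσρ : σ < ρ := hσ.2.trans (hrρ 4)
  have hIco : Ico σ ρ ⊆ Ico (r 2) ρ := Ico_subset_Ico_left hσ.1.le
  have hadv := hφ.map_mem_Ioo (hf.iterate (q + 1)) ((hr01 2).1.trans hσ.1) hσρ hρ1
    (fun s hs => ⟨fun he => ?_, fun he => ?_⟩) ⟨σ', ⟨hσ.2.trans hσ'.1, hσ'.2.trans (hrρ 6)⟩, ?_⟩
  rotate_left
  · obtain ⟨k, hk⟩ := hZ.noper _ (q + 1) (by omega) he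
    exact hk (hZsub k s (hIco hs))
  · exact hk₁ (he ▸ (hZ.maps k₁).iterate (q + 1) (hZsub k₁ s (hIco hs)))
  · rw [hσe', hσe, ← Function.iterate_add_apply]
    congr 1; omega
  choose! w hw hwe using hadv
  let v : ℕ → ℝ := fun k => w^[k] σ
  have hv : ∀ k, v k ∈ Ico σ ρ ∧ φ (v k) = f^[i + (q + 1) * k] x := by
    intro k
    induction k with
    | zero => exact ⟨⟨le_rfl, hσρ⟩, by simpa [v] using hσe⟩
    | succ k ih =>
      have e : v (k + 1) = w (v k) := Function.iterate_succ_apply' _ _ _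
      have h1 := hw (v k) ih.1
      refine ⟨e ▸ ⟨ih.1.1.trans h1.1.le, h1.2⟩, ?_⟩
      rw [e, hwe _ ih.1, ih.2, ← Function.iterate_add_apply]
      congr 1; ring
  have hmono : Monotone v := monotone_nat_of_le_succ fun k => by
    have e : v (k + 1) = w (v k) := Function.iterate_succ_apply' _ _ _
    rw [e]; exact (hw _ (hv k).1).1.le
  have htend := (hφ.cont.tendsto _).comp (tendsto_atTop_ciSup hmono
    ⟨ρ, by rintro _ ⟨k, rfl⟩; exact (hv k).1.2.le⟩)
  refine hinf (omegaSet_finite_of_tendsto hf (i := i) (n := q + 1) (by omega)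
    (htend.congr fun k => ?_))
  exact (hv k).2

end

/-- Connected neighbourhoods shrinking to `x`. -/
structure IsConnBasis {X : Type*} [MetricSpace X] (x : X) (B : ℕ → Set X) : Prop where
  preconn : ∀ n, IsPreconnected (B n)
  isOpen : ∀ n, IsOpen (B n)
  mem : ∀ n, x ∈ B n
  anti : Antitone B
  small : ∀ ε > 0, ∃ n, B n ⊆ Metric.ball x ε

theorem exists_isConnBasis {X : Type*} [MetricSpace X] [LocallyConnectedSpace X] (x : X) :
    ∃ B, IsConnBasis x B := by
  refine ⟨fun n : ℕ => connectedComponentIn (Metric.ball x (1 / (n + 1 : ℝ))) x,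
    fun n => isPreconnected_connectedComponentIn, fun n => Metric.isOpen_ball.connectedComponentIn,
    fun n => mem_connectedComponentIn (Metric.mem_ball_self (by positivity)),
    fun m n hmn => connectedComponentIn_mono x (Metric.ball_subset_ball ?_), fun ε hε => ?_⟩
  · exact one_div_le_one_div_of_le (by positivity) (by exact_mod_cast Nat.add_le_add_right hmn 1)
  · obtain ⟨n, hn⟩ := exists_nat_one_div_lt hε
    exact ⟨n, (connectedComponentIn_subset _ _).trans (Metric.ball_subset_ball hn.le)⟩

theorem NoHorseshoe.exists_not_subset {X : Type*} [MetricSpace X] [CompactSpace X] {f : X → X}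
    (h : NoHorseshoe f) (hf : Continuous f) {x : X} {B : ℕ → Set X} (hB : IsConnBasis x B)
    {D : Set X} {i i' : ℕ} (hne : f^[i] x ≠ f^[i'] x) (hi : D ∈ 𝓝 (f^[i] x))
    (hi' : D ∈ 𝓝 (f^[i'] x)) : ∃ n, ∀ m ≥ n, ∀ p, ¬ D ⊆ f^[p] '' B m := by
  obtain ⟨η, hη, hηD⟩ := Metric.mem_nhds_iff.1 hi
  obtain ⟨η', hη', hηD'⟩ := Metric.mem_nhds_iff.1 hi'
  have hd := dist_pos.2 hne
  set δ := min (min η η') (dist (f^[i] x) (f^[i'] x) / 3) with hδ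
  have hδ0 : 0 < δ := lt_min (lt_min hη hη') (by positivity)
  have hδ3 : 3 * δ ≤ dist (f^[i] x) (f^[i'] x) := by
    have := min_le_right (min η η') (dist (f^[i] x) (f^[i'] x) / 3)
    rw [← hδ] at this
    linarith
  obtain ⟨ε, hε, hclose⟩ := exists_forall_iterate_dist_lt hf (max i i') hδ0
  obtain ⟨n, hn⟩ := hB.small ε hε
  refine ⟨n, fun m hm p hp => ?_⟩
  have hBm : ∀ u ∈ B m, ∀ j ≤ max i i', dist (f^[j] u) (f^[j] x) < δ := fun u hu =>
    hclose u x (hn (hB.anti hm hu))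
  have hiD : f^[i] '' B m ⊆ D := by
    rintro _ ⟨u, hu, rfl⟩
    exact hηD ((hBm u hu i (le_max_left _ _)).trans_le ((min_le_left _ _).trans (min_le_left _ _)))
  have hiD' : f^[i'] '' B m ⊆ D := by
    rintro _ ⟨u, hu, rfl⟩
    exact hηD' ((hBm u hu i' (le_max_right _ _)).trans_le
      ((min_le_left _ _).trans (min_le_right _ _)))
  have hpm : max i i' < p := by
    by_contra! hle
    obtain ⟨u, hu, hue⟩ := hp (mem_of_mem_nhds hi)
    obtain ⟨u', hu', hue'⟩ := hp (mem_of_mem_nhds hi')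
    have h1 := hBm u hu p hle
    have h2 := hBm u' hu' p hle
    have h3 := dist_triangle_right (f^[p] u) (f^[p] u') (f^[p] x)
    rw [hue, hue'] at h3
    rw [hue] at h1
    rw [hue'] at h2
    linarith
  have him := hpm
  rw [max_lt_iff] at him
  refine h (f^[i] '' B m) (f^[i'] '' B m) ⟨_, mem_image_of_mem _ (hB.mem m)⟩ δ hδ0 ?_ (p - i)
    (by omega) (p - i') (by omega) ?_ ?_
  · rintro _ ⟨u, hu, rfl⟩ _ ⟨u', hu', rfl⟩
    have h1 := hBm u hu i (le_max_left _ _)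
    have h2 := hBm u' hu' i' (le_max_right _ _)
    have h3 := dist_triangle4 (f^[i] x) (f^[i] u) (f^[i'] u') (f^[i'] x)
    rw [dist_comm (f^[i] x) (f^[i] u)] at h3
    linarith
  · rw [← image_comp, ← Function.iterate_add, Nat.sub_add_cancel him.1.le]
    exact (union_subset hiD hiD').trans hp
  · rw [← image_comp, ← Function.iterate_add, Nat.sub_add_cancel him.2.le]
    exact (union_subset hiD hiD').trans hp

/-- A subarc `[a, d]` of an edge free of periodic points, both ends `[a, b]`, `[c, d]` of which
have two points of the orbit of `x` in their interior. -/
structure IsCell {X : Type*} [TopologicalSpace X] (f : X → X) (x : X) (φ : ℝ → X)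
    (a b c d : ℝ) : Prop where
  chart : IsChart φ
  pos : 0 < a
  ab : a < b
  bc : b < c
  cd : c < d
  lt_one : d < 1
  left : ∃ i i', f^[i] x ≠ f^[i'] x ∧ f^[i] x ∈ φ '' Ioo a b ∧ f^[i'] x ∈ φ '' Ioo a b
  right : ∃ i i', f^[i] x ≠ f^[i'] x ∧ f^[i] x ∈ φ '' Ioo c d ∧ f^[i'] x ∈ φ '' Ioo c d
  noper : ∀ t ∈ Icc a d, ∀ n, 1 ≤ n → f^[n] (φ t) ≠ φ t

section

variable {X : Type*} [MetricSpace X] {f : X → X} {x : X}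

theorem exists_two_iterates_mem {φ : ℝ → X} (hφ : IsChart φ) {r : ℕ → ℝ} (hr : StrictMono r)
    (hr01 : ∀ k, r k ∈ Ioo (0:ℝ) 1) (hrω : ∀ k, φ (r k) ∈ omegaSet f x) (k : ℕ) :
    ∃ i i', f^[i] x ≠ f^[i'] x ∧ f^[i] x ∈ φ '' Ioo (r k) (r (k + 4)) ∧
      f^[i'] x ∈ φ '' Ioo (r k) (r (k + 4)) := by
  have lt : ∀ i j, i < j → r i < r j := fun i j h => hr h
  obtain ⟨i, -, u, hu, hue⟩ := exists_mem_of_mem_omegaSet hφ (hr01 k).1.le (hr01 (k + 2)).2.le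
    ⟨lt k (k + 1) (by omega), lt _ (k + 2) (by omega)⟩ rfl (hrω (k + 1)) 0
  obtain ⟨i', -, v, hv, hve⟩ := exists_mem_of_mem_omegaSet hφ (hr01 (k + 2)).1.le
    (hr01 (k + 4)).2.le
    ⟨lt (k + 2) (k + 3) (by omega), lt _ (k + 4) (by omega)⟩ rfl (hrω (k + 3)) 0
  refine ⟨i, i', ?_, ⟨u, ⟨hu.1, hu.2.trans (lt _ _ (by omega))⟩, hue⟩,
    ⟨v, ⟨(lt _ _ (by omega)).trans hv.1, hv.2⟩, hve⟩⟩
  rw [← hue, ← hve]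
  intro he
  have := hφ.inj ⟨(hr01 k).1.le.trans hu.1.le, hu.2.le.trans (hr01 _).2.le⟩
    ⟨(hr01 _).1.le.trans hv.1.le, hv.2.le.trans (hr01 _).2.le⟩ he
  exact (hu.2.trans hv.1).ne this

theorem IsTrap.exists_isCell (hX : IsTopGraph X) (hf : Continuous f)
    (hinf : (omegaSet f x).Infinite) {Z : ℕ → Set X} (hZ : IsTrap f x Z) {a : X}
    (ha : a ∈ omegaSet f x) :
    ∃ (n : ℕ) (φ : ℝ → X) (a₁ a₂ a₃ a₄ : ℝ), IsCell f x φ a₁ a₂ a₃ a₄ ∧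
      f^[n] a ∈ φ '' Ioo a₂ a₃ := by
  have := hX.1
  have hinj : ∀ i j, i < j → f^[i] a ≠ f^[j] a := by
    intro i j hij he
    refine hZ.iterate_ne hX hf hinf (iterate_mem_omegaSet hf ha i) (n := j - i) (by omega) ?_
    rw [← Function.iterate_add_apply, Nat.sub_add_cancel hij.le, he]
  have hA : (range fun n => f^[n] a).Infinite := infinite_range_of_injective fun i j h => by
    rcases lt_trichotomy i j with hij | hij | hij
    · exact (hinj i j hij h).elim
    · exact hij
    · exact (hinj j i hij h.symm).elim
  obtain ⟨φ, r, hφ, hr, hr01, hrA⟩ := hX.exists_chart_seq hA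
  have lt : ∀ i j, i < j → r i < r j := fun i j h => hr h
  have hrω : ∀ k, φ (r k) ∈ omegaSet f x := fun k => by
    obtain ⟨n, hn⟩ := hrA k
    exact hn ▸ iterate_mem_omegaSet hf ha n
  have block : ∀ m, φ '' Icc (r 1) (r 11) ⊆ Z m ∨ φ '' Icc (r 13) (r 23) ⊆ Z m := by
    intro m
    obtain ⟨N, hN⟩ := eventually_atTop.1 (hZ.mem m)
    obtain ⟨l, hl, u, hu, hue⟩ := exists_mem_of_mem_omegaSet hφ (hr01 11).1.le (hr01 13).2.le
      ⟨lt 11 12 (by omega), lt 12 13 (by omega)⟩ rfl (hrω 12) N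
    obtain ⟨l', hl', v, hv, hve⟩ := exists_mem_of_mem_omegaSet hφ (hr01 24).1.le (hr01 26).2.le
      ⟨lt 24 25 (by omega), lt 25 26 (by omega)⟩ rfl (hrω 25) N
    have hnot : ¬ Z m ⊆ φ '' Ioo (r 1) (r 23) := by
      intro hsub
      have := (hφ.mem_image_Ioo (hr01 1).1.le (hr01 23).2.le
        ⟨(hr01 24).1.le.trans hv.1.le, hv.2.le.trans (hr01 26).2.le⟩).1
        (hsub (hve ▸ hN l' hl'))
      exact (this.2.trans ((lt 23 24 (by omega)).trans hv.1)).false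
    refine (hφ.image_Icc_subset_or (hZ.preconn m) (hr01 1).1.le
      ((lt 1 11 (by omega)).trans hu.1).le (hu.2.trans (lt 13 23 (by omega))).le (hr01 23).2.le
      (hue ▸ hN l hl) hnot).imp (fun h => ?_) fun h => ?_
    · exact (image_mono (Icc_subset_Icc_right hu.1.le)).trans h
    · exact (image_mono (Icc_subset_Icc_left hu.2.le)).trans h
  have build : ∀ k, (∀ m, φ '' Icc (r k) (r (k + 10)) ⊆ Z m) →
      ∃ (n : ℕ) (φ : ℝ → X) (a₁ a₂ a₃ a₄ : ℝ), IsCell f x φ a₁ a₂ a₃ a₄ ∧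
      f^[n] a ∈ φ '' Ioo a₂ a₃ := by
    intro k hk
    obtain ⟨n, hn⟩ := hrA (k + 5)
    simp only at hn
    refine ⟨n, φ, r k, r (k + 4), r (k + 6), r (k + 10), ⟨hφ, (hr01 k).1, lt _ _ (by omega),
      lt _ _ (by omega), lt _ _ (by omega), (hr01 _).2, exists_two_iterates_mem hφ hr hr01 hrω k,
      exists_two_iterates_mem hφ hr hr01 hrω (k + 6), ?_⟩,
      ⟨r (k + 5), ⟨lt _ _ (by omega), lt _ _ (by omega)⟩, hn.symm⟩⟩
    intro t ht n hn he
    obtain ⟨m, hm⟩ := hZ.noper _ n hn he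
    exact hm (hk m ⟨t, ht, rfl⟩)
  by_cases h1 : ∀ m, φ '' Icc (r 1) (r 11) ⊆ Z m
  · exact build 1 h1
  · push Not at h1
    obtain ⟨m₀, hm₀⟩ := h1
    refine build 13 fun m => ?_
    have h2 := (block (max m m₀)).resolve_left fun h => hm₀ (h.trans (hZ.anti (le_max_right _ _)))
    exact h2.trans (hZ.anti (le_max_left _ _))

end

theorem IsChart.exists_leftInv {X : Type*} [TopologicalSpace X] [T2Space X] {φ : ℝ → X}
    (hφ : IsChart φ) :
    ∃ ψ : X → ℝ, ContinuousOn ψ (φ '' Icc 0 1) ∧ ∀ t ∈ Icc (0:ℝ) 1, ψ (φ t) = t := by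
  have hinv : ∀ t ∈ Icc (0:ℝ) 1, Function.invFunOn φ (Icc 0 1) (φ t) = t :=
    fun t ht => hφ.inj.leftInvOn_invFunOn ht
  refine ⟨_, continuousOn_iff_isClosed.2 fun C hC => ⟨φ '' (C ∩ Icc 0 1),
    ((isCompact_Icc.inter_left hC).image hφ.cont).isClosed, ?_⟩, hinv⟩
  ext z
  constructor
  · rintro ⟨hz, t, ht, rfl⟩
    rw [mem_preimage, hinv t ht] at hz
    exact ⟨⟨t, ⟨hz, ht⟩, rfl⟩, t, ht, rfl⟩
  · rintro ⟨⟨t, ht, rfl⟩, -⟩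
    exact ⟨by rw [mem_preimage, hinv t ht.2]; exact ht.1, t, ht.2, rfl⟩

theorem IsChart.exists_fixed {X : Type*} [TopologicalSpace X] [T2Space X] {φ : ℝ → X}
    (hφ : IsChart φ) {g : X → X} (hg : Continuous g) {α β : ℝ}
    (hmaps : ∀ t ∈ Icc α β, g (φ t) ∈ φ '' Icc 0 1) {s t u v : ℝ} (hs : s ∈ Icc α β)
    (ht : t ∈ Icc α β) (hu : u ∈ Icc (0:ℝ) 1) (hv : v ∈ Icc (0:ℝ) 1) (hsu : g (φ s) = φ u)
    (hus : u ≤ s) (htv : g (φ t) = φ v) (hv' : t ≤ v) : ∃ w ∈ Icc α β, g (φ w) = φ w := by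
  obtain ⟨ψ, hψ, hψφ⟩ := hφ.exists_leftInv
  have hcont : ContinuousOn (fun r => ψ (g (φ r)) - r) (Icc α β) :=
    (hψ.comp (hg.comp hφ.cont).continuousOn hmaps).sub continuousOn_id
  obtain ⟨w, hw, hw0⟩ := isPreconnected_Icc.intermediate_value hs ht hcont
    (show (0:ℝ) ∈ Icc _ _ from ⟨by rw [hsu, hψφ u hu]; linarith, by rw [htv, hψφ v hv]; linarith⟩)
  refine ⟨w, hw, ?_⟩
  obtain ⟨e, he, hee⟩ := hmaps w hw
  simp only at hw0
  rw [← hee, hψφ e he] at hw0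
  rw [← hee, show e = w by linarith]

theorem exists_mem_uIcc_of_strictMono {ξ η : ℕ → ℝ} (hξ : StrictMono ξ) (hη : StrictMono η)
    (hξb : BddAbove (range ξ)) (hηb : BddAbove (range η)) {δ : ℝ} (hδ : 0 < δ)
    (hd : ∀ k, δ ≤ |ξ k - η k|) :
    ∃ ζ : ℕ → ℝ, (ζ = ξ ∨ ζ = η) ∧ ∃ k M, ∀ m ≥ M, ζ k ∈ uIcc (ξ m) (η m) ∧
      ζ (k + 1) ∈ uIcc (ξ m) (η m) := by
  have h1 := tendsto_atTop_ciSup hξ.monotone hξb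
  have h2 := tendsto_atTop_ciSup hη.monotone hηb
  set p := ⨆ k, ξ k
  set q := ⨆ k, η k
  have hp : ∀ k, ξ k ≤ p := le_ciSup hξb
  have hq : ∀ k, η k ≤ q := le_ciSup hηb
  have hpq : δ ≤ |p - q| := ge_of_tendsto' (h1.sub h2).abs hd
  rcases lt_trichotomy p q with h | h | h
  · obtain ⟨k, hk⟩ := (h2.eventually_const_lt h).exists
    refine ⟨η, Or.inr rfl, k, k + 1, fun m hm => ?_⟩
    have h3 := hη.monotone hm
    have h4 := hη (Nat.lt_succ_self k)
    have h5 := hp m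
    constructor <;> refine mem_uIcc.2 (Or.inl ⟨?_, ?_⟩) <;> linarith
  · rw [h, sub_self, abs_zero] at hpq
    exact absurd hδ hpq.not_gt
  · obtain ⟨k, hk⟩ := (h1.eventually_const_lt h).exists
    refine ⟨ξ, Or.inl rfl, k, k + 1, fun m hm => ?_⟩
    have h3 := hξ.monotone hm
    have h4 := hξ (Nat.lt_succ_self k)
    have h5 := hq m
    constructor <;> refine mem_uIcc.2 (Or.inr ⟨?_, ?_⟩) <;> linarith

theorem exists_mem_uIcc_of_subseq {ξ η : ℕ → ℝ} (hξ01 : ∀ k, ξ k ∈ Icc (0:ℝ) 1)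
    (hη01 : ∀ k, η k ∈ Icc (0:ℝ) 1) {δ : ℝ} (hδ : 0 < δ) (hd : ∀ k, δ ≤ |ξ k - η k|)
    (hsame : ∀ k l, k < l → (ξ k < ξ l ∧ η k < η l) ∨ (ξ l < ξ k ∧ η l < η k)) :
    ∃ ζ : ℕ → ℝ, (ζ = ξ ∨ ζ = η) ∧ ∃ k l, k < l ∧ ∀ N, ∃ m ≥ N, ζ k ∈ uIcc (ξ m) (η m) ∧
      ζ l ∈ uIcc (ξ m) (η m) := by
  obtain ⟨g, hg | hg⟩ := exists_increasing_or_nonincreasing_subseq (· < ·) ξ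
  · have h1 : StrictMono (ξ ∘ g) := fun m n h => hg m n h
    have h2 : StrictMono (η ∘ g) := fun m n h =>
      ((hsame _ _ (g.strictMono h)).resolve_right fun h' => (h'.1.trans (hg m n h)).false).2
    obtain ⟨ζ, hζ, k, M, hM⟩ := exists_mem_uIcc_of_strictMono h1 h2
      ⟨1, by rintro _ ⟨k, rfl⟩; exact (hξ01 _).2⟩ ⟨1, by rintro _ ⟨k, rfl⟩; exact (hη01 _).2⟩ hδ
      fun k => hd _
    have hN : ∀ N, ∃ m ≥ N, ∃ m' ≥ M, m = g m' := fun N =>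
      ⟨g (max M N), (le_max_right M N).trans (g.strictMono.le_apply), _, le_max_left _ _, rfl⟩
    rcases hζ with rfl | rfl
    · refine ⟨ξ, Or.inl rfl, g k, g (k + 1), g.strictMono k.lt_succ_self, fun N => ?_⟩
      obtain ⟨_, hm, m, hm', rfl⟩ := hN N
      exact ⟨_, hm, hM m hm'⟩
    · refine ⟨η, Or.inr rfl, g k, g (k + 1), g.strictMono k.lt_succ_self, fun N => ?_⟩
      obtain ⟨_, hm, m, hm', rfl⟩ := hN N
      exact ⟨_, hm, hM m hm'⟩
  · have hs : ∀ m n, m < n → ξ (g n) < ξ (g m) ∧ η (g n) < η (g m) := fun m n h =>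
      (hsame _ _ (g.strictMono h)).resolve_left fun h' => hg m n h h'.1
    have h1 : StrictMono fun n => -ξ (g n) := fun m n h => neg_lt_neg (hs m n h).1
    have h2 : StrictMono fun n => -η (g n) := fun m n h => neg_lt_neg (hs m n h).2
    obtain ⟨ζ, hζ, k, M, hM⟩ := exists_mem_uIcc_of_strictMono h1 h2
      ⟨0, by rintro _ ⟨k, rfl⟩; exact neg_nonpos.2 (hξ01 _).1⟩
      ⟨0, by rintro _ ⟨k, rfl⟩; exact neg_nonpos.2 (hη01 _).1⟩ hδ
      fun k => by
        rw [← abs_neg]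
        convert hd (g k) using 2
        ring
    have hN : ∀ N, ∃ m ≥ N, ∃ m' ≥ M, m = g m' := fun N =>
      ⟨g (max M N), (le_max_right M N).trans (g.strictMono.le_apply), _, le_max_left _ _, rfl⟩
    have neg : ∀ u v w : ℝ, -u ∈ uIcc (-v) (-w) → u ∈ uIcc v w := by
      intro u v w h
      rw [mem_uIcc] at h ⊢
      rcases h with ⟨h, h'⟩ | ⟨h, h'⟩
      · right; constructor <;> linarith
      · left; constructor <;> linarith
    rcases hζ with rfl | rfl
    · refine ⟨ξ, Or.inl rfl, g k, g (k + 1), g.strictMono k.lt_succ_self, fun N => ?_⟩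
      obtain ⟨_, hm, m, hm', rfl⟩ := hN N
      exact ⟨_, hm, neg _ _ _ (hM m hm').1, neg _ _ _ (hM m hm').2⟩
    · refine ⟨η, Or.inr rfl, g k, g (k + 1), g.strictMono k.lt_succ_self, fun N => ?_⟩
      obtain ⟨_, hm, m, hm', rfl⟩ := hN N
      exact ⟨_, hm, neg _ _ _ (hM m hm').1, neg _ _ _ (hM m hm').2⟩

section

variable {X : Type*} [MetricSpace X] {f : X → X} {x y : X}

/-- Points at which the orbits of `x` and `y` accumulate simultaneously. -/
def jointLimitSet (f : X → X) (x y : X) : Set X :=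
  {w | ∀ U, IsOpen U → w ∈ U → ∀ N, ∃ l ≥ N, f^[l] x ∈ U ∧ f^[l] y ∈ U}

theorem apply_mem_jointLimitSet (hf : Continuous f) {w : X} (hw : w ∈ jointLimitSet f x y) :
    f w ∈ jointLimitSet f x y := by
  intro U hU hwU N
  obtain ⟨l, hl, h1, h2⟩ := hw _ (hU.preimage hf) hwU N
  refine ⟨l + 1, by omega, ?_, ?_⟩ <;> rw [Function.iterate_succ_apply']
  exacts [h1, h2]

theorem iterate_mem_jointLimitSet (hf : Continuous f) {w : X} (hw : w ∈ jointLimitSet f x y)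
    (n : ℕ) : f^[n] w ∈ jointLimitSet f x y := by
  induction n with
  | zero => exact hw
  | succ n ih => rw [Function.iterate_succ_apply']; exact apply_mem_jointLimitSet hf ih

theorem jointLimitSet_subset_left : jointLimitSet f x y ⊆ omegaSet f x := fun _ hw =>
  mem_omegaSet_iff.2 fun U hU hwU N =>
    let ⟨l, hl, h, _⟩ := hw U hU hwU N
    ⟨l, hl, h⟩

theorem jointLimitSet_subset_right : jointLimitSet f x y ⊆ omegaSet f y := fun _ hw =>
  mem_omegaSet_iff.2 fun U hU hwU N =>
    let ⟨l, hl, _, h⟩ := hw U hU hwU N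
    ⟨l, hl, h⟩

theorem Proximal.jointLimitSet_nonempty [CompactSpace X] (h : Proximal f x y) :
    (jointLimitSet f x y).Nonempty := by
  choose l hl hd using fun k : ℕ => h (1 / (k + 1 : ℝ)) (by positivity) k
  obtain ⟨w, -, θ, hθ, hw⟩ := isCompact_univ.tendsto_subseq (x := fun k => f^[l k] x)
    fun _ => mem_univ _
  have hd0 : Tendsto (fun k => dist (f^[l (θ k)] x) (f^[l (θ k)] y)) atTop (𝓝 0) :=
    squeeze_zero (fun _ => dist_nonneg) (fun k => (hd (θ k)).le)
      (tendsto_one_div_add_atTop_nhds_zero_nat.comp hθ.tendsto_atTop)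
  have hw' : Tendsto (fun k => f^[l (θ k)] y) atTop (𝓝 w) :=
    (tendsto_iff_of_dist hd0).1 hw
  refine ⟨w, fun U hU hwU N => ?_⟩
  obtain ⟨k, ⟨h1, h2⟩, h3⟩ := (((hw.eventually (hU.mem_nhds hwU)).and
    (hw'.eventually (hU.mem_nhds hwU))).and (eventually_ge_atTop N)).exists
  exact ⟨_, h3.trans ((hθ.le_apply).trans (hl _)), h1, h2⟩

/-- A connected set returning along an orbit whose images never are neighbourhoods of joint limit
points produces a periodic limit point. -/
theorem IsTopGraph.false_of_image_not_mem_nhds (hX : IsTopGraph X) (hf : Continuous f)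
    (hper : ∀ c ∈ omegaSet f x, ∀ n, 1 ≤ n → f^[n] c ≠ c) (hprox : Proximal f x y) {E : Set X}
    (hE : IsPreconnected E) {z : X} (hz : z = x ∨ z = y) {i r : ℕ} (hr : 1 ≤ r)
    (hi : f^[i] z ∈ E) (hir : f^[i + r] z ∈ E)
    (hnhds : ∀ q, ∀ w ∈ jointLimitSet f x y, f^[q] '' E ∉ 𝓝 w) : False := by
  have := hX.1
  obtain ⟨w, hw⟩ := hprox.jointLimitSet_nonempty
  have hne : ∀ i j, i < j → f^[i] w ≠ f^[j] w := by
    intro i j hij he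
    refine hper _ (jointLimitSet_subset_left (iterate_mem_jointLimitSet hf hw i)) (j - i)
      (by omega) ?_
    rw [← Function.iterate_add_apply, Nat.sub_add_cancel hij.le, he]
  have hA : (range fun n => f^[n] w).Infinite := infinite_range_of_injective fun i j h => by
    rcases lt_trichotomy i j with hij | hij | hij
    · exact (hne i j hij h).elim
    · exact hij
    · exact (hne j i hij h.symm).elim
  obtain ⟨φ, τ, hφ, hτ, hτ01, hτA⟩ := hX.exists_chart_seq hA
  have lt : ∀ i j, i < j → τ i < τ j := fun i j h => hτ h
  have hτJ : ∀ k, φ (τ k) ∈ jointLimitSet f x y := fun k => by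
    obtain ⟨n, hn⟩ := hτA k
    exact hn ▸ iterate_mem_jointLimitSet hf hw n
  have hτz : ∀ k, φ (τ k) ∈ omegaSet f z := fun k => by
    rcases hz with rfl | rfl
    exacts [jointLimitSet_subset_left (hτJ k), jointLimitSet_subset_right (hτJ k)]
  have step : ∀ n, ∃ p, f^[p] z ∈ φ '' Ioo (τ n) (τ (n + 6)) ∧
      f^[r] (f^[p] z) ∈ φ '' Ioo (τ n) (τ (n + 6)) := by
    intro n
    obtain ⟨p, hp, t, ht, hte⟩ := exists_mem_of_mem_omegaSet hφ (hτ01 (n + 2)).1.le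
      (hτ01 (n + 4)).2.le ⟨lt (n + 2) (n + 3) (by omega), lt _ (n + 4) (by omega)⟩ rfl
      (hτz (n + 3)) i
    have e1 : f^[p - i] (f^[i] z) = f^[p] z := by
      rw [← Function.iterate_add_apply, Nat.sub_add_cancel hp]
    have e2 : f^[p - i] (f^[i + r] z) = f^[r] (f^[p] z) := by
      rw [← Function.iterate_add_apply, ← Function.iterate_add_apply]
      congr 1; omega
    have h1 : f^[p] z ∈ f^[p - i] '' E := e1 ▸ mem_image_of_mem _ hi
    have h2 : f^[r] (f^[p] z) ∈ f^[p - i] '' E := e2 ▸ mem_image_of_mem _ hir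
    have hsub : f^[p - i] '' E ⊆ φ '' Ioo (τ n) (τ (n + 6)) := by
      by_contra hnot
      rcases hφ.image_Icc_subset_or (hE.image _ (hf.iterate _).continuousOn) (hτ01 n).1.le
        ((lt _ _ (by omega)).trans ht.1).le (ht.2.trans (lt _ _ (by omega))).le
        (hτ01 (n + 6)).2.le (hte ▸ h1) hnot with h | h
      · refine hnhds _ _ (hτJ (n + 1)) (mem_of_superset ((hφ.isOpen_image_Ioo (hτ01 n).1.le
          (hτ01 (n + 2)).2.le).mem_nhds ⟨τ (n + 1), ⟨lt _ _ (by omega), lt _ _ (by omega)⟩, rfl⟩)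
          ((image_mono ?_).trans h))
        exact fun u hu => ⟨hu.1.le, (hu.2.trans ht.1).le⟩
      · refine hnhds _ _ (hτJ (n + 5)) (mem_of_superset ((hφ.isOpen_image_Ioo (hτ01 (n + 4)).1.le
          (hτ01 (n + 6)).2.le).mem_nhds ⟨τ (n + 5), ⟨lt _ _ (by omega), lt _ _ (by omega)⟩, rfl⟩)
          ((image_mono ?_).trans h))
        exact fun u hu => ⟨(ht.2.trans hu.1).le, hu.2.le⟩
    exact ⟨p, hsub h1, hsub h2⟩
  choose p hp using step
  choose u hu hup using fun n => (hp n).1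
  choose v hv hvp using fun n => (hp n).2
  have hbdd : BddAbove (range τ) := ⟨1, by rintro _ ⟨k, rfl⟩; exact (hτ01 k).2.le⟩
  have ht := tendsto_atTop_ciSup hτ.monotone hbdd
  have ht6 := (tendsto_add_atTop_iff_nat 6).2 ht
  have hut := tendsto_of_tendsto_of_tendsto_of_le_of_le ht ht6 (fun n => (hu n).1.le)
    fun n => (hu n).2.le
  have hvt := tendsto_of_tendsto_of_tendsto_of_le_of_le ht ht6 (fun n => (hv n).1.le)
    fun n => (hv n).2.le
  have h1 := (hφ.cont.tendsto _).comp hut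
  have h2 := (hφ.cont.tendsto _).comp hvt
  have h3 := ((hf.iterate r).tendsto _).comp h1
  have h4 := tendsto_nhds_unique h3 (h2.congr fun n => by
    simp only [Function.comp_apply, hup, hvp])
  refine hper _ ?_ r hr h4
  exact (isClosed_omegaSet f x).mem_of_tendsto ((hφ.cont.tendsto _).comp ht)
    (Eventually.of_forall fun k => jointLimitSet_subset_left (hτJ k))

end

theorem IsChart.image_uIcc_subset {X : Type*} [TopologicalSpace X] [T2Space X] {φ : ℝ → X}
    (hφ : IsChart φ) {K : Set X} (hK : IsPreconnected K) (hKφ : K ⊆ φ '' Ioo 0 1) {s t : ℝ}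
    (hs : s ∈ Ioo (0:ℝ) 1) (ht : t ∈ Ioo (0:ℝ) 1) (hsK : φ s ∈ K) (htK : φ t ∈ K) :
    φ '' uIcc s t ⊆ K := by
  rintro _ ⟨r, hr, rfl⟩
  rcases eq_or_ne r s with rfl | h1
  · exact hsK
  rcases eq_or_ne r t with rfl | h2
  · exact htK
  rcases mem_uIcc.1 hr with ⟨h, h'⟩ | ⟨h, h'⟩
  · exact hφ.mem_of_between hK hKφ hs ht (lt_of_le_of_ne h h1.symm) (lt_of_le_of_ne h' h2) hsK htK
  · exact hφ.mem_of_between hK hKφ ht hs (lt_of_le_of_ne h h2.symm) (lt_of_le_of_ne h' h1) htK hsK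

theorem min_mem_uIcc (s t : ℝ) : min s t ∈ uIcc s t := ⟨le_rfl, min_le_max⟩

theorem max_mem_uIcc (s t : ℝ) : max s t ∈ uIcc s t := ⟨min_le_max, le_rfl⟩

section

variable {X : Type*} [MetricSpace X] {f : X → X} {x y : X}

theorem IsCell.image_subset {φ : ℝ → X} {a b c d : ℝ} (hC : IsCell f x φ a b c d) {B : Set X}
    (hB : IsPreconnected B) (hab : ¬ φ '' Icc a b ⊆ B) (hcd : ¬ φ '' Icc c d ⊆ B)
    (h : (B ∩ φ '' Ioo b c).Nonempty) : B ⊆ φ '' Ioo a d := by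
  obtain ⟨_, htB, t, ht, rfl⟩ := h
  by_contra hnot
  rcases hC.chart.image_Icc_subset_or hB hC.pos.le (hC.ab.trans ht.1).le (ht.2.trans hC.cd).le
    hC.lt_one.le htB hnot with h | h
  · exact hab ((image_mono (Icc_subset_Icc_right ht.1.le)).trans h)
  · exact hcd ((image_mono (Icc_subset_Icc_left ht.2.le)).trans h)

theorem IsCell.exists_fixed_of_mapsTo {φ : ℝ → X} {a b c d : ℝ} (hC : IsCell f x φ a b c d)
    (hf : Continuous f) {n : ℕ} (hn : 1 ≤ n) {s t u v : ℝ}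
    (hs : s ∈ Icc a d) (ht : t ∈ Icc a d)
    (hmaps : ∀ w ∈ uIcc s t, f^[n] (φ w) ∈ φ '' Icc 0 1)
    (hu : u ∈ Icc (0:ℝ) 1) (hv : v ∈ Icc (0:ℝ) 1) (hsu : f^[n] (φ s) = φ u) (hus : u ≤ s)
    (htv : f^[n] (φ t) = φ v) (hv' : t ≤ v) : False := by
  obtain ⟨w, hw, he⟩ := hC.chart.exists_fixed (hf.iterate n) hmaps left_mem_uIcc right_mem_uIcc
    hu hv hsu hus htv hv'
  exact hC.noper w (uIcc_subset_Icc hs ht hw) n hn he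

theorem IsCell.false_of_frequently (hX : IsTopGraph X) (hf : Continuous f)
    (hper : ∀ c ∈ omegaSet f x, ∀ n, 1 ≤ n → f^[n] c ≠ c) (hprox : Proximal f x y)
    {φ : ℝ → X} {a b c d : ℝ} (hC : IsCell f x φ a b c d) {B : Set X} (hB : IsPreconnected B)
    (hxB : x ∈ B) (hyB : y ∈ B) (hab : ∀ p, ¬ φ '' Icc a b ⊆ f^[p] '' B)
    (hcd : ∀ p, ¬ φ '' Icc c d ⊆ f^[p] '' B) {ε : ℝ} (hε : 0 < ε)
    (hfr : ∃ᶠ l in atTop, f^[l] x ∈ φ '' Ioo b c ∧ ε ≤ dist (f^[l] x) (f^[l] y)) : False := by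
  have hφ := hC.chart
  have h01 : Icc a d ⊆ Ioo 0 1 := fun t ht => ⟨hC.pos.trans_le ht.1, ht.2.trans_lt hC.lt_one⟩
  have hBp : ∀ p, IsPreconnected (f^[p] '' B) := fun p => hB.image _ (hf.iterate p).continuousOn
  obtain ⟨T, hT, hTP⟩ := extraction_of_frequently_atTop hfr
  have hsub : ∀ k, f^[T k] '' B ⊆ φ '' Ioo a d := fun k =>
    hC.image_subset (hBp _) (hab _) (hcd _) ⟨_, mem_image_of_mem _ hxB, (hTP k).1⟩
  choose ξ hξ hξe using fun k => hsub k (mem_image_of_mem _ hxB)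
  choose η hη hηe using fun k => hsub k (mem_image_of_mem _ hyB)
  have hseg : ∀ k, φ '' uIcc (ξ k) (η k) ⊆ f^[T k] '' B := by
    intro k
    exact hφ.image_uIcc_subset (hBp _)
      ((hsub k).trans (image_mono (Ioo_subset_Icc_self.trans h01)))
      (h01 (Ioo_subset_Icc_self (hξ k))) (h01 (Ioo_subset_Icc_self (hη k)))
      (hξe k ▸ mem_image_of_mem _ hxB) (hηe k ▸ mem_image_of_mem _ hyB)
  -- parameters stay apart
  obtain ⟨δ, hδ, hδd⟩ : ∃ δ > 0, ∀ k, δ ≤ |ξ k - η k| := by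
    obtain ⟨δ, hδ, hu⟩ := Metric.uniformContinuousOn_iff.1
      (isCompact_Icc.uniformContinuousOn_of_continuous (hφ.cont.continuousOn (s := Icc 0 1))) ε hε
    refine ⟨δ, hδ, fun k => ?_⟩
    by_contra! hlt
    have := hu _ (Ioo_subset_Icc_self (h01 (Ioo_subset_Icc_self (hξ k)))) _
      (Ioo_subset_Icc_self (h01 (Ioo_subset_Icc_self (hη k)))) hlt
    rw [hξe, hηe] at this
    exact this.not_ge (hTP k).2
  have hξ01 : ∀ k, ξ k ∈ Icc (0:ℝ) 1 := fun k =>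
    Ioo_subset_Icc_self (h01 (Ioo_subset_Icc_self (hξ k)))
  have hη01 : ∀ k, η k ∈ Icc (0:ℝ) 1 := fun k =>
    Ioo_subset_Icc_self (h01 (Ioo_subset_Icc_self (hη k)))
  have hshift : ∀ z k l, k < l → f^[T l - T k] (f^[T k] z) = f^[T l] z := fun z k l hkl => by
    rw [← Function.iterate_add_apply, Nat.sub_add_cancel (hT hkl).le]
  have hmapseg : ∀ k l, k < l → ∀ w ∈ uIcc (ξ k) (η k), f^[T l - T k] (φ w) ∈ φ '' Icc 0 1 := by
    intro k l hkl w hw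
    obtain ⟨u, hu, hue⟩ := hseg k ⟨w, hw, rfl⟩
    rw [← hue, hshift u k l hkl]
    exact image_mono (Ioo_subset_Icc_self.trans (h01.trans Ioo_subset_Icc_self))
      (hsub l (mem_image_of_mem _ hu))
  have hsame : ∀ k l, k < l → (ξ k < ξ l ∧ η k < η l) ∨ (ξ l < ξ k ∧ η l < η k) := by
    intro k l hkl
    have hn : 1 ≤ T l - T k := by have := hT hkl; omega
    have ex : f^[T l - T k] (φ (ξ k)) = φ (ξ l) := by rw [hξe, hξe, hshift x k l hkl]
    have ey : f^[T l - T k] (φ (η k)) = φ (η l) := by rw [hηe, hηe, hshift y k l hkl]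
    have hξk := Ioo_subset_Icc_self (hξ k)
    have hηk := Ioo_subset_Icc_self (hη k)
    by_contra hcon
    rcases le_or_gt (ξ l) (ξ k) with h1 | h1
    · rcases le_or_gt (η k) (η l) with h2 | h2
      · exact hC.exists_fixed_of_mapsTo hf hn hξk hηk (hmapseg k l hkl) (hξ01 l) (hη01 l) ex h1
          ey h2
      · have h3 : ξ l = ξ k := le_antisymm h1 (not_lt.1 fun h => hcon (Or.inr ⟨h, h2⟩))
        exact hC.noper _ hξk _ hn (by rw [ex, h3])
    · rcases le_or_gt (η l) (η k) with h2 | h2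
      · exact hC.exists_fixed_of_mapsTo hf hn hηk hξk (by rw [uIcc_comm]; exact hmapseg k l hkl)
          (hη01 l) (hξ01 l) ey h2 ex h1.le
      · exact hcon (Or.inl ⟨h1, h2⟩)
  obtain ⟨ζ, hζ, k, l, hkl, hcof⟩ := exists_mem_uIcc_of_subseq hξ01 hη01 hδ hδd hsame
  obtain ⟨z, hz, hζz⟩ : ∃ z, (z = x ∨ z = y) ∧ ∀ k, φ (ζ k) = f^[T k] z := by
    rcases hζ with rfl | rfl
    · exact ⟨x, Or.inl rfl, hξe⟩
    · exact ⟨y, Or.inr rfl, hηe⟩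
  have hζad : ∀ k, ζ k ∈ Icc a d := by
    rcases hζ with rfl | rfl
    · exact fun k => Ioo_subset_Icc_self (hξ k)
    · exact fun k => Ioo_subset_Icc_self (hη k)
  have hTkl := hT hkl
  refine hX.false_of_image_not_mem_nhds hf hper hprox (E := φ '' uIcc (ζ k) (ζ l))
    (isPreconnected_uIcc.image _ hφ.cont.continuousOn) hz (i := T k) (r := T l - T k) (by omega)
    ⟨_, left_mem_uIcc, hζz k⟩ ⟨_, right_mem_uIcc, by
      rw [hζz l]; congr 1; omega⟩ ?_
  intro q w hw hqw
  obtain ⟨U, hUE, hU, hwU⟩ := mem_nhds_iff.1 hqw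
  obtain ⟨j, -, hjx, hjy⟩ := hw U hU hwU 0
  obtain ⟨m₀, -, hm₀, hm₀'⟩ := hcof 0
  obtain ⟨m, hm, hmk, hml⟩ := hcof (j + 1)
  have hjm : j < T m := (Nat.lt_of_succ_le hm).trans_le hT.le_apply
  set E := φ '' uIcc (ζ k) (ζ l) with hE
  set e := (T m - j) + q with he
  have hEB : f^[e] '' E ⊆ f^[e + T m₀] '' B := by
    rw [Function.iterate_add f e, image_comp]
    exact image_mono ((image_mono (uIcc_subset_uIcc hm₀ hm₀')).trans (hseg m₀))
  have hzE : ∀ u, f^[j] u ∈ U → f^[T m] u ∈ f^[e] '' E := by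
    intro u hu
    rw [he, Function.iterate_add, image_comp]
    refine ⟨_, hUE hu, ?_⟩
    rw [← Function.iterate_add_apply, Nat.sub_add_cancel hjm.le]
  have hEc : IsPreconnected (f^[e] '' E) :=
    (isPreconnected_uIcc.image _ hφ.cont.continuousOn).image _ (hf.iterate e).continuousOn
  have hEad : f^[e] '' E ⊆ φ '' Ioo a d := hEB.trans
    (hC.image_subset (hBp _) (hab _) (hcd _) ⟨_, hEB (hzE x hjx), (hTP m).1⟩)
  have hE01 : f^[e] '' E ⊆ φ '' Ioo 0 1 :=
    hEad.trans (image_mono (Ioo_subset_Icc_self.trans h01))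
  have hcov : φ '' uIcc (ξ m) (η m) ⊆ f^[e] '' E :=
    hφ.image_uIcc_subset hEc hE01 (h01 (Ioo_subset_Icc_self (hξ m)))
      (h01 (Ioo_subset_Icc_self (hη m))) (hξe m ▸ hzE x hjx) (hηe m ▸ hzE y hjy)
  have hJm : uIcc (ζ k) (ζ l) ⊆ uIcc (ξ m) (η m) := uIcc_subset_uIcc hmk hml
  have hJad : uIcc (ζ k) (ζ l) ⊆ Icc a d := uIcc_subset_Icc (hζad k) (hζad l)
  have hadI : Icc a d ⊆ Icc 0 1 := h01.trans Ioo_subset_Icc_self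
  have hin : ∀ w ∈ uIcc (ζ k) (ζ l), f^[e] (φ w) ∈ φ '' Icc 0 1 := fun w hw =>
    image_mono Ioo_subset_Icc_self (hE01 ⟨_, ⟨w, hw, rfl⟩, rfl⟩)
  obtain ⟨_, ⟨s, hs, rfl⟩, hse⟩ := hcov ⟨_, hJm (min_mem_uIcc (ζ k) (ζ l)), rfl⟩
  obtain ⟨_, ⟨t, ht, rfl⟩, hte⟩ := hcov ⟨_, hJm (max_mem_uIcc (ζ k) (ζ l)), rfl⟩
  exact hC.exists_fixed_of_mapsTo hf (by omega) (hJad hs) (hJad ht)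
    (fun w hw => hin w (uIcc_subset_uIcc hs ht hw)) (hadI (hJad (min_mem_uIcc _ _)))
    (hadI (hJad (max_mem_uIcc _ _))) hse hs.1 hte ht.2

end

theorem IsChart.image_Icc_mem_nhds {X : Type*} [TopologicalSpace X] [T2Space X] {φ : ℝ → X}
    (hφ : IsChart φ) {a b : ℝ} (ha : 0 ≤ a) (hb : b ≤ 1) {p : X} (hp : p ∈ φ '' Ioo a b) :
    φ '' Icc a b ∈ 𝓝 p :=
  mem_of_superset ((hφ.isOpen_image_Ioo ha hb).mem_nhds hp) (image_mono Ioo_subset_Icc_self)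

theorem exists_frequently_le_dist_of_not_asymptotic {X : Type*} [PseudoMetricSpace X] {f : X → X}
    {x y : X} (h : ¬ Asymptotic f x y) :
    ∃ ε > 0, ∃ᶠ l in atTop, ε ≤ dist (f^[l] x) (f^[l] y) := by
  by_contra! hcon
  refine h (Metric.tendsto_atTop'.2 fun ε hε => ?_)
  obtain ⟨M, hM⟩ := eventually_atTop.1 (hcon ε hε)
  refine ⟨M, fun l hl => ?_⟩
  rw [Real.dist_0_eq_abs, abs_of_nonneg dist_nonneg]
  exact hM l (le_of_lt hl)

theorem IsTrap.false {X : Type*} [MetricSpace X] {f : X → X} {x : X} (hX : IsTopGraph X)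
    (h : NoHorseshoe f) (hf : Continuous f) (hinf : (omegaSet f x).Infinite) {B : ℕ → Set X}
    (hB : IsConnBasis x B) (hscr : ∀ n, ∃ y ∈ B n, ScrambledPair f x y) {Z : ℕ → Set X}
    (hZ : IsTrap f x Z) : False := by
  have := hX.1
  choose! N φ a b c d hC hmem using fun p (hp : p ∈ omegaSet f x) => hZ.exists_isCell hX hf hinf hp
  have hopen : ∀ p ∈ omegaSet f x, IsOpen (f^[N p] ⁻¹' (φ p '' Ioo (b p) (c p))) := fun p hp =>
    ((hC p hp).chart.isOpen_image_Ioo ((hC p hp).pos.trans (hC p hp).ab).le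
      ((hC p hp).cd.trans (hC p hp).lt_one).le).preimage (hf.iterate _)
  obtain ⟨s, hs, hcov⟩ := (isClosed_omegaSet f x).isCompact.elim_nhds_subcover
    (fun p => f^[N p] ⁻¹' (φ p '' Ioo (b p) (c p))) fun p hp => (hopen p hp).mem_nhds (hmem p hp)
  have hev := eventually_mem_of_omegaSet_subset
    (isOpen_biUnion fun p (hp : p ∈ s) => hopen p (hs p hp)) hcov
  have hshort : ∀ p ∈ s, ∃ n, ∀ m ≥ n, ∀ q, ¬ φ p '' Icc (a p) (b p) ⊆ f^[q] '' B m ∧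
      ¬ φ p '' Icc (c p) (d p) ⊆ f^[q] '' B m := by
    intro p hp
    have hCp := hC p (hs p hp)
    obtain ⟨i, i', hne, hi, hi'⟩ := hCp.left
    obtain ⟨j, j', hne', hj, hj'⟩ := hCp.right
    have hb1 := (hCp.bc.trans (hCp.cd.trans hCp.lt_one)).le
    have hc0 := (hCp.pos.trans (hCp.ab.trans hCp.bc)).le
    obtain ⟨n₁, h₁⟩ := h.exists_not_subset hf hB hne
      (hCp.chart.image_Icc_mem_nhds hCp.pos.le hb1 hi)
      (hCp.chart.image_Icc_mem_nhds hCp.pos.le hb1 hi')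
    obtain ⟨n₂, h₂⟩ := h.exists_not_subset hf hB hne'
      (hCp.chart.image_Icc_mem_nhds hc0 hCp.lt_one.le hj)
      (hCp.chart.image_Icc_mem_nhds hc0 hCp.lt_one.le hj')
    exact ⟨max n₁ n₂, fun m hm q =>
      ⟨h₁ m ((le_max_left _ _).trans hm) q, h₂ m ((le_max_right _ _).trans hm) q⟩⟩
  choose! n hn using hshort
  obtain ⟨y, hyB, hprox, hnas⟩ := hscr (s.sup n)
  obtain ⟨ε, hε, hfr⟩ := exists_frequently_le_dist_of_not_asymptotic hnas
  obtain ⟨δ, hδ, hδε⟩ := exists_forall_iterate_dist_lt hf (s.sup N) hε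
  have hfr' : ∃ᶠ l in atTop, ∃ p ∈ s, f^[l + N p] x ∈ φ p '' Ioo (b p) (c p) ∧
      δ ≤ dist (f^[l + N p] x) (f^[l + N p] y) := by
    refine frequently_atTop.2 fun M => ?_
    obtain ⟨M', hM'⟩ := eventually_atTop.1 hev
    obtain ⟨l', hl', hle⟩ := frequently_atTop.1 hfr (max M M' + s.sup N)
    have hx := hM' (l' - s.sup N) (by omega)
    simp only [mem_iUnion, mem_preimage, ← Function.iterate_add_apply] at hx
    obtain ⟨p, hp, hx⟩ := hx
    have hNp : N p ≤ s.sup N := Finset.le_sup hp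
    refine ⟨l' - s.sup N, by omega, p, hp, by rwa [add_comm], not_lt.1 fun hlt => ?_⟩
    have := hδε _ _ hlt (s.sup N - N p) (by omega)
    rw [← Function.iterate_add_apply, ← Function.iterate_add_apply] at this
    rw [show s.sup N - N p + (l' - s.sup N + N p) = l' by omega] at this
    exact not_le.2 this hle
  obtain ⟨p, hp, hfp⟩ : ∃ p ∈ s, ∃ᶠ l in atTop, f^[l + N p] x ∈ φ p '' Ioo (b p) (c p) ∧
      δ ≤ dist (f^[l + N p] x) (f^[l + N p] y) := by
    by_contra! hcon
    refine hfr' (((Finset.eventually_all s).2 hcon).mono fun l hl => ?_)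
    rintro ⟨p, hp, hlp⟩
    exact (hl p hp hlp.1).not_ge hlp.2
  refine (hC p (hs p hp)).false_of_frequently hX hf
    (fun c hc n hn => hZ.iterate_ne hX hf hinf hc hn) hprox (hB.preconn _) (hB.mem _) hyB
    (fun q => (hn p hp _ (Finset.le_sup hp) q).1) (fun q => (hn p hp _ (Finset.le_sup hp) q).2) hδ
    ((tendsto_add_atTop_nat (N p)).frequently hfp)

/-- The union of the images of `B` under the iterates `l, l + d, l + 2 d, …` of `f`. -/
def progressionUnion {X : Type*} (f : X → X) (B : Set X) (d l : ℕ) : Set X :=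
  ⋃ t : ℕ, f^[l + d * t] '' B

section Progression

variable {X : Type*} {f : X → X} {B : Set X} {d l : ℕ}

theorem image_iterate_subset_progressionUnion (t : ℕ) :
    f^[l + d * t] '' B ⊆ progressionUnion f B d l := subset_iUnion (fun t => f^[l + d * t] '' B) t

theorem iterate_mem_progressionUnion {x : X} (hx : x ∈ B) {p : ℕ} (h : ∃ t, p = l + d * t) :
    f^[p] x ∈ progressionUnion f B d l := by
  obtain ⟨t, rfl⟩ := h
  exact image_iterate_subset_progressionUnion t ⟨x, hx, rfl⟩

theorem image_iterate_progressionUnion (i : ℕ) :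
    f^[i] '' progressionUnion f B d l = progressionUnion f B d (l + i) := by
  simp only [progressionUnion, image_iUnion, ← image_comp, ← Function.iterate_add]
  exact iUnion_congr fun t => by rw [show i + (l + d * t) = l + i + d * t by ring]

theorem progressionUnion_subset {e l' : ℕ} (h : ∀ t, ∃ s, l' + e * t = l + d * s) :
    progressionUnion f B e l' ⊆ progressionUnion f B d l := by
  refine iUnion_subset fun t => ?_
  obtain ⟨s, hs⟩ := h t
  rw [hs]
  exact image_iterate_subset_progressionUnion s

theorem progressionUnion_add_mul_subset (s : ℕ) :
    progressionUnion f B d (l + d * s) ⊆ progressionUnion f B d l :=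
  progressionUnion_subset fun t => ⟨s + t, by ring⟩

theorem progressionUnion_mono {B' : Set X} (h : B ⊆ B') :
    progressionUnion f B d l ⊆ progressionUnion f B' d l :=
  iUnion_mono fun _ => image_mono h

theorem progressionUnion_one_anti {m m' : ℕ} (h : m ≤ m') :
    progressionUnion f B 1 m' ⊆ progressionUnion f B 1 m :=
  progressionUnion_subset fun t => ⟨m' - m + t, by omega⟩

theorem progressionUnion_iterate (d m : ℕ) :
    progressionUnion f^[d] B 1 m = progressionUnion f B d (d * m) := by
  simp only [progressionUnion, ← Function.iterate_mul]
  exact iUnion_congr fun t => by rw [show d * (m + 1 * t) = d * m + d * t by ring]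

/-- The union of all late images splits into residue classes. -/
theorem progressionUnion_one_eq (hd : 1 ≤ d) (l : ℕ) :
    progressionUnion f B 1 l = ⋃ j ∈ Iio d, progressionUnion f B d (l + j) := by
  refine subset_antisymm (iUnion_subset fun t => ?_) (iUnion₂_subset fun j _ => ?_)
  · refine subset_trans ?_ (subset_biUnion_of_mem (show t % d ∈ Iio d from Nat.mod_lt _ hd))
    have := image_iterate_subset_progressionUnion (f := f) (B := B) (d := d) (l := l + t % d)
      (t / d)
    rwa [show l + t % d + d * (t / d) = l + 1 * t by rw [add_assoc, Nat.mod_add_div, one_mul]]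
      at this
  · exact progressionUnion_subset fun t => ⟨j + d * t, by ring⟩

end Progression

/-- An operation on sets lying between the identity and the closure. -/
structure IsHull {X : Type*} [TopologicalSpace X] (cl : Set X → Set X) : Prop where
  subset : ∀ S, S ⊆ cl S
  subset_closure : ∀ S, cl S ⊆ closure S
  mono : Monotone cl
  image : ∀ f : X → X, Continuous f → ∀ S, f '' cl S ⊆ cl (f '' S)

theorem IsHull.id (X : Type*) [TopologicalSpace X] : IsHull (fun S : Set X => S) :=
  ⟨fun _ => Subset.rfl, fun _ => _root_.subset_closure, monotone_id, fun _ _ _ => Subset.rfl⟩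

theorem IsHull.closure (X : Type*) [TopologicalSpace X] :
    IsHull (fun S : Set X => _root_.closure S) :=
  ⟨fun _ => _root_.subset_closure, fun _ => Subset.rfl, fun _ _ => closure_mono,
    fun _ hf _ => image_closure_subset_closure_image hf⟩

theorem IsHull.isPreconnected_of_subset {X : Type*} [TopologicalSpace X] {cl : Set X → Set X}
    (hcl : IsHull cl) {W M : Set X} (hM : IsPreconnected M) (hWM : W ⊆ M) (hMW : M ⊆ cl W) :
    IsPreconnected (cl W) :=
  hM.subset_closure hMW ((hcl.subset_closure W).trans (closure_mono hWM))

/-- The periods along which the late images of `B` are connected, up to the hull `cl`. -/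
def connPeriods {X : Type*} [TopologicalSpace X] (f : X → X) (cl : Set X → Set X) (B : Set X) :
    Set ℕ :=
  {d | 1 ≤ d ∧ ∃ l, IsPreconnected (cl (progressionUnion f B d l))}

section Conn

variable {X : Type*} [TopologicalSpace X] {f : X → X} {cl : Set X → Set X} {B : Set X} {d l : ℕ}

theorem IsHull.image_progressionUnion_subset (hcl : IsHull cl) (hf : Continuous f) (i : ℕ) :
    f^[i] '' cl (progressionUnion f B d l) ⊆ cl (progressionUnion f B d (l + i)) := by
  rw [← image_iterate_progressionUnion i]
  exact hcl.image _ (hf.iterate i) _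

theorem IsHull.isPreconnected_progressionUnion (hcl : IsHull cl) (hf : Continuous f)
    (h : IsPreconnected (cl (progressionUnion f B d l))) {l' : ℕ} (hl : l ≤ l') :
    IsPreconnected (cl (progressionUnion f B d l')) := by
  obtain ⟨i, rfl⟩ := Nat.exists_eq_add_of_le hl
  refine hcl.isPreconnected_of_subset (h.image _ (hf.iterate i).continuousOn) ?_
    (hcl.image_progressionUnion_subset hf i)
  rw [← image_iterate_progressionUnion i]
  exact image_mono (hcl.subset _)

theorem IsHull.connPeriods_mono (hcl : IsHull cl) (hf : Continuous f) {B' : Set X}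
    (hB' : IsPreconnected B') (hne : B.Nonempty) (hBB' : B ⊆ B') :
    connPeriods f cl B ⊆ connPeriods f cl B' := by
  rintro d ⟨hd, l, hl⟩
  obtain ⟨x, hx⟩ := hne
  refine ⟨hd, l, hcl.isPreconnected_of_subset
    (M := ⋃ t, (cl (progressionUnion f B d l) ∪ f^[l + d * t] '' B')) ?_ ?_ ?_⟩
  · refine isPreconnected_iUnion ⟨f^[l] x, mem_iInter.2 fun t => Or.inl (hcl.subset _
      (iterate_mem_progressionUnion hx ⟨0, by simp⟩))⟩ fun t => ?_
    exact hl.union (f^[l + d * t] x) (hcl.subset _ (iterate_mem_progressionUnion hx ⟨t, rfl⟩))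
      ⟨x, hBB' hx, rfl⟩ (hB'.image _ (hf.iterate _).continuousOn)
  · exact iUnion_mono fun t => subset_union_right
  · exact iUnion_subset fun t => union_subset (hcl.mono (progressionUnion_mono hBB'))
      ((image_iterate_subset_progressionUnion t).trans (hcl.subset _))

/-- For the least period, the late images of `B` fall into disjoint connected classes. -/
theorem IsHull.exists_disjoint (hcl : IsHull cl) (hf : Continuous f) (hne : B.Nonempty) {k : ℕ}
    (hk : IsLeast (connPeriods f cl B) k) : ∃ l₀, ∀ l ≥ l₀,
      IsPreconnected (cl (progressionUnion f B k l)) ∧ ∀ j, 0 < j → j < k →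
        Disjoint (cl (progressionUnion f B k l)) (cl (progressionUnion f B k (l + j))) := by
  obtain ⟨⟨hk1, l₀, hl₀⟩, hmin⟩ := hk
  have hconn : ∀ l ≥ l₀, IsPreconnected (cl (progressionUnion f B k l)) := fun l hl =>
    hcl.isPreconnected_progressionUnion hf hl₀ hl
  refine ⟨l₀, fun L hL => ⟨hconn L hL, fun j hj hjk => ?_⟩⟩
  rw [← not_nonempty_iff_eq_empty.trans disjoint_iff_inter_eq_empty.symm]
  intro hmeet
  obtain ⟨x, hx⟩ := hne
  set g := Nat.gcd j k with hg
  have hg1 : 1 ≤ g := Nat.gcd_pos_of_pos_left k hj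
  have hgj : g ≤ j := Nat.gcd_le_left k hj
  have hmeet' : ∀ i, (cl (progressionUnion f B k (L + j * i)) ∩
      cl (progressionUnion f B k (L + j * (i + 1)))).Nonempty := by
    rintro i
    obtain ⟨p, hp, hp'⟩ := hmeet
    refine ⟨f^[j * i] p, hcl.image_progressionUnion_subset hf _ ⟨p, hp, rfl⟩, ?_⟩
    rw [show L + j * (i + 1) = L + j + j * i by ring]
    exact hcl.image_progressionUnion_subset hf _ ⟨p, hp', rfl⟩
  have hV : IsPreconnected (⋃ i, cl (progressionUnion f B k (L + j * i))) :=
    IsPreconnected.iUnion_of_chain (fun i => hconn _ (by omega)) hmeet'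
  have hsub : ∀ s, g ∣ s → cl (progressionUnion f B k (L + s)) ⊆
      cl (progressionUnion f B g L) := by
    rintro _ ⟨s, rfl⟩
    obtain ⟨k', hk'⟩ := Nat.gcd_dvd_right j k
    refine hcl.mono (progressionUnion_subset fun t => ⟨s + k' * t, ?_⟩)
    rw [← hg] at hk'
    rw [hk']
    ring
  have hbez : ∀ s, ∃ i r, j * i = g * s + k * r := by
    obtain ⟨m, -, hm⟩ := Nat.exists_mul_mod_eq_gcd (k := k) (n := j) (by rw [← hg]; omega)
    intro s
    have h1 : j * m = g + k * (j * m / k) := by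
      conv_lhs => rw [← Nat.mod_add_div (j * m) k, hm]
    exact ⟨m * s, j * m / k * s, by linear_combination s * h1⟩
  refine (Nat.lt_of_le_of_lt hgj hjk).not_ge (hmin ⟨hg1, L, hcl.isPreconnected_of_subset
    (M := ⋃ s, ((⋃ i, cl (progressionUnion f B k (L + j * i))) ∪
      cl (progressionUnion f B k (L + g * s)))) ?_ ?_ ?_⟩)
  · refine isPreconnected_iUnion ⟨f^[L] x, mem_iInter.2 fun s => Or.inl (mem_iUnion.2
      ⟨0, hcl.subset _ (iterate_mem_progressionUnion hx ⟨0, by simp⟩)⟩)⟩ fun s => ?_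
    obtain ⟨i, r, hir⟩ := hbez s
    refine hV.union (f^[L + j * i] x) (mem_iUnion.2
      ⟨i, hcl.subset _ (iterate_mem_progressionUnion hx ⟨0, by simp⟩)⟩) ?_ (hconn _ (by omega))
    exact hcl.subset _ (iterate_mem_progressionUnion hx ⟨r, by rw [hir]; ring⟩)
  · refine iUnion_subset fun s => ?_
    refine subset_trans ?_ (subset_iUnion _ s)
    refine subset_trans ?_ subset_union_right
    exact (image_iterate_subset_progressionUnion (l := L + g * s) 0).trans (hcl.subset _)
  · refine iUnion_subset fun s => union_subset (iUnion_subset fun i => hsub _ ?_)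
      (hsub _ (Dvd.intro _ rfl))
    exact (Nat.gcd_dvd_left j k).mul_right i

end Conn

section

variable {X : Type*} [MetricSpace X] {f : X → X} {x : X} {B : ℕ → Set X}

/-- Images of small neighbourhoods of a point with infinite `ω`-limit set avoid a given periodic
point. -/
theorem NoHorseshoe.exists_notMem_image (hX : IsTopGraph X) (h : NoHorseshoe f)
    (hf : Continuous f) (hinf : (omegaSet f x).Infinite) (hB : IsConnBasis x B) {c : X} {q : ℕ}
    (hq : 1 ≤ q) (hc : f^[q] c = c) : ∃ n, ∀ m ≥ n, ∀ p, c ∉ f^[p] '' B m := by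
  have := hX.1
  obtain ⟨φ, r, hφ, hr, hr01, hrω⟩ := hX.exists_chart_seq hinf
  have lt : ∀ i j, i < j → r i < r j := fun i j h => hr h
  have hP : ∀ i, f^[i] c ∈ (fun i => f^[i] c) '' Iio q := fun i =>
    ⟨i % q, Nat.mod_lt _ hq, Function.IsPeriodicPt.iterate_mod_apply hc i⟩
  have hT : (Icc (0:ℝ) 1 ∩ φ ⁻¹' ((fun i => f^[i] c) '' Iio q)).Finite := by
    refine Set.Finite.of_finite_image (((finite_Iio q).image _).subset
      ((image_mono inter_subset_right).trans (image_preimage_subset φ _)))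
      (hφ.inj.mono inter_subset_left)
  obtain ⟨K, hK⟩ : ∃ K, ∀ t ∈ Icc (0:ℝ) 1 ∩ φ ⁻¹' ((fun i => f^[i] c) '' Iio q),
      t < r K ∨ ∀ k, r k < t := by
    refine (((hT.eventually_all (l := atTop)).2 fun t _ => ?_).exists)
    by_cases hcase : ∀ k, r k < t
    · exact Eventually.of_forall fun _ => Or.inr hcase
    · push Not at hcase
      obtain ⟨k, hk⟩ := hcase
      filter_upwards [eventually_gt_atTop k] with k' hk'
      exact Or.inl (hk.trans_lt (lt _ _ hk'))
  obtain ⟨i₁, i₂, hne, h1, h2⟩ := exists_two_iterates_mem hφ hr hr01 hrω K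
  obtain ⟨j₁, j₂, hne', h3, h4⟩ := exists_two_iterates_mem hφ hr hr01 hrω (K + 6)
  obtain ⟨n₁, hn₁⟩ := h.exists_not_subset hf hB hne
    (hφ.image_Icc_mem_nhds (hr01 _).1.le (hr01 _).2.le h1)
    (hφ.image_Icc_mem_nhds (hr01 _).1.le (hr01 _).2.le h2)
  obtain ⟨n₂, hn₂⟩ := h.exists_not_subset hf hB hne'
    (hφ.image_Icc_mem_nhds (hr01 _).1.le (hr01 _).2.le h3)
    (hφ.image_Icc_mem_nhds (hr01 _).1.le (hr01 _).2.le h4)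
  refine ⟨max n₁ n₂, fun m hm p hcp => ?_⟩
  obtain ⟨p', hp', u, hu, hue⟩ := exists_mem_of_mem_omegaSet hφ (hr01 (K + 4)).1.le
    (hr01 (K + 6)).2.le ⟨lt (K + 4) (K + 5) (by omega), lt (K + 5) (K + 6) (by omega)⟩ rfl
    (hrω (K + 5)) p
  have hcm : f^[p' - p] c ∈ f^[p'] '' B m := by
    have := iterate_mem_image hcp (p' - p)
    rwa [Nat.sub_add_cancel hp'] at this
  have hKu : r K < u := (lt _ _ (by omega)).trans hu.1
  have huK : u < r (K + 6 + 4) := hu.2.trans (lt _ _ (by omega))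
  have hnot : ¬ f^[p'] '' B m ⊆ φ '' Ioo (r K) (r (K + 6 + 4)) := fun hsub => by
    obtain ⟨t, ht, hte⟩ := hsub hcm
    rcases hK t ⟨⟨(hr01 K).1.le.trans ht.1.le, ht.2.le.trans (hr01 _).2.le⟩,
      mem_preimage.2 (hte ▸ hP _)⟩ with hlt | hgt
    · exact hlt.not_gt ht.1
    · exact (hgt _).not_gt ht.2
  rcases hφ.image_Icc_subset_or ((hB.preconn m).image _ (hf.iterate p').continuousOn)
    (hr01 K).1.le hKu.le huK.le (hr01 _).2.le (hue ▸ ⟨x, hB.mem m, rfl⟩) hnot with hs | hs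
  · exact hn₁ m ((le_max_left _ _).trans hm) p'
      ((image_mono (Icc_subset_Icc_right hu.1.le)).trans hs)
  · exact hn₂ m ((le_max_right _ _).trans hm) p'
      ((image_mono (Icc_subset_Icc_left hu.2.le)).trans hs)

/-- The late images of a neighbourhood containing a non-asymptotic pair return to one another. -/
theorem IsTopGraph.connPeriods_nonempty (hX : IsTopGraph X) (hf : Continuous f) {y : X}
    {B : Set X} (hB : IsPreconnected B) (hx : x ∈ B) (hy : y ∈ B) (h : ¬ Asymptotic f x y) :
    (connPeriods f (fun S => S) B).Nonempty := by
  obtain ⟨ε, hε, hfr⟩ := exists_frequently_le_dist_of_not_asymptotic h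
  obtain ⟨F, hF, hFd⟩ := hX.exists_finite_dist_lt hε
  obtain ⟨p, -, hp⟩ : ∃ p ∈ F, ∃ᶠ l in atTop, p ∈ f^[l] '' B := by
    by_contra! hcon
    refine hfr (((hF.eventually_all).2 hcon).mono fun l hl => ?_)
    refine (hFd _ (hB.image _ (hf.iterate l).continuousOn) ?_ _ ⟨x, hx, rfl⟩ _
      ⟨y, hy, rfl⟩).not_ge
    exact disjoint_left.2 fun p hp hpF => hl p hpF hp
  obtain ⟨l, -, hl⟩ := frequently_atTop.1 hp 0
  obtain ⟨l', hl', hpl'⟩ := frequently_atTop.1 hp (l + 1)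
  obtain ⟨r, rfl⟩ := Nat.exists_eq_add_of_lt hl'
  refine ⟨r + 1, by omega, l, IsPreconnected.iUnion_of_chain
    (fun t => hB.image _ (hf.iterate _).continuousOn) fun t => ?_⟩
  refine ⟨f^[(r + 1) * t] p, ?_, ?_⟩
  · have := iterate_mem_image hl ((r + 1) * t)
    rwa [add_comm] at this
  · have := iterate_mem_image hpl' ((r + 1) * t)
    rwa [show (r + 1) * t + (l + r + 1) = l + (r + 1) * (t + 1) by ring] at this

end

section

variable {X : Type*} [MetricSpace X] {f : X → X} {x : X} {B : ℕ → Set X}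
  {cl : Set X → Set X}

theorem IsHull.exists_isTrap (hcl : IsHull cl) (hf : Continuous f) (hB : IsConnBasis x B)
    (hconn : ∀ n, 1 ∈ connPeriods f cl (B n)) (hper : ∀ c q, 1 ≤ q → f^[q] c = c →
      ∃ n m, c ∉ cl (progressionUnion f (B n) 1 m)) : ∃ Z, IsTrap f x Z := by
  choose M hM using fun n => (hconn n).2
  set M' : ℕ → ℕ := fun n => n + ∑ i ∈ Finset.range (n + 1), M i
  have hM'M : ∀ n, M n ≤ M' n := fun n =>
    (Finset.single_le_sum (fun _ _ => Nat.zero_le _) (Finset.self_mem_range_succ n)).trans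
      (Nat.le_add_left _ _)
  have hM'mono : Monotone M' := fun a b hab => Nat.add_le_add hab
    (Finset.sum_le_sum_of_subset (Finset.range_mono (Nat.succ_le_succ hab)))
  have hanti : Antitone fun n => cl (progressionUnion f (B n) 1 (M' n)) := fun a b hab =>
    hcl.mono ((progressionUnion_mono (hB.anti hab)).trans (progressionUnion_one_anti (hM'mono hab)))
  refine ⟨fun n => cl (progressionUnion f (B n) 1 (M' n)),
    fun n => hcl.isPreconnected_progressionUnion hf (hM n) (hM'M n), hanti, fun n => ?_, fun n => ?_,
    fun c q hq hc => ?_⟩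
  · rw [mapsTo_iff_image_subset]
    exact (hcl.image_progressionUnion_subset hf 1).trans
      (hcl.mono (progressionUnion_one_anti (Nat.le_succ _)))
  · filter_upwards [eventually_ge_atTop (M' n)] with l hl
    exact hcl.subset _ (iterate_mem_progressionUnion (hB.mem n) ⟨l - M' n, by omega⟩)
  · obtain ⟨n, m, hnm⟩ := hper c q hq hc
    refine ⟨max n m, fun hmem => hnm (hcl.mono ?_ hmem)⟩
    exact (progressionUnion_mono (hB.anti (le_max_left n m))).trans
      (progressionUnion_one_anti ((le_max_right n m).trans (Nat.le_add_right _ _)))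

theorem exists_forall_of_frequently_antitone {P : ℕ → ℕ → Prop}
    (hanti : ∀ d, Antitone fun n => P n d) {N : ℕ} (h : ∃ᶠ n in atTop, ∃ d ≤ N, P n d) :
    ∃ d, ∀ n, P n d := by
  obtain ⟨d, hd⟩ : ∃ d, ∃ᶠ n in atTop, P n d := by
    by_contra! hcon
    refine h (((finite_Iic N).eventually_all.2 fun d _ => hcon d).mono fun n hn => ?_)
    rintro ⟨d, hd, hP⟩
    exact hn d hd hP
  refine ⟨d, fun n => ?_⟩
  obtain ⟨m, hm, hP⟩ := frequently_atTop.1 hd n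
  exact hanti d hm hP

/-- If the late images of the neighbourhoods of `x` accumulate at a periodic point, they have
boundedly many connected classes. -/
theorem IsConnBasis.exists_mem_connPeriods (hB : IsConnBasis x B) (hX : IsTopGraph X)
    (h : NoHorseshoe f) (hf : Continuous f) (hinf : (omegaSet f x).Infinite)
    (hne : ∀ n, (connPeriods f (fun S => S) (B n)).Nonempty) {c : X} {q : ℕ} (hq : 1 ≤ q)
    (hc : f^[q] c = c) (hcl : ∀ n m, c ∈ closure (progressionUnion f (B n) 1 m)) :
    ∃ d, ∀ n, d ∈ connPeriods f (fun S => S) (B n) := by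
  have hid := IsHull.id X
  obtain ⟨n₁, hn₁⟩ := h.exists_notMem_image hX hf hinf hB hq hc
  obtain ⟨C, hC, hCc, hCA⟩ := hX.exists_finite_chart_seq_tendsto
  set P : Set X := (fun i => f^[i] c) '' Iio q
  have hP : ∀ i, f^[i] c ∈ P := fun i =>
    ⟨i % q, Nat.mod_lt _ hq, Function.IsPeriodicPt.iterate_mod_apply hc i⟩
  set T : Set ((ℝ → X) × ℝ) := ⋃ φ ∈ C, Prod.mk φ '' (Icc 0 1 ∩ φ ⁻¹' P)
  have hT : T.Finite := hC.biUnion fun φ hφ => Set.Finite.image _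
    (Set.Finite.of_finite_image (((finite_Iio q).image _).subset
      ((image_mono inter_subset_right).trans (image_preimage_subset φ _)))
      ((hCc φ hφ).inj.mono inter_subset_left))
  refine exists_forall_of_frequently_antitone (N := T.ncard)
    (P := fun n d => d ∈ connPeriods f (fun S => S) (B n)) (fun d m n hmn hd =>
      hid.connPeriods_mono hf (hB.preconn m) ⟨x, hB.mem n⟩ (hB.anti hmn) hd) ?_
  refine Eventually.frequently ?_
  filter_upwards [eventually_ge_atTop n₁] with n hn
  set k := sInf (connPeriods f (fun S => S) (B n))
  have hk : IsLeast (connPeriods f (fun S => S) (B n)) k :=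
    ⟨Nat.sInf_mem (hne n), fun d hd => Nat.sInf_le hd⟩
  refine ⟨k, ?_, hk.1⟩
  obtain ⟨l₀, hl₀⟩ := hid.exists_disjoint hf ⟨x, hB.mem n⟩ hk
  have hgerm : ∀ j < k, ∃ g ∈ T, ∃ σ < g.2,
      g.1 '' Ioo σ g.2 ⊆ progressionUnion f (B n) k (l₀ + j) := by
    intro j hj
    obtain ⟨i, hi⟩ : ∃ i, f^[i] c ∈ closure (progressionUnion f (B n) k (l₀ + j)) := by
      have := hcl n l₀
      rw [progressionUnion_one_eq hk.1.1, (finite_Iio k).closure_biUnion] at this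
      simp only [mem_iUnion, mem_Iio] at this
      obtain ⟨j', hj', hcj'⟩ := this
      refine ⟨k + j - j', closure_mono (progressionUnion_add_mul_subset 1) ?_⟩
      have := (IsHull.closure X).image_progressionUnion_subset hf (k + j - j')
        (mem_image_of_mem _ hcj')
      rwa [show l₀ + j' + (k + j - j') = l₀ + j + k * 1 by omega] at this
    have hni : f^[i] c ∉ progressionUnion f (B n) k (l₀ + j) := by
      intro hmem
      obtain ⟨t, ht⟩ := mem_iUnion.1 hmem
      refine hn₁ n hn (q * i - i + (l₀ + j + k * t)) ?_
      have := iterate_mem_image ht (q * i - i)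
      rwa [← Function.iterate_add_apply, Nat.sub_add_cancel (Nat.le_mul_of_pos_left i hq),
        (show f^[q * i] c = c from Function.IsPeriodicPt.mul_const hc i)] at this
    obtain ⟨φ, hφC, r, ρ, hr, hr01, hrW, hrρ, hρ1, hltρ, hφρ⟩ := hCA _ _ hi hni
    have hφ := hCc φ hφC
    refine ⟨(φ, ρ), mem_biUnion hφC ⟨ρ, ⟨⟨(hr01 0).1.le.trans (hltρ 0).le, hρ1⟩,
      mem_preimage.2 (hφρ ▸ hP i)⟩, rfl⟩, r 0, hltρ 0, ?_⟩
    rintro _ ⟨s, hs, rfl⟩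
    by_contra hsW
    obtain ⟨m, hm⟩ := (hrρ.eventually_const_lt hs.2).exists
    have hs0 : 0 ≤ s := (hr01 0).1.le.trans hs.1.le
    have := hφ.subset_of_notMem (hl₀ (l₀ + j) (by omega)).1 hs0 hm (hltρ m) hρ1 (hrW m) hsW
      (hφρ ▸ hni) (hrW 0)
    exact ((hφ.mem_image_Ioo hs0 hρ1 (Ioo_subset_Icc_self (hr01 0))).1 this).1.not_gt hs.1
  have : Nonempty X := ⟨x⟩
  choose! g hgT σ hσ hgW using hgerm
  have key : ∀ j j', j < j' → j' < k → g j ≠ g j' := by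
    intro j j' hjj' hj' he
    have hj := hjj'.trans hj'
    have hlt : max (σ j) (σ j') < (g j).2 := max_lt (hσ j hj) (he ▸ hσ j' hj')
    obtain ⟨s, hs1, hs2⟩ := exists_between hlt
    refine disjoint_left.1 ((hl₀ (l₀ + j) (by omega)).2 (j' - j) (by omega) (by omega))
      (hgW j hj ⟨s, ⟨(le_max_left _ _).trans_lt hs1, hs2⟩, rfl⟩) ?_
    rw [show l₀ + j + (j' - j) = l₀ + j' by omega, he]
    exact hgW j' hj' ⟨s, ⟨(le_max_right _ _).trans_lt hs1, he ▸ hs2⟩, rfl⟩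
  have := ncard_le_ncard_of_injOn (s := Iio k) g (fun j hj => hgT j hj) (fun j hj j' hj' he => by
    rcases lt_trichotomy j j' with hlt | hlt | hlt
    · exact (key j j' hlt hj' he).elim
    · exact hlt
    · exact (key j' j hlt hj he.symm).elim) hT
  simpa [Set.ncard_eq_toFinset_card'] using this

theorem IsHull.false_of_forall_one_mem (hcl : IsHull cl) (hX : IsTopGraph X) (h : NoHorseshoe f)
    (hf : Continuous f) (hinf : (omegaSet f x).Infinite) (hB : IsConnBasis x B)
    (hscr : ∀ n, ∃ y ∈ B n, ScrambledPair f x y) (hconn : ∀ n, 1 ∈ connPeriods f cl (B n))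
    (hper : ∀ c q, 1 ≤ q → f^[q] c = c → ∃ n m, c ∉ cl (progressionUnion f (B n) 1 m)) :
    False :=
  let ⟨_, hZ⟩ := hcl.exists_isTrap hf hB hconn hper
  hZ.false hX h hf hinf hB hscr

theorem IsHull.one_mem_connPeriods (hcl : IsHull cl) (hf : Continuous f) {B : Set X} {d : ℕ}
    (hd : d ∈ connPeriods f cl B) : 1 ∈ connPeriods f^[d] cl B := by
  obtain ⟨hd, l, hl⟩ := hd
  refine ⟨le_rfl, l, ?_⟩
  rw [progressionUnion_iterate]
  exact hcl.isPreconnected_progressionUnion hf hl (Nat.le_mul_of_pos_left l hd)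

theorem IsConnBasis.false_of_forall_mem (hB : IsConnBasis x B) (hX : IsTopGraph X)
    (h : NoHorseshoe f) (hf : Continuous f) (hinf : (omegaSet f x).Infinite)
    (hscr : ∀ n, ∃ y ∈ B n, ScrambledPair f x y) {d : ℕ}
    (hd : ∀ n, d ∈ connPeriods f closure (B n)) : False := by
  have := hX.1
  have lift : ∀ {f : X → X}, Continuous f → (∀ n, ∃ y ∈ B n, ScrambledPair f x y) → ∀ {d}, 1 ≤ d →
      ∀ n, ∃ y ∈ B n, ScrambledPair f^[d] x y := fun hf hs _ hd n =>
    let ⟨y, hy, hxy⟩ := hs n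
    ⟨y, hy, hxy.iterate hf hd⟩
  have hd1 := (hd 0).1
  have hfd := hf.iterate d
  have hinfd := omegaSet_iterate_infinite hf hd1 hinf
  have hscrd := lift hf hscr hd1
  have hd' := h.iterate hd1
  by_cases hper : ∀ c q, 1 ≤ q → (f^[d])^[q] c = c →
      ∃ n m, c ∉ closure (progressionUnion f^[d] (B n) 1 m)
  · exact (IsHull.closure X).false_of_forall_one_mem hX hd' hfd hinfd hB hscrd
      (fun n => (IsHull.closure X).one_mem_connPeriods hf (hd n)) hper
  · push Not at hper
    obtain ⟨c, q, hq, hc, hcl⟩ := hper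
    obtain ⟨e, he⟩ := hB.exists_mem_connPeriods hX hd' hfd hinfd (fun n =>
      let ⟨y, hy, hxy⟩ := hscrd n
      hX.connPeriods_nonempty hfd (hB.preconn n) (hB.mem n) hy hxy.2) hq hc hcl
    have he1 := (he 0).1
    refine (IsHull.id X).false_of_forall_one_mem hX (hd'.iterate he1) (hfd.iterate e)
      (omegaSet_iterate_infinite hfd he1 hinfd) hB (lift hfd hscrd he1)
      (fun n => (IsHull.id X).one_mem_connPeriods hfd (he n)) fun c q hq hc => ?_
    obtain ⟨n, hn⟩ := (hd'.iterate he1).exists_notMem_image hX (hfd.iterate e)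
      (omegaSet_iterate_infinite hfd he1 hinfd) hB hq hc
    exact ⟨n, 0, fun hmem => by
      obtain ⟨t, ht⟩ := mem_iUnion.1 hmem
      exact hn n le_rfl _ ht⟩

end

theorem isPreconnected_iInter_of_antitone {X : Type*} [TopologicalSpace X] [CompactSpace X]
    [T2Space X] {E : ℕ → Set X} (hE : ∀ t, IsPreconnected (E t)) (hEc : ∀ t, IsClosed (E t))
    (hanti : Antitone E) : IsPreconnected (⋂ t, E t) := by
  rw [isPreconnected_iff_subset_of_fully_disjoint_closed (isClosed_iInter hEc)]
  intro u v hu hv hsub hdisj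
  obtain ⟨U, V, hU, hV, huU, hvV, hUV⟩ := normal_separation hu hv hdisj
  obtain ⟨t, ht⟩ := exists_subset_nhds_of_isCompact (V := E) hanti.directed_ge
    (fun t => (hEc t).isCompact) (U := U ∪ V) fun p hp =>
      (hU.union hV).mem_nhds (union_subset_union huU hvV (hsub hp))
  have hsep : ∀ {U V u v : Set X}, E t ⊆ U → Disjoint U V → v ⊆ V → (⋂ t, E t) ⊆ u ∪ v →
      (⋂ t, E t) ⊆ u := fun h hd hv hs p hp => (hs hp).resolve_right fun hpv =>
    disjoint_left.1 hd (h (mem_iInter.1 hp t)) (hv hpv)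
  rcases (isPreconnected_iff_subset_of_disjoint.1 (hE t)) U V hU hV ht
    (by rw [hUV.inter_eq, inter_empty]) with h | h
  · exact Or.inl (hsep h hUV hvV hsub)
  · exact Or.inr (hsep h hUV.symm huU (by rwa [union_comm] at hsub))

theorem image_iInter_of_antitone {X Y : Type*} [TopologicalSpace X] [CompactSpace X]
    [TopologicalSpace Y] [T1Space Y] {g : X → Y} (hg : Continuous g) {E : ℕ → Set X}
    (hEc : ∀ t, IsClosed (E t)) (hanti : Antitone E) : g '' ⋂ t, E t = ⋂ t, g '' E t := by
  refine subset_antisymm (image_iInter_subset _ _) fun z hz => ?_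
  obtain ⟨p, hp⟩ := IsCompact.nonempty_iInter_of_sequence_nonempty_isCompact_isClosed
    (fun t => E t ∩ g ⁻¹' {z}) (fun t => inter_subset_inter_left _ (hanti t.le_succ))
    (fun t => (mem_iInter.1 hz t))
    ((hEc 0).inter (isClosed_singleton.preimage hg)).isCompact
    fun t => (hEc t).inter (isClosed_singleton.preimage hg)
  rw [mem_iInter] at hp
  exact ⟨p, mem_iInter.2 fun t => (hp t).1, (hp 0).2⟩

/-- A decomposition of `Q` into `k` disjoint connected closed sets cyclically permuted by `f`. -/
structure IsCyclicCover {X : Type*} [TopologicalSpace X] (f : X → X) (Q : Set X) (k : ℕ)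
    (K : ℕ → Set X) : Prop where
  pos : 1 ≤ k
  closed : ∀ l, IsClosed (K l)
  preconn : ∀ l, IsPreconnected (K l)
  image : ∀ i l, f^[i] '' K l = K (l + i)
  period : ∀ l s, K (l + k * s) = K l
  disj : ∀ l j, 0 < j → j < k → Disjoint (K l) (K (l + j))
  eq : Q = ⋃ l, K l

theorem exists_isCyclicCover {X : Type*} [TopologicalSpace X] [CompactSpace X] [T2Space X]
    {f : X → X} (hf : Continuous f) {B : Set X} (hne : B.Nonempty) {k : ℕ}
    (hk : IsLeast (connPeriods f closure B) k) :
    ∃ K, IsCyclicCover f (⋂ m, closure (progressionUnion f B 1 m)) k K := by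
  obtain ⟨l₀, hl₀⟩ := (IsHull.closure X).exists_disjoint hf hne hk
  set E : ℕ → Set X := fun l => closure (progressionUnion f B k l)
  have hE : ∀ l, Antitone fun t => E (l + k * t) := fun l => antitone_nat_of_succ_le fun t =>
    closure_mono (by
      have := progressionUnion_add_mul_subset (f := f) (B := B) (d := k) (l := l + k * t) 1
      rwa [show l + k * t + k * 1 = l + k * (t + 1) by ring] at this)
  have hEc : ∀ l t, IsClosed (E (l + k * t)) := fun l t => isClosed_closure
  have hper : ∀ l s, ⋂ t, E (l + k * s + k * t) = ⋂ t, E (l + k * t) := by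
    intro l s
    refine subset_antisymm (subset_iInter fun t => ?_) (subset_iInter fun t => ?_)
    · refine (iInter_subset _ t).trans ?_
      rw [show l + k * s + k * t = l + k * (s + t) by ring]
      exact hE l (Nat.le_add_left _ _)
    · rw [show l + k * s + k * t = l + k * (s + t) by ring]
      exact iInter_subset _ _
  refine ⟨fun l => ⋂ t, E (l₀ + l + k * t), hk.1.1, fun l => isClosed_iInter (hEc _), fun l => ?_,
    fun i l => ?_, fun l s => ?_, fun l j hj hjk => ?_, ?_⟩
  · exact isPreconnected_iInter_of_antitone (fun t => (hl₀ _ (by omega)).1) (hEc _) (hE _)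
  · rw [image_iInter_of_antitone (hf.iterate i) (hEc _) (hE _)]
    refine iInter_congr fun t => ?_
    rw [← (hf.iterate i).isClosedMap.closure_image_eq_of_continuous (hf.iterate i),
      image_iterate_progressionUnion, show l₀ + l + k * t + i = l₀ + (l + i) + k * t by ring]
  · simp only [← add_assoc]
    exact hper _ s
  · have := (hl₀ (l₀ + l) (by omega)).2 j hj hjk
    refine this.mono ((iInter_subset _ 0).trans (by simp [E])) ((iInter_subset _ 0).trans ?_)
    simp [E, add_assoc]
  · refine subset_antisymm (fun p hp => ?_) (iUnion_subset fun l => subset_iInter fun m =>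
      (iInter_subset _ m).trans (closure_mono (progressionUnion_subset fun t =>
        ⟨l₀ + l + k * m + k * t - m, ?_⟩)))
    · by_contra hcon
      simp only [mem_iUnion, mem_iInter, not_exists, not_forall] at hcon
      choose t ht using hcon
      have := mem_iInter.1 hp (l₀ + k * (Finset.range k).sup t)
      rw [progressionUnion_one_eq hk.1.1, (finite_Iio k).closure_biUnion] at this
      simp only [mem_iUnion, mem_Iio] at this
      obtain ⟨j, hj, hpj⟩ := this
      refine ht j (hE (l₀ + j) (Finset.le_sup (Finset.mem_range.2 hj)) ?_)
      rwa [show l₀ + k * (Finset.range k).sup t + j = l₀ + j + k * (Finset.range k).sup t by ring]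
        at hpj
    · have := Nat.le_mul_of_pos_left m hk.1.1
      omega

section

variable {X : Type*} [MetricSpace X] {f : X → X} {Q : Set X} {k : ℕ} {K : ℕ → Set X}

theorem IsCyclicCover.congr (h : IsCyclicCover f Q k K) {l l' : ℕ} (hl : l ≡ l' [MOD k]) :
    K l = K l' := by
  rw [← Nat.mod_add_div l k, ← Nat.mod_add_div l' k, h.period, h.period, hl]

theorem IsCyclicCover.exists_eq_add (h : IsCyclicCover f Q k K) (e l : ℕ) :
    ∃ j < k, K e = K (l + j) := by
  refine ⟨(e + k * l - l) % k, Nat.mod_lt _ h.pos, ?_⟩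
  have hle := Nat.le_mul_of_pos_left l h.pos
  have hdiv := Nat.mod_add_div (e + k * l - l) k
  have : l + (e + k * l - l) % k + k * ((e + k * l - l) / k) = e + k * l := by omega
  rw [← h.period e l, ← h.period (l + _ % k) ((e + k * l - l) / k), this]

theorem IsCyclicCover.iterate_mem (h : IsCyclicCover f Q k K) {l : ℕ} {p : X} (hp : p ∈ K l)
    (i : ℕ) : f^[i] p ∈ K (l + i) := h.image i l ▸ mem_image_of_mem _ hp

theorem IsCyclicCover.dvd_of_iterate_eq (h : IsCyclicCover f Q k K) {u : X} (hu : u ∈ Q) {i j : ℕ}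
    (hij : f^[i] u = f^[i + j] u) : k ∣ j := by
  rw [h.eq, mem_iUnion] at hu
  obtain ⟨l, hl⟩ := hu
  by_contra hdvd
  have h1 := h.iterate_mem hl i
  have h2 := h.iterate_mem hl (i + j)
  rw [← hij, ← add_assoc, h.congr ((Nat.mod_modEq j k).symm.add_left _)] at h2
  exact disjoint_left.1 (h.disj (l + i) (j % k)
    (Nat.pos_of_ne_zero fun h0 => hdvd (Nat.dvd_of_mod_eq_zero h0)) (Nat.mod_lt _ h.pos)) h1 h2

theorem IsCyclicCover.exists_iterate_mem (h : IsCyclicCover f Q k K) (hX : IsTopGraph X)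
    {x y u : X} (hu : u ∈ jointLimitSet f x y) (hf : Continuous f) (huQ : u ∈ Q)
    (hinj : Function.Injective fun n => f^[n] u) :
    ∃ p l, f^[p] x ∈ K l ∧ f^[p] y ∈ K l := by
  rw [h.eq, mem_iUnion] at huQ
  obtain ⟨l, hl⟩ := huQ
  have hA : (range fun i => f^[k * i] u).Infinite := infinite_range_of_injective fun i j hij =>
    Nat.eq_of_mul_eq_mul_left h.pos (hinj hij)
  have hAK : (range fun i => f^[k * i] u) ⊆ K l := by
    rintro _ ⟨i, rfl⟩
    have := h.iterate_mem hl (k * i)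
    rwa [h.period] at this
  have enter : ∀ z, u ∈ omegaSet f z → ∃ p, ∀ i ≥ p, ∃ e, f^[i] z ∈ K e := by
    intro z hz
    obtain ⟨p, -, hp⟩ := hX.exists_iterate_mem (h.preconn l) hA hAK (by
      rintro _ ⟨i, rfl⟩
      exact iterate_mem_omegaSet hf hz _) 0
    refine ⟨p, fun i hi => ⟨l + (i - p), ?_⟩⟩
    have := h.iterate_mem hp (i - p)
    rwa [← Function.iterate_add_apply, Nat.sub_add_cancel hi] at this
  obtain ⟨p, hp⟩ := enter x (jointLimitSet_subset_left hu)
  obtain ⟨p', hp'⟩ := enter y (jointLimitSet_subset_right hu)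
  have hO : IsOpen (⋃ j ∈ Ioo 0 k, K (l + j))ᶜ :=
    ((finite_Ioo 0 k).isClosed_biUnion fun j _ => h.closed _).isOpen_compl
  obtain ⟨i, hi, hxi, hyi⟩ := hu _ hO (fun hmem => by
    simp only [mem_iUnion] at hmem
    obtain ⟨j, hj, hm⟩ := hmem
    exact disjoint_left.1 (h.disj l j hj.1 hj.2) hl hm) (max p p')
  have fin : ∀ z ∈ (⋃ j ∈ Ioo 0 k, K (l + j))ᶜ, (∃ e, z ∈ K e) → z ∈ K l := by
    rintro z hz ⟨e, he⟩
    obtain ⟨j, hj, hej⟩ := h.exists_eq_add e l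
    rw [hej] at he
    rcases Nat.eq_zero_or_pos j with rfl | hj0
    · exact he
    · exact (hz (mem_biUnion (show j ∈ Ioo 0 k from ⟨hj0, hj⟩) he)).elim
  exact ⟨i, l, fin _ hxi (hp i ((le_max_left _ _).trans hi)),
    fin _ hyi (hp' i ((le_max_right _ _).trans hi))⟩

theorem IsCyclicCover.exists_mem_of_mem_omegaSet (h : IsCyclicCover f Q k K) {x y : X} {p l : ℕ}
    (hx : f^[p] x ∈ K l) (hy : f^[p] y ∈ K l) {w : X × X}
    (hw : w ∈ omegaSet (Prod.map f f) (x, y)) : ∃ j, w.1 ∈ K j ∧ w.2 ∈ K j := by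
  have hC : IsClosed (⋃ j ∈ Iio k, K (l + j) ×ˢ K (l + j)) :=
    (finite_Iio k).isClosed_biUnion fun j _ => (h.closed _).prod (h.closed _)
  have := omegaSet_subset_of_eventually hC (eventually_atTop.2 ⟨p, fun i hi => ?_⟩) hw
  · simp only [mem_iUnion] at this
    obtain ⟨j, -, hj⟩ := this
    exact ⟨_, hj⟩
  · obtain ⟨j, hj, he⟩ := h.exists_eq_add (l + (i - p)) l
    have hx' := h.iterate_mem hx (i - p)
    have hy' := h.iterate_mem hy (i - p)
    rw [← Function.iterate_add_apply, Nat.sub_add_cancel hi, he] at hx' hy'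
    refine mem_biUnion (show j ∈ Iio k from hj) ?_
    rw [Prod.map_iterate]
    exact ⟨hx', hy'⟩

theorem IsCyclicCover.isPeriodicSubgraph (h : IsCyclicCover f Q k K) (hX : IsTopGraph X) {l : ℕ}
    (hn : (K l).Nontrivial) : IsPeriodicSubgraph f (K l) k := by
  refine ⟨hX.isSubgraph (h.closed l) (h.preconn l) hn, h.pos, ?_, ?_⟩
  · have := h.period l 1
    rw [h.image, ← this, mul_one]
  · have key : ∀ i j, i < j → j < k → Disjoint (f^[i] '' K l) (f^[j] '' K l) := by
      intro i j hij hj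
      rw [h.image, h.image, show l + j = l + i + (j - i) by omega]
      exact h.disj _ _ (by omega) (by omega)
    intro i j hi hj hne
    rcases hne.lt_or_gt with hlt | hlt
    · exact key i j hlt hj
    · exact (key j i hlt hi).symm

theorem IsCyclicCover.subset_of_mem (h : IsCyclicCover f Q k K) {A : Set X} (hA : IsPreconnected A)
    (hAQ : A ⊆ Q) {l : ℕ} {p : X} (hpA : p ∈ A) (hpl : p ∈ K l) : A ⊆ K l := by
  have hC : IsClosed (⋃ j ∈ Ioo 0 k, K (l + j)) :=
    (finite_Ioo 0 k).isClosed_biUnion fun j _ => h.closed _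
  have hd : Disjoint (K l) (⋃ j ∈ Ioo 0 k, K (l + j)) :=
    disjoint_iUnion₂_right.2 fun j hj => h.disj l j hj.1 hj.2
  have hcov : A ⊆ K l ∪ ⋃ j ∈ Ioo 0 k, K (l + j) := by
    intro z hz
    obtain ⟨e, he⟩ := mem_iUnion.1 (h.eq ▸ hAQ hz)
    obtain ⟨j, hj, hej⟩ := h.exists_eq_add e l
    rw [hej] at he
    rcases Nat.eq_zero_or_pos j with rfl | hj0
    · exact Or.inl he
    · exact Or.inr (mem_biUnion (show j ∈ Ioo 0 k from ⟨hj0, hj⟩) he)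
  rcases isPreconnected_iff_subset_of_disjoint_closed.1 hA _ _ (h.closed l) hC hcov
    (by rw [hd.inter_eq, inter_empty]) with h1 | h1
  · exact h1
  · exact (disjoint_left.1 hd hpl (h1 hpA)).elim

theorem exists_mem_omegaSet_prod_ne [CompactSpace X] {x y : X} (h : ¬ Asymptotic f x y) :
    ∃ w ∈ omegaSet (Prod.map f f) (x, y), w.1 ≠ w.2 := by
  obtain ⟨ε, hε, hfr⟩ := exists_frequently_le_dist_of_not_asymptotic h
  by_contra! hcon
  refine hfr ((eventually_mem_of_omegaSet_subset (f := Prod.map f f) (x := (x, y))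
    (isOpen_lt continuous_dist continuous_const : IsOpen {w : X × X | dist w.1 w.2 < ε})
    fun w hw => ?_).mono fun l hl => ?_)
  · simpa [hcon w hw] using hε
  · rw [Prod.map_iterate] at hl
    exact not_le.2 hl

theorem mem_omegaSet_of_mem_omegaSet_prod {x y : X} {w : X × X}
    (hw : w ∈ omegaSet (Prod.map f f) (x, y)) : w.1 ∈ omegaSet f x ∧ w.2 ∈ omegaSet f y := by
  rw [mem_omegaSet_iff] at hw
  refine ⟨mem_omegaSet_iff.2 fun U hU hwU N => ?_, mem_omegaSet_iff.2 fun U hU hwU N => ?_⟩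
  · obtain ⟨m, hm, h⟩ := hw _ (hU.preimage continuous_fst) hwU N
    rw [Prod.map_iterate] at h
    exact ⟨m, hm, h⟩
  · obtain ⟨m, hm, h⟩ := hw _ (hU.preimage continuous_snd) hwU N
    rw [Prod.map_iterate] at h
    exact ⟨m, hm, h⟩

theorem IsConnBasis.exists_isNSPair {x y : X} {B : ℕ → Set X} (hB : IsConnBasis x B)
    (hX : IsTopGraph X) (hf : Continuous f) (hxy : ScrambledPair f x y)
    (hne : ∀ n, (connPeriods f closure (B n)).Nonempty)
    (hunb : ∀ N, ∃ n, ∀ d ∈ connPeriods f closure (B n), N ≤ d) : ∃ v w, IsNSPair f v w := by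
  have := hX.1
  have hleast : ∀ n, IsLeast (connPeriods f closure (B n)) (sInf (connPeriods f closure (B n))) :=
    fun n => ⟨Nat.sInf_mem (hne n), fun d hd => Nat.sInf_le hd⟩
  have hbound : ∀ N, ∃ n, N ≤ sInf (connPeriods f closure (B n)) := fun N =>
    let ⟨n, hn⟩ := hunb N
    ⟨n, hn _ (hleast n).1⟩
  have hmono : Monotone fun n => sInf (connPeriods f closure (B n)) := fun m n hmn =>
    (hleast m).2 ((IsHull.closure X).connPeriods_mono hf (hB.preconn m) ⟨x, hB.mem n⟩
      (hB.anti hmn) (hleast n).1)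
  choose K hK using fun n => exists_isCyclicCover hf ⟨x, hB.mem n⟩ (hleast n)
  obtain ⟨u, hu⟩ := hxy.1.jointLimitSet_nonempty
  have huQ : ∀ n, u ∈ ⋂ m, closure (progressionUnion f (B n) 1 m) := by
    intro n
    refine iInter_mono (fun m => closure_mono ?_) (jointLimitSet_subset_left hu)
    rintro _ ⟨l, hl, rfl⟩
    exact iterate_mem_progressionUnion (hB.mem n) ⟨l - m, by simp only [mem_Ici] at hl; omega⟩
  have hinj : Function.Injective fun n => f^[n] u := by
    have key : ∀ i j, i < j → f^[i] u ≠ f^[j] u := by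
      intro i j hij he
      obtain ⟨s, rfl⟩ := Nat.exists_eq_add_of_lt hij
      obtain ⟨n, hn⟩ := hbound (s + 2)
      have : sInf (connPeriods f closure (B n)) ≤ s + 1 :=
        Nat.le_of_dvd (by omega) ((hK n).dvd_of_iterate_eq (huQ n) (j := s + 1) he)
      omega
    intro i j hij
    rcases lt_trichotomy i j with hlt | hlt | hlt
    · exact (key i j hlt hij).elim
    · exact hlt
    · exact (key j i hlt hij.symm).elim
  obtain ⟨w, hw, hw12⟩ := exists_mem_omegaSet_prod_ne hxy.2
  have hmem : ∀ n, ∃ l, w.1 ∈ K n l ∧ w.2 ∈ K n l := fun n =>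
    let ⟨_, _, h1, h2⟩ := (hK n).exists_iterate_mem hX hu hf (huQ n) hinj
    (hK n).exists_mem_of_mem_omegaSet h1 h2 hw
  choose l hl using hmem
  refine ⟨w.1, w.2, hw12, mem_iUnion.2 ⟨x, (mem_omegaSet_of_mem_omegaSet_prod hw).1⟩,
    mem_iUnion.2 ⟨y, (mem_omegaSet_of_mem_omegaSet_prod hw).2⟩, fun n => K n (l n), _,
    fun n => (hK n).isPeriodicSubgraph hX ⟨_, (hl n).1, _, (hl n).2, hw12⟩, fun n => ?_,
    tendsto_atTop_atTop_of_monotone hmono hbound, hl⟩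
  refine (hK n).subset_of_mem ((hK (n + 1)).preconn _) ?_ (hl (n + 1)).1 (hl n).1
  have hsub : K (n + 1) (l (n + 1)) ⊆ ⋂ m, closure (progressionUnion f (B (n + 1)) 1 m) := by
    rw [(hK (n + 1)).eq]
    exact subset_iUnion _ _
  exact hsub.trans <| iInter_mono fun m => closure_mono (progressionUnion_mono (hB.anti n.le_succ))

end

theorem LiYorkeChaotic.exists_isNSPair {X : Type*} [MetricSpace X] {f : X → X} (hX : IsTopGraph X)
    (h : NoHorseshoe f) (hf : Continuous f) (hLY : LiYorkeChaotic f) : ∃ v w, IsNSPair f v w := by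
  have := hX.1
  have := hX.locallyConnectedSpace
  obtain ⟨S, hS, hscr⟩ := hLY
  have hfin : {x ∈ S | (omegaSet f x).Finite}.Subsingleton := by
    intro x hx y hy
    by_contra hne
    have hxy := hscr x hx.1 y hy.1 hne
    exact hxy.2 (hxy.1.asymptotic_of_finite hf hx.2 hy.2)
  have hT : ¬ {x ∈ S | (omegaSet f x).Infinite}.Countable := fun hT =>
    hS ((hT.union hfin.finite.countable).mono fun x hx => by
      by_cases hx' : (omegaSet f x).Finite
      · exact Or.inr ⟨hx, hx'⟩
      · exact Or.inl ⟨hx, hx'⟩)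
  set T := {x ∈ S | (omegaSet f x).Infinite}
  obtain ⟨x, hxT, hx⟩ : ∃ x ∈ T, {x} ∉ 𝓝[T] x := by
    by_contra! hcon
    obtain ⟨t, -, ht, hTt⟩ := TopologicalSpace.countable_cover_nhdsWithin hcon
    exact hT (ht.mono (by simpa using hTt))
  obtain ⟨B, hB⟩ := exists_isConnBasis x
  have hpair : ∀ n, ∃ y ∈ B n, ScrambledPair f x y := by
    intro n
    by_contra! hcon
    refine hx (mem_nhdsWithin.2 ⟨B n, hB.isOpen n, hB.mem n, fun y hy => ?_⟩)
    by_contra hne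
    exact hcon y hy.1 (hscr x hxT.1 y hy.2.1 (Ne.symm hne))
  have hne : ∀ n, (connPeriods f closure (B n)).Nonempty := by
    intro n
    obtain ⟨y, hy, hxy⟩ := hpair n
    obtain ⟨d, hd⟩ := hX.connPeriods_nonempty hf (hB.preconn n) (hB.mem n) hy hxy.2
    exact ⟨d, hd.1, hd.2.imp fun l hl => hl.closure⟩
  by_cases hunb : ∀ N, ∃ n, ∀ d ∈ connPeriods f closure (B n), N ≤ d
  · obtain ⟨y, -, hxy⟩ := hpair 0
    exact hB.exists_isNSPair hX hf hxy hne hunb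
  · push Not at hunb
    obtain ⟨N, hN⟩ := hunb
    obtain ⟨d, hd⟩ := exists_forall_of_frequently_antitone
      (P := fun n d => d ∈ connPeriods f closure (B n)) (N := N)
      (fun d m n hmn hd => (IsHull.closure X).connPeriods_mono hf (hB.preconn m)
        ⟨x, hB.mem n⟩ (hB.anti hmn) hd)
      (Eventually.of_forall fun n => (hN n).imp fun d hd => ⟨hd.2.le, hd.1⟩).frequently
    exact (hB.false_of_forall_mem hX h hf hxT.2 hpair hd).elim

/-- A graph map with zero topological entropy is Li–Yorke chaotic if and only if
it has an NS-pair. -/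
theorem liYorkeChaotic_iff_exists_nsPair {G : Type*} [MetricSpace G]
    (hG : IsTopGraph G) (f : G → G) (hf : Continuous f)
    (hent : Dynamics.coverEntropy f Set.univ = 0) :
    LiYorkeChaotic f ↔ ∃ x y : G, IsNSPair f x y := by
  have h := NoHorseshoe.of_coverEntropy hent
  have := hG.1
  exact ⟨fun hLY => hLY.exists_isNSPair hG h hf, fun ⟨_, _, hxy⟩ => hxy.liYorkeChaotic hG hf⟩
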